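/- Let f satisfy condition (f). Then for almost all x ∈ [A,B]: limsup_{N→∞} |Σ_{n=1}^N f(ξ x^{s_n})| / √(N log log N) = √2 · ‖f‖. -/

import Mathlib

open MeasureTheory Filter

/-- The `L²` norm of `f` over `[A,B]`. -/
noncomputable def fnorm (A B : ℝ) (f : ℝ → ℝ) : ℝ :=
  Real.sqrt (∫ x in A..B, (f x) ^ 2)

/-- The natural logarithm, interpreted as `max {1, log x}`. -/
noncomputable def plog (x : ℝ) : ℝ := max 1 (Real.log x)

open MeasureTheory Filter

/-- splitting lemma for sparse polynomials -/
theorem osc_split (p : ℕ) : ∀ (T : Finset ℕ) (c : ℕ → ℝ) (e : ℕ → ℕ) (a₀ b₀ τ κ : ℝ)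
    (F : ℝ → ℝ → ℝ), T.Nonempty → T.card ≤ p + 1 → (∀ i ∈ T, 1 ≤ |c i|) → Set.InjOn e T →
    1 ≤ a₀ → a₀ ≤ b₀ → 0 < τ → τ ≤ 1 → 0 ≤ κ →
    (∀ a b c, a₀ ≤ a → a ≤ b → b ≤ c → c ≤ b₀ → F a c ≤ F a b + F b c) →
    (∀ a b, a₀ ≤ a → a ≤ b → b ≤ b₀ → F a b ≤ b - a) →
    (∀ a b, a₀ ≤ a → a ≤ b → b ≤ b₀ →
      (∀ x ∈ Set.Ioo a b, τ ^ (2 ^ p) ≤ |∑ i ∈ T, c i * x ^ e i|) → F a b ≤ κ) →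
    F a₀ b₀ ≤ 2 ^ p * κ + 2 ^ (p + 1) * τ := by
  induction p with
  | zero =>
    intro T c e a₀ b₀ τ κ F hne hcard hc he ha hab hτ hτ1 hκ _ _ hF
    have h1 : T.card = 1 := le_antisymm (by simpa using hcard) hne.card_pos
    obtain ⟨i, rfl⟩ := Finset.card_eq_one.mp h1
    have := hF a₀ b₀ le_rfl hab le_rfl (by
      intro x hx
      simp only [pow_zero, pow_one, Finset.sum_singleton, abs_mul]
      have hx1 : 1 ≤ x := ha.trans hx.1.le
      have h2 : 1 ≤ |x ^ e i| := by
        rw [abs_of_nonneg (by positivity)]; exact one_le_pow₀ hx1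
      have h3 := hc i (by simp)
      nlinarith)
    norm_num
    linarith
  | succ p ih =>
    intro T c e a₀ b₀ τ κ F hne hcard hc he ha hab hτ hτ1 hκ hadd hlen hF
    obtain ⟨i0, hi0, hmin⟩ := Finset.exists_min_image T e hne
    set T' := T.erase i0 with hT'
    have hlt : ∀ i ∈ T', e i0 < e i := by
      intro i hi
      have hi' := Finset.mem_erase.mp hi
      refine lt_of_le_of_ne (hmin i hi'.2) ?_
      intro h; exact hi'.1 (he hi'.2 hi0 h.symm)
    set R : ℝ → ℝ := fun x => c i0 + ∑ i ∈ T', c i * x ^ (e i - e i0) with hR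
    set R' : ℝ → ℝ := fun x => ∑ i ∈ T', (c i * ((e i - e i0 : ℕ) : ℝ)) * x ^ (e i - e i0 - 1) with hR'
    have hderiv : ∀ x, HasDerivAt R (R' x) x := by
      intro x
      have : HasDerivAt (fun x => ∑ i ∈ T', c i * x ^ (e i - e i0)) (R' x) x := by
        apply HasDerivAt.fun_sum
        intro i hi
        have := (hasDerivAt_pow (e i - e i0) x).const_mul (c i)
        exact this.congr_deriv (by ring)
      exact this.const_add _
    have hRle : ∀ x, 1 ≤ x → |R x| ≤ |∑ i ∈ T, c i * x ^ e i| := by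
      intro x hx
      have : ∑ i ∈ T, c i * x ^ e i = x ^ e i0 * R x := by
        rw [← Finset.add_sum_erase _ _ hi0, hR]
        simp only [mul_add, Finset.mul_sum]
        congr 1
        · ring
        · apply Finset.sum_congr rfl
          intro i hi
          have := hlt i hi
          have h2 : x ^ e i = x ^ e i0 * x ^ (e i - e i0) := by
            rw [← pow_add]; congr 1; omega
          rw [h2]; ring
      rw [this, abs_mul]
      have h2 : 1 ≤ |x ^ e i0| := by
        rw [abs_of_nonneg (by positivity)]; exact one_le_pow₀ hx
      nlinarith [abs_nonneg (R x)]
    by_cases hT'e : T'.Nonempty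
    · have key := ih T' (fun i => c i * ((e i - e i0 : ℕ) : ℝ)) (fun i => e i - e i0 - 1) a₀ b₀ τ
        (2 * κ + 2 * τ) F hT'e (by rw [hT', Finset.card_erase_of_mem hi0]; omega) ?_ ?_ ha hab hτ hτ1
        (by positivity) hadd hlen ?_
      · calc F a₀ b₀ ≤ _ := key
          _ = 2 ^ (p+1) * κ + 2 ^ (p + 1 + 1) * τ := by ring
      · intro i hi
        have h1 := hc i (Finset.mem_of_mem_erase hi)
        have h2 := hlt i hi
        have h3 : (1:ℝ) ≤ ((e i - e i0 : ℕ) : ℝ) := by exact_mod_cast (by omega : 1 ≤ e i - e i0)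
        rw [abs_mul, abs_of_nonneg (by linarith : (0:ℝ) ≤ ((e i - e i0 : ℕ) : ℝ))]
        nlinarith
      · intro i hi j hj hij
        have h2 := hlt i hi
        have h3 := hlt j hj
        simp only at hij
        exact he (Finset.mem_of_mem_erase hi) (Finset.mem_of_mem_erase hj) (by omega)
      · intro a b haa hab' hbb hbig
        set ε := τ ^ (2 ^ (p+1)) with hε
        set ε' := τ ^ (2 ^ p) with hε'
        have hεε : ε = ε' * ε' := by rw [hε, hε', ← pow_add]; congr 1; ring
        have hε'0 : 0 < ε' := by positivity
        have hε'τ : ε' ≤ τ := by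
          rw [hε']; exact pow_le_of_le_one hτ.le hτ1 (by positivity)
        have hmv : ∀ x ∈ Set.Ioo a b, ∀ y ∈ Set.Ioo a b, x < y → ε' * (y - x) ≤ |R y - R x| := by
          intro x hx y hy hxy
          obtain ⟨z, hz, hz2⟩ := exists_hasDerivAt_eq_slope R R' hxy
            (fun t _ => (hderiv t).continuousAt.continuousWithinAt) (fun t _ => hderiv t)
          have := hbig z ⟨hx.1.trans hz.1, hz.2.trans hy.2⟩
          change ε' ≤ |R' z| at this
          rw [hz2, abs_div, abs_of_pos (sub_pos.mpr hxy), le_div_iff₀ (sub_pos.mpr hxy)] at this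
          exact this
        by_cases hJ : ∃ x ∈ Set.Ioo a b, |R x| < ε
        · set J := {x | x ∈ Set.Ioo a b ∧ |R x| < ε} with hJdef
          have hJne : J.Nonempty := hJ
          have hbb' : BddBelow J := ⟨a, fun x hx => hx.1.1.le⟩
          have hba' : BddAbove J := ⟨b, fun x hx => hx.1.2.le⟩
          obtain ⟨x0, hx0⟩ := hJne
          set u := sInf J
          set v := sSup J
          have hau : a ≤ u := le_csInf ⟨x0, hx0⟩ (fun x hx => hx.1.1.le)
          have hvb : v ≤ b := csSup_le ⟨x0, hx0⟩ (fun x hx => hx.1.2.le)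
          have hux : u ≤ x0 := csInf_le hbb' hx0
          have hxv : x0 ≤ v := le_csSup hba' hx0
          have huv : v - u ≤ 2 * ε' := by
            have h1 : ∀ x ∈ J, ∀ y ∈ J, y - x ≤ 2 * ε' := by
              intro x hx y hy
              rcases lt_or_ge x y with h | h
              · have h2 := hmv x hx.1 y hy.1 h
                have h3 : |R y - R x| ≤ |R y| + |R x| := abs_sub _ _
                have h4 : ε' * (y - x) ≤ ε' * (2 * ε') := by
                  have := hx.2; have := hy.2; nlinarith
                exact le_of_mul_le_mul_left h4 hε'0
              · linarith
            have h2 : v ≤ u + 2 * ε' := by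
              apply csSup_le ⟨x0, hx0⟩
              intro y hy
              have : y - 2 * ε' ≤ u := le_csInf ⟨x0, hx0⟩ (fun x hx => by linarith [h1 x hx y hy])
              linarith
            linarith
          have e1 := hadd a u b haa hau (hux.trans (hxv.trans hvb)) hbb
          have e2 := hadd u v b (haa.trans hau) (hux.trans hxv) hvb hbb
          have e3 : F a u ≤ κ := hF a u haa hau ((hux.trans (hxv.trans hvb)).trans hbb) (by
            intro x hx
            by_contra hcon
            push Not at hcon
            have hx1 : 1 ≤ x := ha.trans (haa.trans hx.1.le)
            have : x ∈ J := ⟨⟨hx.1, hx.2.trans_le (hux.trans (hxv.trans hvb))⟩,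
              (hRle x hx1).trans_lt hcon⟩
            exact absurd (csInf_le hbb' this) (not_le.mpr hx.2))
          have e4 : F v b ≤ κ := hF v b (haa.trans (hau.trans (hux.trans hxv))) hvb hbb (by
            intro x hx
            by_contra hcon
            push Not at hcon
            have hav : a ≤ v := hau.trans (hux.trans hxv)
            have hx1 : 1 ≤ x := ha.trans (haa.trans (hav.trans hx.1.le))
            have : x ∈ J := ⟨⟨hav.trans_lt hx.1, hx.2⟩, (hRle x hx1).trans_lt hcon⟩
            exact absurd (le_csSup hba' this) (not_le.mpr hx.1))
          have e5 := hlen u v (haa.trans hau) (hux.trans hxv) (hvb.trans hbb)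
          linarith
        · push Not at hJ
          have := hF a b haa hab' hbb (fun x hx => (hJ x hx).trans (hRle x (ha.trans (haa.trans hx.1.le))))
          linarith
    · rw [Finset.not_nonempty_iff_eq_empty] at hT'e
      have := hF a₀ b₀ le_rfl hab le_rfl (by
        intro x hx
        refine le_trans ?_ (hRle x (ha.trans hx.1.le))
        rw [hR, hT'e]
        simp only [Finset.sum_empty, add_zero]
        exact (pow_le_one₀ hτ.le hτ1).trans (hc i0 hi0))
      have h2 : (1:ℝ) ≤ 2 ^ (p+1) := one_le_pow₀ (by norm_num)
      have h3 : (0:ℝ) ≤ 2 ^ (p+1+1) * τ := by positivity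
      nlinarith

/-- first derivative test -/
theorem vdc_one (φ φ1 φ2 : ℝ → ℝ) (a b l : ℝ) (hab : a ≤ b) (hl : 0 < l)
    (h1 : ∀ x, HasDerivAt φ (φ1 x) x) (h2 : ∀ x, HasDerivAt φ1 (φ2 x) x) (hc : Continuous φ2)
    (hbig : ∀ x ∈ Set.Ioo a b, l ≤ |φ1 x|) (hne : ∀ x ∈ Set.Ioo a b, φ2 x ≠ 0) :
    ‖∫ x in a..b, Complex.exp (Complex.I * φ x)‖ ≤ 4 / l := by
  rcases hab.eq_or_lt with rfl | hab
  · simp; positivity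
  have hφ1c : Continuous φ1 := continuous_iff_continuousAt.mpr fun x => (h2 x).continuousAt
  have hφc : Continuous φ := continuous_iff_continuousAt.mpr fun x => (h1 x).continuousAt
  have hbig' : ∀ x ∈ Set.Icc a b, l ≤ |φ1 x| := by
    intro x hx
    have hx' : x ∈ closure (Set.Ioo a b) := by rwa [closure_Ioo hab.ne]
    exact closure_minimal (s := Set.Ioo a b) (t := {x | l ≤ |φ1 x|}) hbig
      (isClosed_le continuous_const hφ1c.abs) hx'
  have hne1 : ∀ x ∈ Set.Icc a b, φ1 x ≠ 0 := by
    intro x hx h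
    have := hbig' x hx
    rw [h] at this; simp at this; linarith
  have hne1c : ∀ x ∈ Set.Icc a b, (φ1 x : ℂ) ≠ 0 := fun x hx => by exact_mod_cast hne1 x hx
  have hu : Set.uIcc a b = Set.Icc a b := Set.uIcc_of_le hab.le
  set q : ℝ → ℝ := fun x => φ2 x / (φ1 x) ^ 2 with hq
  have hqc : ContinuousOn q (Set.Icc a b) := by
    apply ContinuousOn.div hc.continuousOn (hφ1c.pow 2).continuousOn
    intro x hx; exact pow_ne_zero _ (hne1 x hx)
  -- derivative of G = exp(iφ)/(i φ1)
  have hG : ∀ x ∈ Set.uIcc a b, HasDerivAt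
      (fun x => Complex.exp (Complex.I * φ x) * (Complex.I * (φ1 x : ℂ))⁻¹)
      (Complex.exp (Complex.I * φ x) + Complex.exp (Complex.I * φ x) * (Complex.I * (q x : ℂ))) x := by
    intro x hx
    rw [hu] at hx
    have hn := hne1c x hx
    have d1 : HasDerivAt (fun x => Complex.exp (Complex.I * φ x))
        (Complex.exp (Complex.I * φ x) * (Complex.I * φ1 x)) x :=
      ((h1 x).ofReal_comp.const_mul Complex.I).cexp
    have d2 : HasDerivAt (fun x => (Complex.I * (φ1 x : ℂ))⁻¹)
        (-(Complex.I * φ2 x) / (Complex.I * (φ1 x : ℂ)) ^ 2) x :=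
      ((h2 x).ofReal_comp.const_mul Complex.I).fun_inv (mul_ne_zero Complex.I_ne_zero hn)
    refine (d1.fun_mul d2).congr_deriv ?_
    simp only [hq]
    push_cast
    field_simp
    linear_combination (-(φ2 x : ℂ)) * Complex.I_sq
  have hcont1 : Continuous fun x => Complex.exp (Complex.I * φ x) := by fun_prop
  have hqcC : ContinuousOn (fun x => Complex.exp (Complex.I * φ x) * (Complex.I * (q x : ℂ)))
      (Set.uIcc a b) := by
    rw [hu]
    exact hcont1.continuousOn.mul (continuousOn_const.mul (Complex.continuous_ofReal.comp_continuousOn hqc))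
  have hint2 := hqcC.intervalIntegrable (μ := volume)
  have hint1 := hcont1.intervalIntegrable (μ := volume) a b
  have hFTC := intervalIntegral.integral_eq_sub_of_hasDerivAt hG (hint1.add hint2)
  rw [intervalIntegral.integral_add hint1 hint2] at hFTC
  have hexp : ∀ x : ℝ, ‖Complex.exp (Complex.I * φ x)‖ = 1 := fun x => by
    rw [mul_comm]; exact Complex.norm_exp_ofReal_mul_I _
  have hB : ∀ x ∈ Set.Icc a b, ‖Complex.exp (Complex.I * φ x) * (Complex.I * (φ1 x : ℂ))⁻¹‖ ≤ 1 / l := by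
    intro x hx
    rw [norm_mul, hexp, norm_inv, norm_mul, Complex.norm_I, Complex.norm_real, Real.norm_eq_abs]
    simp only [one_mul, one_div]
    exact inv_anti₀ hl (hbig' x hx)
  -- integral of |q|
  have hqd : ∀ x ∈ Set.uIcc a b, HasDerivAt (fun x => -(φ1 x)⁻¹) (q x) x := by
    intro x hx
    rw [hu] at hx
    refine ((h2 x).fun_inv (hne1 x hx)).fun_neg.congr_deriv ?_
    simp only [hq]; ring
  have hqi : IntervalIntegrable q volume a b := by
    apply ContinuousOn.intervalIntegrable; rwa [hu]
  have hqF := intervalIntegral.integral_eq_sub_of_hasDerivAt hqd hqi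
  have hinv : ∀ x ∈ Set.Icc a b, |(φ1 x)⁻¹| ≤ 1 / l := by
    intro x hx
    rw [abs_inv, one_div]; exact inv_anti₀ hl (hbig' x hx)
  have hqabs : ∫ x in a..b, |q x| ≤ 2 / l := by
    have ha' := abs_le.mp (hinv a ⟨le_rfl, hab.le⟩)
    have hb' := abs_le.mp (hinv b ⟨hab.le, le_rfl⟩)
    have hsum : 2 / l = 1 / l + 1 / l := by ring
    have hsign : (∀ x ∈ Set.Ioo a b, 0 < φ2 x) ∨ (∀ x ∈ Set.Ioo a b, φ2 x < 0) := by
      by_contra hcon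
      push Not at hcon
      obtain ⟨⟨x, hx, hx0⟩, ⟨y, hy, hy0⟩⟩ := hcon
      have := isPreconnected_Ioo.intermediate_value hx hy hc.continuousOn
      obtain ⟨z, hz, hz0⟩ := this ⟨hx0, hy0⟩
      exact hne z hz hz0
    rcases hsign with hs | hs
    · have : ∫ x in a..b, |q x| = ∫ x in a..b, q x := by
        apply intervalIntegral.integral_congr_ae
        rw [Set.uIoc_of_le hab.le]
        have : ∀ᵐ x : ℝ, x ≠ b := by simp [ae_iff]
        filter_upwards [this] with x hxb hx
        apply abs_of_nonneg
        exact div_nonneg (hs x ⟨hx.1, lt_of_le_of_ne hx.2 hxb⟩).le (by positivity)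
      rw [this, hqF]; linarith
    · have : ∫ x in a..b, |q x| = ∫ x in a..b, -q x := by
        apply intervalIntegral.integral_congr_ae
        rw [Set.uIoc_of_le hab.le]
        have : ∀ᵐ x : ℝ, x ≠ b := by simp [ae_iff]
        filter_upwards [this] with x hxb hx
        apply abs_of_nonpos
        exact div_nonpos_of_nonpos_of_nonneg (hs x ⟨hx.1, lt_of_le_of_ne hx.2 hxb⟩).le (by positivity)
      rw [this, intervalIntegral.integral_neg, hqF]; linarith
  have hI2 : ‖∫ x in a..b, Complex.exp (Complex.I * φ x) * (Complex.I * (q x : ℂ))‖ ≤ 2 / l := by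
    refine (intervalIntegral.norm_integral_le_integral_norm hab.le).trans ?_
    refine le_trans (le_of_eq ?_) hqabs
    apply intervalIntegral.integral_congr
    intro x _
    simp only [norm_mul, hexp, Complex.norm_I, Complex.norm_real, Real.norm_eq_abs, one_mul]
  have heq : ∫ x in a..b, Complex.exp (Complex.I * φ x) =
      (Complex.exp (Complex.I * φ b) * (Complex.I * (φ1 b : ℂ))⁻¹ -
       Complex.exp (Complex.I * φ a) * (Complex.I * (φ1 a : ℂ))⁻¹) -
      ∫ x in a..b, Complex.exp (Complex.I * φ x) * (Complex.I * (q x : ℂ)) := by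
    rw [← hFTC]; ring
  rw [heq]
  calc _ ≤ _ := norm_sub_le _ _
    _ ≤ (1 / l + 1 / l) + 2 / l := by
        gcongr
        exact (norm_sub_le _ _).trans (add_le_add (hB b ⟨hab.le, le_rfl⟩) (hB a ⟨le_rfl, hab.le⟩))
    _ = 4 / l := by ring

theorem osc_poly (ξ A B : ℝ) (hξ : 0 < ξ) (hA : 1 < A) (hAB : A ≤ B) (p M : ℕ) (T : Finset ℕ)
    (c : ℕ → ℝ) (τ : ℝ) (hT : T.Nonempty) (hcard : T.card ≤ p + 1) (hc : ∀ m ∈ T, 1 ≤ |c m|)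
    (hM : 2 ≤ M) (hTM : ∀ m ∈ T, M ≤ m) (hτ : 0 < τ) (hτ1 : τ ≤ 1) :
    ‖∫ x in A..B, Complex.exp (Complex.I * ((2 * Real.pi * ξ * ∑ m ∈ T, c m * x ^ m : ℝ) : ℂ))‖ ≤
      2 ^ p * (2 ^ p * (4 / (2 * Real.pi * ξ * (A ^ (M - 1) * τ ^ (2 ^ p)))) + 2 ^ (p + 1) * τ)
        + 2 ^ (p + 1) * τ := by
  set w := 2 * Real.pi * ξ with hw
  have hw0 : 0 < w := by positivity
  set φ : ℝ → ℝ := fun x => w * ∑ m ∈ T, c m * x ^ m with hφ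
  set φ1 : ℝ → ℝ := fun x => w * ∑ m ∈ T, c m * (m * x ^ (m - 1)) with hφ1
  set φ2 : ℝ → ℝ := fun x => w * ∑ m ∈ T, c m * (m * (((m - 1 : ℕ) : ℝ) * x ^ (m - 1 - 1))) with hφ2
  have d1 : ∀ x, HasDerivAt φ (φ1 x) x := by
    intro x
    apply HasDerivAt.const_mul
    apply HasDerivAt.fun_sum
    intro m _
    exact (hasDerivAt_pow m x).const_mul (c m)
  have d2 : ∀ x, HasDerivAt φ1 (φ2 x) x := by
    intro x
    apply HasDerivAt.const_mul
    apply HasDerivAt.fun_sum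
    intro m _
    exact ((hasDerivAt_pow (m-1) x).const_mul (m:ℝ)).const_mul (c m)
  have hφc : Continuous φ := continuous_iff_continuousAt.mpr fun x => (d1 x).continuousAt
  have hc2 : Continuous φ2 := by
    apply continuous_const.mul
    apply continuous_finsetSum
    intro m _; fun_prop
  set F : ℝ → ℝ → ℝ := fun a b => ‖∫ x in a..b, Complex.exp (Complex.I * (φ x : ℂ))‖ with hF
  have hcont : Continuous fun x => Complex.exp (Complex.I * (φ x : ℂ)) := by fun_prop
  have hadd : ∀ a b c, F a c ≤ F a b + F b c := by
    intro a b c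
    simp only [hF]
    rw [← intervalIntegral.integral_add_adjacent_intervals (hcont.intervalIntegrable a b)
      (hcont.intervalIntegrable b c)]
    exact norm_add_le _ _
  have hlen : ∀ a b, a ≤ b → F a b ≤ b - a := by
    intro a b hab
    have := intervalIntegral.norm_integral_le_of_norm_le_const (a := a) (b := b) (C := 1)
      (f := fun x => Complex.exp (Complex.I * (φ x : ℂ))) (fun x _ => by
        rw [mul_comm]; exact (Complex.norm_exp_ofReal_mul_I _).le)
    rw [abs_of_nonneg (by linarith)] at this
    simpa using this
  have hm1 : ∀ m ∈ T, (1:ℝ) ≤ m := fun m hm => by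
    exact_mod_cast (by have := hTM m hm; omega : 1 ≤ m)
  have hm2 : ∀ m ∈ T, (1:ℝ) ≤ ((m - 1 : ℕ) : ℝ) := fun m hm => by
    exact_mod_cast (by have := hTM m hm; omega : 1 ≤ m - 1)
  set lam := w * (A ^ (M - 1) * τ ^ (2 ^ p)) with hlam
  have hlam0 : 0 < lam := by positivity
  change F A B ≤ _
  refine osc_split p T (fun m => c m * m) (fun m => m - M) A B τ _ F hT hcard ?_ ?_ hA.le hAB hτ hτ1
    (by positivity) (fun a b c _ _ _ _ => hadd a b c) (fun a b _ h _ => hlen a b h) ?_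
  · intro m hm
    rw [abs_mul, abs_of_nonneg (by linarith [hm1 m hm] : (0:ℝ) ≤ m)]
    nlinarith [hc m hm, hm1 m hm]
  · intro m hm n hn h
    have := hTM m hm; have := hTM n hn
    simp only at h; omega
  · intro a b ha hab hb hbig
    refine osc_split p T (fun m => c m * (m * ((m - 1 : ℕ) : ℝ))) (fun m => m - 1 - 1) a b τ _ F hT hcard
      ?_ ?_ (hA.le.trans ha) hab hτ hτ1
      (by positivity) (fun a b c _ _ _ _ => hadd a b c) (fun a b _ h _ => hlen a b h) ?_
    · intro m hm
      have h1 := hc m hm; have h2 := hm1 m hm; have h3 := hm2 m hm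
      have h4 : (1:ℝ) ≤ m * ((m - 1 : ℕ) : ℝ) := by nlinarith
      rw [abs_mul, abs_of_nonneg (by linarith : (0:ℝ) ≤ m * ((m - 1 : ℕ) : ℝ))]
      nlinarith
    · intro m hm n hn h
      have := hTM m hm; have := hTM n hn
      simp only at h; omega
    · intro a' b' ha' hab' hb' hbig2
      refine vdc_one φ φ1 φ2 a' b' lam hab' hlam0 d1 d2 hc2 ?_ ?_
      · intro x hx
        have hxA : A ≤ x := ha.trans (ha'.trans hx.1.le)
        have hx0 : 0 < x := by linarith
        have h1 := hbig x ⟨ha'.trans_lt hx.1, hx.2.trans_le hb'⟩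
        have h2 : φ1 x = w * (x ^ (M - 1) * ∑ m ∈ T, c m * m * x ^ (m - M)) := by
          simp only [hφ1, Finset.mul_sum]
          apply Finset.sum_congr rfl
          intro m hm
          have h3 : x ^ (m - 1) = x ^ (M - 1) * x ^ (m - M) := by
            rw [← pow_add]; congr 1; have := hTM m hm; omega
          rw [h3]; ring
        rw [h2, abs_mul w, abs_mul (x ^ (M-1)), abs_of_pos hw0, abs_of_pos (by positivity : 0 < x ^ (M-1)), hlam]
        gcongr
      · intro x hx h0
        have h1 := hbig2 x hx
        have h2 : φ2 x = w * ∑ m ∈ T, c m * (m * ((m - 1 : ℕ) : ℝ)) * x ^ (m - 1 - 1) := by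
          simp only [hφ2, Finset.mul_sum]
          apply Finset.sum_congr rfl
          intro m _; ring
        rw [h2] at h0
        rcases mul_eq_zero.mp h0 with h | h
        · exact hw0.ne' h
        · rw [h, abs_zero] at h1
          exact absurd h1 (not_le.mpr (by positivity))

/-- clean version: with M large the oscillatory integral is tiny -/
theorem osc_final (ξ A B : ℝ) (hξ : 0 < ξ) (hA : 1 < A) (hAB : A ≤ B) (p M : ℕ) (T : Finset ℕ)
    (c : ℕ → ℝ) (hT : T.Nonempty) (hcard : T.card ≤ p + 1) (hc : ∀ m ∈ T, 1 ≤ |c m|)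
    (hM : 2 ≤ M) (hTM : ∀ m ∈ T, M ≤ m) :
    ‖∫ x in A..B, Complex.exp (Complex.I * ((2 * Real.pi * ξ * ∑ m ∈ T, c m * x ^ m : ℝ) : ℂ))‖ ≤
      (4 + A / ξ) * 4 ^ p * A ^ (-((M:ℝ) / 2 ^ (p + 1))) := by
  have hA0 : 0 < A := by linarith
  set τ := A ^ (-((M:ℝ) / 2 ^ (p + 1))) with hτ
  have hτ0 : 0 < τ := Real.rpow_pos_of_pos hA0 _
  have hτ1 : τ ≤ 1 := Real.rpow_le_one_of_one_le_of_nonpos hA.le (by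
    rw [neg_nonpos]; positivity)
  refine (osc_poly ξ A B hξ hA hAB p M T c τ hT hcard hc hM hTM hτ0 hτ1).trans ?_
  have hpw : τ ^ (2 ^ p) = A ^ (-((M:ℝ) / 2)) := by
    rw [hτ, ← Real.rpow_natCast, ← Real.rpow_mul hA0.le]
    congr 1; push_cast; field_simp; ring
  have hAM : A ^ (M - 1) = A ^ (M:ℝ) / A := by
    rw [Real.rpow_natCast, eq_div_iff hA0.ne', ← pow_succ]; congr 1; omega
  have h1 : 4 / (2 * Real.pi * ξ * (A ^ (M - 1) * τ ^ (2 ^ p))) ≤ A / ξ * τ := by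
    have h2 : A ^ (M - 1) * τ ^ (2 ^ p) = A ^ ((M:ℝ) / 2) / A := by
      rw [hpw, hAM, div_mul_eq_mul_div, ← Real.rpow_add hA0]; congr 2; ring
    have h3 : A ^ (-((M:ℝ) / 2)) ≤ τ := by
      rw [hτ]
      apply Real.rpow_le_rpow_of_exponent_le hA.le
      rw [neg_le_neg_iff]
      apply div_le_div_of_nonneg_left (by positivity) (by norm_num)
      exact le_self_pow₀ (by norm_num) (by omega)
    rw [h2]
    calc 4 / (2 * Real.pi * ξ * (A ^ ((M:ℝ) / 2) / A)) = (4 / (2 * Real.pi)) * (A / ξ * A ^ (-((M:ℝ) / 2))) := by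
          rw [Real.rpow_neg hA0.le]; field_simp
      _ ≤ 1 * (A / ξ * τ) := by
          have : 4 / (2 * Real.pi) ≤ 1 := by
            rw [div_le_one (by positivity)]; linarith [Real.pi_gt_three]
          gcongr
      _ = _ := one_mul _
  have h4 : (2:ℝ) ^ p * 2 ^ p = 4 ^ p := by rw [← mul_pow]; norm_num
  have h5 : (2:ℝ) ^ p ≤ 4 ^ p := pow_le_pow_left₀ (by norm_num) (by norm_num) p
  calc _ ≤ 2 ^ p * (2 ^ p * (A / ξ * τ) + 2 ^ (p + 1) * τ) + 2 ^ (p + 1) * τ := by gcongr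
    _ = 4 ^ p * (A / ξ + 2) * τ + 2 * 2 ^ p * τ := by rw [pow_succ, ← h4]; ring
    _ ≤ 4 ^ p * (A / ξ + 2) * τ + 2 * 4 ^ p * τ := by gcongr
    _ = _ := by ring

open MeasureTheory Filter

theorem per_fract (f : ℝ → ℝ) (hper : ∀ x : ℝ, f (x + 1) = f x) (x : ℝ) : f x = f (Int.fract x) := by
  have hp : Function.Periodic f 1 := hper
  have := hp.sub_int_mul_eq (x := x) ⌊x⌋
  rw [mul_one] at this
  rw [← Int.self_sub_floor, this]

theorem f_meas (f : ℝ → ℝ) (hper : ∀ x : ℝ, f (x + 1) = f x)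
    (hvar : eVariationOn f (Set.Icc (0:ℝ) 1) ≤ 2) : Measurable f := by
  have hb : BoundedVariationOn f (Set.Icc (0:ℝ) 1) := ne_top_of_le_ne_top (by simp) hvar
  obtain ⟨p, q, hp, hq, hpq⟩ := hb.locallyBoundedVariationOn.exists_monotoneOn_sub_monotoneOn
  have hp' : Monotone (fun x : ℝ => p (Set.projIcc (0:ℝ) 1 zero_le_one x)) := by
    intro a b hab
    exact hp (Subtype.mem _) (Subtype.mem _) (Set.monotone_projIcc zero_le_one hab)
  have hq' : Monotone (fun x : ℝ => q (Set.projIcc (0:ℝ) 1 zero_le_one x)) := by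
    intro a b hab
    exact hq (Subtype.mem _) (Subtype.mem _) (Set.monotone_projIcc zero_le_one hab)
  have := (hp'.measurable.sub hq'.measurable).comp measurable_fract
  convert this using 1
  funext x
  rw [per_fract f hper x, hpq]
  have : Int.fract x ∈ Set.Icc (0:ℝ) 1 := ⟨Int.fract_nonneg x, (Int.fract_lt_one x).le⟩
  simp [Set.projIcc_of_mem zero_le_one this]

theorem f_bound (f : ℝ → ℝ) (hper : ∀ x : ℝ, f (x + 1) = f x)
    (hint : (∫ x in (0:ℝ)..1, f x) = 0)
    (hvar : eVariationOn f (Set.Icc (0:ℝ) 1) ≤ 2) (x : ℝ) : |f x| ≤ 2 := by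
  have hb : BoundedVariationOn f (Set.Icc (0:ℝ) 1) := ne_top_of_le_ne_top (by simp) hvar
  rw [per_fract f hper x]
  set y := Int.fract x
  have hy : y ∈ Set.Icc (0:ℝ) 1 := ⟨Int.fract_nonneg x, (Int.fract_lt_one x).le⟩
  have hd : ∀ z ∈ Set.Icc (0:ℝ) 1, |f y - f z| ≤ 2 := by
    intro z hz
    have := hb.dist_le hy hz
    rw [Real.dist_eq] at this
    refine this.trans ?_
    have := ENNReal.toReal_mono (by simp) hvar
    simpa using this
  have hii : IntervalIntegrable f volume 0 1 := by
    refine ⟨?_, by simp⟩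
    refine Measure.integrableOn_of_bounded (M := |f y| + 2) (by simp) (f_meas f hper hvar).aestronglyMeasurable ?_
    refine (ae_restrict_iff' measurableSet_Ioc).2 (ae_of_all _ fun z hz => ?_)
    have := hd z ⟨hz.1.le, hz.2⟩
    rw [Real.norm_eq_abs]
    have h2 := abs_sub_abs_le_abs_sub (f z) (f y)
    rw [abs_sub_comm] at this
    linarith
  have h1 : ‖∫ z in (0:ℝ)..1, (f y - f z)‖ ≤ 2 * |1 - 0| := by
    apply intervalIntegral.norm_integral_le_of_norm_le_const
    intro z hz
    rw [Set.uIoc_of_le zero_le_one] at hz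
    exact hd z ⟨hz.1.le, hz.2⟩
  rw [intervalIntegral.integral_sub (by simp) hii, hint] at h1
  simpa using h1

theorem f_ii (f : ℝ → ℝ) (hm : Measurable f) (hb : ∀ x, |f x| ≤ 2) (a b : ℝ) :
    IntervalIntegrable f volume a b := by
  rw [intervalIntegrable_iff]
  exact Measure.integrableOn_of_bounded (M := 2) (by simp) hm.aestronglyMeasurable (ae_of_all _ hb)

theorem e_int (k : ℤ) (hk : k ≠ 0) (a : ℝ) : ∫ x in a..(a + 1/|(k:ℝ)|), Complex.exp (2 * Real.pi * Complex.I * k * x) = 0 := by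
  have hk' : (k : ℂ) ≠ 0 := by exact_mod_cast hk
  have hc : (2 * Real.pi * Complex.I * k : ℂ) ≠ 0 := by simp [Real.pi_ne_zero, hk]
  rw [integral_exp_mul_complex hc]
  rw [div_eq_zero_iff]; left
  rw [sub_eq_zero]
  have hk2 : (k:ℝ) ≠ 0 := by exact_mod_cast hk
  rcases abs_choice (k:ℝ) with h | h <;> rw [h]
  · have : (2 * Real.pi * Complex.I * k * ((a + 1/(k:ℝ) : ℝ) : ℂ)) = 2 * Real.pi * Complex.I * k * a + 2 * Real.pi * Complex.I := by
      push_cast; field_simp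
    rw [this, Complex.exp_add, Complex.exp_two_pi_mul_I, mul_one]
  · have : (2 * Real.pi * Complex.I * k * ((a + 1/(-(k:ℝ)) : ℝ) : ℂ)) = 2 * Real.pi * Complex.I * k * a - 2 * Real.pi * Complex.I := by
      push_cast; field_simp
      ring
    rw [this, Complex.exp_sub, Complex.exp_two_pi_mul_I, div_one]

theorem e_norm (k : ℤ) (x : ℝ) : ‖Complex.exp (2 * Real.pi * Complex.I * k * x)‖ = 1 := by
  have : (2 * Real.pi * Complex.I * k * x : ℂ) = ((2 * Real.pi * k * x : ℝ) : ℂ) * Complex.I := by push_cast; ring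
  rw [this, Complex.norm_exp_ofReal_mul_I]

theorem coeff_bound (f : ℝ → ℝ) (hm : Measurable f) (hb : ∀ x, |f x| ≤ 2)
    (hvar : eVariationOn f (Set.Icc (0:ℝ) 1) ≤ 2) (k : ℤ) (hk : k ≠ 0) :
    ‖∫ x in (0:ℝ)..1, Complex.exp (2 * Real.pi * Complex.I * (-k : ℤ) * x) * f x‖ ≤ 2 / |(k:ℝ)| := by
  have hbv : BoundedVariationOn f (Set.Icc (0:ℝ) 1) := ne_top_of_le_ne_top (by simp) hvar
  set n := k.natAbs with hn
  have hnk : |(k:ℝ)| = n := by rw [hn]; simp [Nat.cast_natAbs]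
  have hn0 : (0:ℝ) < n := by rw [← hnk]; positivity
  set I : ℕ → ℝ := fun j => j / n with hI
  have hImono : Monotone I := fun a b hab => by
    simp only [hI]; gcongr
  have hiif : ∀ a b, IntervalIntegrable (fun x => Complex.exp (2 * Real.pi * Complex.I * (-k : ℤ) * x) * f x) volume a b := by
    intro a b
    rw [intervalIntegrable_iff]
    refine Measure.integrableOn_of_bounded (M := 2) (by simp) ?_ (ae_of_all _ ?_)
    · exact ((by fun_prop : Measurable fun x:ℝ => Complex.exp (2 * Real.pi * Complex.I * (-k : ℤ) * x)).mul
        (Complex.measurable_ofReal.comp hm)).aestronglyMeasurable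
    · intro x
      rw [norm_mul, e_norm, one_mul, Complex.norm_real]; exact hb x
  have hsplit : ∫ x in (0:ℝ)..1, Complex.exp (2 * Real.pi * Complex.I * (-k : ℤ) * x) * f x =
      ∑ j ∈ Finset.range n, ∫ x in (I j)..(I (j+1)), Complex.exp (2 * Real.pi * Complex.I * (-k : ℤ) * x) * f x := by
    rw [intervalIntegral.sum_integral_adjacent_intervals (fun j _ => hiif _ _)]
    simp [hI, div_self hn0.ne']
  have hIs : ∀ j : ℕ, I (j+1) = I j + 1/n := fun j => by simp only [hI]; push_cast; ring
  have hpiece : ∀ j ∈ Finset.range n, ‖∫ x in (I j)..(I (j+1)), Complex.exp (2 * Real.pi * Complex.I * (-k : ℤ) * x) * f x‖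
      ≤ (eVariationOn f (Set.Icc (I j) (I (j+1)))).toReal * (1/n) := by
    intro j hj
    have hj' : j + 1 ≤ n := Finset.mem_range.1 hj
    have hle : I j ≤ I (j+1) := hImono (Nat.le_succ j)
    have hsub : Set.Icc (I j) (I (j+1)) ⊆ Set.Icc (0:ℝ) 1 := by
      apply Set.Icc_subset_Icc
      · simp only [hI]; positivity
      · simp only [hI]; rw [div_le_one hn0]; exact_mod_cast hj'
    have h0 : ∫ x in (I j)..(I (j+1)), Complex.exp (2 * Real.pi * Complex.I * (-k : ℤ) * x) * (f (I j):ℂ) = 0 := by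
      rw [intervalIntegral.integral_mul_const]
      have := e_int (-k) (neg_ne_zero.2 hk) (I j)
      rw [hIs, ← hnk]
      push_cast at this ⊢
      rw [abs_neg] at this
      rw [this, zero_mul]
    have h1 : ∫ x in (I j)..(I (j+1)), Complex.exp (2 * Real.pi * Complex.I * (-k : ℤ) * x) * f x =
       ∫ x in (I j)..(I (j+1)), Complex.exp (2 * Real.pi * Complex.I * (-k : ℤ) * x) * ((f x - f (I j) : ℝ) : ℂ) := by
      rw [← sub_zero (∫ x in (I j)..(I (j+1)), Complex.exp (2 * Real.pi * Complex.I * (-k : ℤ) * x) * f x), ← h0,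
        ← intervalIntegral.integral_sub (hiif _ _)]
      · congr 1; funext x; push_cast; ring
      · exact (by fun_prop : Continuous fun x : ℝ => Complex.exp (2 * Real.pi * Complex.I * (-k : ℤ) * x) * (f (I j):ℂ)).intervalIntegrable _ _
    rw [h1]
    have h2 := intervalIntegral.norm_integral_le_of_norm_le_const (a := I j) (b := I (j+1))
      (f := fun x => Complex.exp (2 * Real.pi * Complex.I * (-k : ℤ) * x) * ((f x - f (I j) : ℝ) : ℂ))
      (C := (eVariationOn f (Set.Icc (I j) (I (j+1)))).toReal) (by
        intro x hx
        rw [Set.uIoc_of_le hle] at hx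
        rw [norm_mul, e_norm, one_mul, Complex.norm_real]
        exact (hbv.mono hsub).dist_le ⟨hx.1.le, hx.2⟩ ⟨le_rfl, hle⟩)
    rw [hIs] at h2 ⊢
    rwa [add_sub_cancel_left, abs_of_pos (by positivity : (0:ℝ) < 1/n)] at h2
  rw [hsplit, hnk]
  refine (norm_sum_le _ _).trans ((Finset.sum_le_sum hpiece).trans ?_)
  rw [← Finset.sum_mul]
  have hs := eVariationOn.sum' f hImono (n := n)
  have h01 : Set.Icc (I 0) (I n) = Set.Icc (0:ℝ) 1 := by simp [hI, div_self hn0.ne']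
  rw [h01] at hs
  have : ∑ j ∈ Finset.range n, (eVariationOn f (Set.Icc (I j) (I (j+1)))).toReal ≤ 2 := by
    rw [← ENNReal.toReal_sum, hs]
    · simpa using ENNReal.toReal_mono (by simp) hvar
    · intro j hj
      have hj' : j + 1 ≤ n := Finset.mem_range.1 hj
      refine hbv.mono ?_
      apply Set.Icc_subset_Icc
      · simp only [hI]; positivity
      · simp only [hI]; rw [div_le_one hn0]; exact_mod_cast hj'
  rw [mul_one_div]
  gcongr

open MeasureTheory Filter

noncomputable def ee (k : ℤ) (x : ℝ) : ℂ := Complex.exp (2 * Real.pi * Complex.I * k * x)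

theorem ee_norm (k : ℤ) (x : ℝ) : ‖ee k x‖ = 1 := e_norm k x

theorem ee_cont (k : ℤ) : Continuous (ee k) := by unfold ee; fun_prop

theorem ee_add (k l : ℤ) (x : ℝ) : ee k x * ee l x = ee (k + l) x := by
  unfold ee; rw [← Complex.exp_add]; congr 1; push_cast; ring

theorem ee_int (k : ℤ) : ∫ x in (0:ℝ)..1, ee k x = if k = 0 then 1 else 0 := by
  split_ifs with h
  · subst h; simp [ee]
  · have hc : (2 * Real.pi * Complex.I * k : ℂ) ≠ 0 := by simp [Real.pi_ne_zero, h]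
    unfold ee
    rw [integral_exp_mul_complex hc]
    have : Complex.exp (2 * Real.pi * Complex.I * k * (1:ℝ)) = 1 := by
      rw [Complex.exp_eq_one_iff]; exact ⟨k, by push_cast; ring⟩
    rw [this]; simp

theorem ee_per (k : ℤ) (x : ℝ) : ee k (x + 1) = ee k x := by
  unfold ee
  rw [Complex.exp_eq_exp_iff_exists_int]
  exact ⟨k, by push_cast; ring⟩

theorem fcoeff_eq (F : ℝ → ℂ) (k : ℤ) :
    fourierCoeffOn (zero_lt_one (α := ℝ)) F k = ∫ x in (0:ℝ)..1, ee (-k) x * F x := by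
  rw [fourierCoeffOn_eq_integral]
  simp only [sub_zero, div_one, one_smul, smul_eq_mul]
  congr 1; funext x
  rw [fourier_coe_apply]
  unfold ee
  congr 2
  push_cast; ring

theorem trig_approx (f : ℝ → ℝ) (hm : Measurable f) (hb : ∀ x, |f x| ≤ 2)
    (hint : (∫ x in (0:ℝ)..1, f x) = 0)
    (hvar : eVariationOn f (Set.Icc (0:ℝ) 1) ≤ 2) (t : ℕ) :
    ∃ c : ℤ → ℂ, (∑ k ∈ Finset.Icc (-(4:ℤ)^t) (4^t), ‖c k‖ ≤ 4 * (1 + 2 * t)) ∧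
      ∫ x in (0:ℝ)..1, ‖(f x : ℂ) - ∑ k ∈ Finset.Icc (-(4:ℤ)^t) (4^t), c k * ee k x‖ ≤ 4 / 2 ^ t := by
  set c : ℤ → ℂ := fun k => ∫ x in (0:ℝ)..1, ee (-k) x * f x with hc
  have hc0 : c 0 = 0 := by
    simp only [hc, ee]
    have : ∀ x : ℝ, Complex.exp (2 * Real.pi * Complex.I * ((-0 : ℤ):ℂ) * x) * (f x:ℂ) = (f x : ℂ) := by
      intro x; simp
    simp_rw [this]
    rw [intervalIntegral.integral_ofReal, hint]; simp
  have hck : ∀ k : ℤ, k ≠ 0 → ‖c k‖ ≤ 2 / |(k:ℝ)| := fun k hk => coeff_bound f hm hb hvar k hk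
  set K : ℕ := 4 ^ t with hK
  have hK1 : 1 ≤ K := Nat.one_le_pow _ _ (by norm_num)
  have hKc : (4:ℤ)^t = (K:ℤ) := by rw [hK]; push_cast; rfl
  rw [hKc]
  refine ⟨c, ?_, ?_⟩
  · have h1 : ∀ M : ℕ, ∑ k ∈ Finset.Icc (-(M:ℤ)) M, ‖c k‖ ≤ 4 * (harmonic M : ℝ) := by
      intro M
      induction M with
      | zero => simp [hc0]
      | succ M ih =>
        have : Finset.Icc (-((M+1:ℕ):ℤ)) ((M+1:ℕ):ℤ) = insert (-((M+1:ℕ):ℤ)) (insert (((M+1:ℕ):ℤ)) (Finset.Icc (-(M:ℤ)) M)) := by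
          ext z; simp only [Finset.mem_insert, Finset.mem_Icc]; push_cast; omega
        rw [this, Finset.sum_insert, Finset.sum_insert, harmonic_succ]
        · have h2 := hck (-((M+1:ℕ):ℤ)) (by push_cast; omega)
          have h3 := hck (((M+1:ℕ):ℤ)) (by push_cast; omega)
          push_cast at h2 h3 ⊢
          rw [abs_neg] at h2
          rw [abs_of_pos (by positivity)] at h2 h3
          rw [mul_add]
          have : 2 / ((M:ℝ)+1) = 2 * ((M:ℝ)+1)⁻¹ := by rw [div_eq_mul_inv]
          rw [this] at h2 h3
          linarith
        · simp
        · simp only [Finset.mem_insert, Finset.mem_Icc]; push_cast; omega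
    refine (h1 K).trans ?_
    have h2 := harmonic_le_one_add_log K
    have h3 : Real.log K ≤ 2 * t := by
      rw [hK]; push_cast
      rw [Real.log_pow, show (4:ℝ) = 2^2 by norm_num, Real.log_pow]
      have := Real.log_two_lt_d9
      have ht : (0:ℝ) ≤ t := by positivity
      push_cast
      nlinarith
    linarith
  · set g : ℝ → ℂ := fun x => ∑ k ∈ Finset.Icc (-(K:ℤ)) K, c k * ee k x with hg
    have hgc : Continuous g := by
      apply continuous_finsetSum; intro k _; exact continuous_const.mul (ee_cont k)
    set u : ℝ → ℂ := fun x => (f x : ℂ) - g x with hu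
    have hum : Measurable u := (Complex.measurable_ofReal.comp hm).sub hgc.measurable
    have hub : ∀ x, ‖u x‖ ≤ 2 + ∑ k ∈ Finset.Icc (-(K:ℤ)) K, ‖c k‖ := by
      intro x
      refine (norm_sub_le _ _).trans (add_le_add ?_ ?_)
      · rw [Complex.norm_real]; exact hb x
      · refine (norm_sum_le _ _).trans (Finset.sum_le_sum fun k _ => ?_)
        rw [norm_mul, ee_norm, mul_one]
    have hmem : MemLp u 2 (volume.restrict (Set.Ioc 0 1)) :=
      MemLp.of_bound hum.aestronglyMeasurable _ (ae_of_all _ hub)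
    have hs := hasSum_sq_fourierCoeffOn (zero_lt_one (α := ℝ)) hmem
    have hcoef : ∀ n : ℤ, fourierCoeffOn (zero_lt_one (α := ℝ)) u n = if n ∈ Finset.Icc (-(K:ℤ)) K then 0 else c n := by
      intro n
      rw [fcoeff_eq]
      have h1 : ∀ x, ee (-n) x * u x = ee (-n) x * f x - ∑ k ∈ Finset.Icc (-(K:ℤ)) K, c k * ee (k - n) x := by
        intro x
        simp only [hu, hg, mul_sub, Finset.mul_sum]
        congr 1
        refine Finset.sum_congr rfl fun k _ => ?_
        rw [← mul_assoc, mul_comm (ee (-n) x), mul_assoc, ee_add]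
        congr 2; ring
      simp_rw [h1]
      rw [intervalIntegral.integral_sub, intervalIntegral.integral_finsetSum]
      · simp_rw [intervalIntegral.integral_const_mul, ee_int, sub_eq_zero]
        simp only [mul_ite, mul_one, mul_zero]
        rw [Finset.sum_ite_eq' (Finset.Icc (-(K:ℤ)) K) n c]
        split_ifs <;> simp [hc]
      · intro k _
        exact (continuous_const.mul (ee_cont _)).intervalIntegrable _ _
      · rw [intervalIntegrable_iff]
        refine Measure.integrableOn_of_bounded (M := 2) (by simp) ?_ (ae_of_all _ ?_)
        · exact ((ee_cont _).measurable.mul (Complex.measurable_ofReal.comp hm)).aestronglyMeasurable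
        · intro x
          rw [norm_mul, ee_norm, one_mul, Complex.norm_real]; exact hb x
      · exact (continuous_finsetSum _ fun k _ => continuous_const.mul (ee_cont _)).intervalIntegrable _ _
    have hs2 := hs.nat_add_neg
    simp only [hcoef] at hs2
    have hL2 : ∫ x in (0:ℝ)..1, ‖u x‖ ^ 2 ≤ 16 / K := by
      have hbd : ∀ S : Finset ℕ, ∑ n ∈ S, (‖if (n:ℤ) ∈ Finset.Icc (-(K:ℤ)) K then 0 else c n‖ ^ 2 +
          ‖if -(n:ℤ) ∈ Finset.Icc (-(K:ℤ)) K then 0 else c (-n)‖ ^ 2) ≤ 16 / K := by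
        intro S
        obtain ⟨M, hM⟩ := S.exists_nat_subset_range
        refine (Finset.sum_le_sum_of_subset_of_nonneg hM (fun _ _ _ => by positivity)).trans ?_
        have hK0 : (0:ℝ) < K := by positivity
        have h2 : ∀ n ∈ Finset.range M, (‖if (n:ℤ) ∈ Finset.Icc (-(K:ℤ)) K then 0 else c n‖ ^ 2 +
          ‖if -(n:ℤ) ∈ Finset.Icc (-(K:ℤ)) K then 0 else c (-n)‖ ^ 2) ≤ if n ∈ Finset.Ioo K M then 8 * ((n:ℝ)^2)⁻¹ else 0 := by
          intro n hn
          have hnM := Finset.mem_range.1 hn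
          by_cases hnK : n ≤ K
          · rw [if_pos, if_pos, if_neg]
            · simp
            · simp; omega
            · simp; omega
            · simp; omega
          · rw [if_neg, if_neg, if_pos]
            · have hn0 : (0:ℝ) < n := by have : 0 < n := by omega
                                         exact_mod_cast this
              have e1 := hck n (by omega)
              have e2 := hck (-n) (by omega)
              push_cast at e1 e2
              rw [abs_neg] at e2
              rw [abs_of_pos hn0] at e1 e2
              have e3 := pow_le_pow_left₀ (norm_nonneg _) e1 2
              have e4 := pow_le_pow_left₀ (norm_nonneg _) e2 2
              have : (2 / (n:ℝ))^2 = 4 * ((n:ℝ)^2)⁻¹ := by field_simp; norm_num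
              rw [this] at e3 e4
              linarith
            · simp; omega
            · simp; omega
            · simp; omega
        refine (Finset.sum_le_sum h2).trans ?_
        rw [← Finset.sum_filter, ← Finset.mul_sum]
        have h3 : (Finset.range M).filter (fun n => n ∈ Finset.Ioo K M) = Finset.Ioo K M := by
          ext z; simp only [Finset.mem_filter, Finset.mem_range, Finset.mem_Ioo]; omega
        rw [h3]
        have h4 := sum_Ioo_inv_sq_le (α := ℝ) K M
        have h5 : (2:ℝ) / (K + 1) ≤ 2 / K := by gcongr; linarith
        have : (16:ℝ) / K = 8 * (2 / K) := by ring
        rw [this]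
        linarith
      have := hasSum_le_of_sum_le hs2 hbd
      simpa using this
    set ε : ℝ := 4 / 2 ^ t with hε
    have hε0 : 0 < ε := by positivity
    have hεK : 16 / (K:ℝ) = ε ^ 2 := by
      rw [hε, hK]; push_cast; rw [div_pow, ← pow_mul, mul_comm t 2, pow_mul]; norm_num
    have hpt : ∀ x, ‖u x‖ ≤ ε / 2 + (1 / (2 * ε)) * ‖u x‖ ^ 2 := by
      intro x
      have : ε / 2 + (1 / (2 * ε)) * ‖u x‖ ^ 2 - ‖u x‖ = (ε - ‖u x‖) ^ 2 / (2 * ε) := by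
        field_simp; ring
      have h2 : 0 ≤ (ε - ‖u x‖) ^ 2 / (2 * ε) := by positivity
      linarith
    have hi1 : IntervalIntegrable (fun x => ‖u x‖) volume 0 1 := by
      rw [intervalIntegrable_iff]
      exact Measure.integrableOn_of_bounded (M := 2 + ∑ k ∈ Finset.Icc (-(K:ℤ)) K, ‖c k‖) (by simp) hum.norm.aestronglyMeasurable (ae_of_all _ fun x => by rw [norm_norm]; exact hub x)
    have hi2 : IntervalIntegrable (fun x => ‖u x‖ ^ 2) volume 0 1 := by
      rw [intervalIntegrable_iff]
      refine Measure.integrableOn_of_bounded (M := (2 + ∑ k ∈ Finset.Icc (-(K:ℤ)) K, ‖c k‖) ^ 2) (by simp) (hum.norm.pow_const 2).aestronglyMeasurable (ae_of_all _ fun x => ?_)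
      rw [norm_pow, norm_norm]; exact pow_le_pow_left₀ (norm_nonneg _) (hub x) 2
    calc ∫ x in (0:ℝ)..1, ‖u x‖ ≤ ∫ x in (0:ℝ)..1, (ε / 2 + (1 / (2 * ε)) * ‖u x‖ ^ 2) :=
          intervalIntegral.integral_mono_on zero_le_one hi1 ((by simp : IntervalIntegrable (fun _ : ℝ => ε / 2) volume 0 1).add (hi2.const_mul _)) fun x _ => hpt x
      _ = ε / 2 + (1 / (2 * ε)) * ∫ x in (0:ℝ)..1, ‖u x‖ ^ 2 := by
          rw [intervalIntegral.integral_add (by simp) (hi2.const_mul _), intervalIntegral.integral_const_mul]; simp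
      _ ≤ ε / 2 + (1 / (2 * ε)) * ε ^ 2 := by rw [← hεK]; gcongr
      _ = ε := by field_simp; ring

open MeasureTheory Filter

theorem comp_int_bound (h : ℝ → ℝ) (hm : Measurable h) (h0 : ∀ x, 0 ≤ h x) (C : ℝ) (hC : ∀ x, h x ≤ C)
    (hper : ∀ x, h (x + 1) = h x) (ξ : ℝ) (hξ : 0 < ξ) (j : ℕ) (d c : ℝ) (hd : 0 < d) (hdc : d ≤ c)
    (hφ : ξ * c ^ (j+1) ≤ ξ * d ^ (j+1) + 1) :
    (ξ * (j+1) * d ^ j) * ∫ x in d..c, h (ξ * x ^ (j+1)) ≤ ∫ x in (0:ℝ)..1, h x := by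
  have hii : ∀ a b, IntervalIntegrable h volume a b := by
    intro a b
    rw [intervalIntegrable_iff]
    exact Measure.integrableOn_of_bounded (M := C) (by simp) hm.aestronglyMeasurable
      (ae_of_all _ fun x => by rw [Real.norm_eq_abs, abs_of_nonneg (h0 x)]; exact hC x)
  set φ : ℝ → ℝ := fun x => ξ * x ^ (j+1) with hφd
  have hmono : StrictMonoOn φ (Set.Icc d c) := by
    intro a ha b hb hab
    simp only [hφd]
    have : 0 ≤ a := hd.le.trans ha.1
    gcongr
  have hcont : ContinuousOn φ (Set.Icc d c) := by
    simp only [hφd]; fun_prop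
  have himg : φ '' Set.Icc d c = Set.Icc (φ d) (φ c) := hcont.image_Icc_of_monotoneOn hdc hmono.monotoneOn
  have hder : ∀ x ∈ Set.Icc d c, HasDerivWithinAt φ (ξ * (j+1) * x ^ j) (Set.Icc d c) x := by
    intro x _
    have := ((hasDerivAt_pow (j+1) x).const_mul ξ).hasDerivWithinAt (s := Set.Icc d c)
    refine this.congr_deriv ?_
    push_cast; ring
  have hsub := integral_image_eq_integral_abs_deriv_smul measurableSet_Icc hder hmono.injOn h
  rw [himg] at hsub
  have hφdc : φ d ≤ φ c := hmono.monotoneOn ⟨le_rfl, hdc⟩ ⟨hdc, le_rfl⟩ hdc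
  have h1 : ∫ x in (φ d)..(φ c), h x ≤ ∫ x in (0:ℝ)..1, h x := by
    have hp : Function.Periodic h 1 := hper
    have := hp.intervalIntegral_add_eq (φ d) 0
    rw [zero_add] at this
    rw [← this]
    apply intervalIntegral.integral_mono_interval le_rfl hφdc
    · exact hφ
    · exact ae_of_all _ h0
    · exact hii _ _
  rw [intervalIntegral.integral_of_le hφdc, ← integral_Icc_eq_integral_Ioc, hsub] at h1
  refine le_trans ?_ h1
  rw [intervalIntegral.integral_of_le hdc, ← integral_Icc_eq_integral_Ioc, ← integral_const_mul]
  have hmc : Measurable fun x => h (φ x) := hm.comp (by simp only [hφd]; fun_prop)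
  have hb : ∀ x, ‖h (φ x)‖ ≤ C := fun x => by rw [Real.norm_eq_abs, abs_of_nonneg (h0 _)]; exact hC _
  apply setIntegral_mono_on
  · exact Measure.integrableOn_of_bounded (M := |ξ * (j+1) * d ^ j| * C) (by simp) (hmc.const_mul _).aestronglyMeasurable
      (ae_of_all _ fun x => by rw [norm_mul, Real.norm_eq_abs]; gcongr; exact hb x)
  · refine Measure.integrableOn_of_bounded (M := |ξ * (j+1) * c ^ j| * C) (by simp) ?_ ?_
    · have : Measurable fun x : ℝ => |ξ * (j+1) * x ^ j| := by fun_prop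
      exact (this.smul hmc).aestronglyMeasurable
    · refine (ae_restrict_iff' measurableSet_Icc).2 (ae_of_all _ fun x hx => ?_)
      rw [norm_smul, Real.norm_eq_abs, abs_abs]
      have hx0 : 0 ≤ x := hd.le.trans hx.1
      have := hx.2
      have hc0 : 0 ≤ c := hx0.trans this
      gcongr ?_ * ?_
      · rw [abs_of_nonneg (by positivity), abs_of_nonneg (by positivity)]
        gcongr
      · exact hb x
  · exact measurableSet_Icc
  · intro x hx
    have hx0 : 0 ≤ x := hd.le.trans hx.1
    have := hx.1
    rw [smul_eq_mul, abs_of_nonneg (by positivity)]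
    have := h0 (φ x)
    gcongr

theorem comp_int_le (h : ℝ → ℝ) (hm : Measurable h) (h0 : ∀ x, 0 ≤ h x) (C : ℝ) (hC : ∀ x, h x ≤ C)
    (hper : ∀ x, h (x + 1) = h x) (ξ A B : ℝ) (hξ : 0 < ξ) (hA : 1 < A) (hAB : B - A = 1) (m : ℕ) (hm1 : 1 ≤ m) :
    ∫ x in A..B, h (ξ * x ^ m) ≤ (1 + 2 / ξ) * ∫ x in (0:ℝ)..1, h x := by
  obtain ⟨j, rfl⟩ : ∃ j, m = j + 1 := ⟨m - 1, by omega⟩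
  set Ib := ∫ x in (0:ℝ)..1, h x with hIb
  have hIb0 : 0 ≤ Ib := intervalIntegral.integral_nonneg zero_le_one fun x _ => h0 x
  have hii : ∀ a b, IntervalIntegrable (fun x => h (ξ * x ^ (j+1))) volume a b := by
    intro a b
    rw [intervalIntegrable_iff]
    exact Measure.integrableOn_of_bounded (M := C) (by simp) (hm.comp (by fun_prop)).aestronglyMeasurable
      (ae_of_all _ fun x => by rw [Real.norm_eq_abs, abs_of_nonneg (h0 _)]; exact hC _)
  have key : ∀ n : ℕ, ∀ c, A ≤ c → ξ * c ^ (j+1) ≤ ξ * A ^ (j+1) + n + 1 →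
      ∫ x in A..c, h (ξ * x ^ (j+1)) ≤ Ib * (1/ξ + (1 + 1/ξ) * (c - A)) := by
    intro n
    have base : ∀ c, A ≤ c → ξ * c ^ (j+1) ≤ ξ * A ^ (j+1) + 1 →
      ∫ x in A..c, h (ξ * x ^ (j+1)) ≤ Ib * (1/ξ + (1 + 1/ξ) * (c - A)) := by
      intro c hc hφ
      have h1 := comp_int_bound h hm h0 C hC hper ξ hξ j A c (by linarith) hc hφ
      have hJ : 0 ≤ ∫ x in A..c, h (ξ * x ^ (j+1)) := intervalIntegral.integral_nonneg hc fun x _ => h0 _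
      have h2 : ξ * ∫ x in A..c, h (ξ * x ^ (j+1)) ≤ Ib := by
        refine le_trans ?_ h1
        gcongr
        have : 1 ≤ A ^ j := one_le_pow₀ hA.le
        have h3 : (1:ℝ) ≤ (j:ℝ) + 1 := by linarith [(Nat.cast_nonneg j : (0:ℝ) ≤ j)]
        have : 1 ≤ ((j:ℝ)+1) * A ^ j := one_le_mul_of_one_le_of_one_le h3 this
        rw [mul_assoc]
        exact le_mul_of_one_le_right hξ.le this
      have h4 : ∫ x in A..c, h (ξ * x ^ (j+1)) ≤ Ib * (1/ξ) := by
        rw [mul_one_div, le_div_iff₀ hξ]; linarith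
      refine h4.trans ?_
      gcongr
      have : 0 ≤ c - A := by linarith
      have : 0 ≤ (1 + 1/ξ) * (c - A) := by positivity
      linarith
    induction n with
    | zero => intro c hc hφ; exact base c hc (by simpa using hφ)
    | succ n ih =>
      intro c hc hφ
      by_cases hle : ξ * c ^ (j+1) ≤ ξ * A ^ (j+1) + 1
      · exact base c hc hle
      push Not at hle
      have hcont : ContinuousOn (fun x : ℝ => ξ * x ^ (j+1)) (Set.Icc A c) := by fun_prop
      obtain ⟨d, hd, hdv⟩ := intermediate_value_Icc hc hcont (show ξ * c ^ (j+1) - 1 ∈ _ from ⟨by linarith, by linarith⟩)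
      simp only at hdv
      have h1 := ih d hd.1 (by push_cast at hφ; linarith)
      have hd1 : 1 < d := lt_of_lt_of_le hA hd.1
      have h2 := comp_int_bound h hm h0 C hC hper ξ hξ j d c (by linarith) hd.2 (by linarith)
      rw [← hIb] at h2
      have hJ : 0 ≤ ∫ x in d..c, h (ξ * x ^ (j+1)) := intervalIntegral.integral_nonneg hd.2 fun x _ => h0 _
      have hdc := hd.2
      have hc0 : 0 ≤ c := by linarith
      -- 1 ≤ φ'(c)(c-d)
      have h3 : c ^ (j+1) - d ^ (j+1) ≤ (j+1) * c ^ j * (c - d) := by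
        have : c ^ (j+1) - d ^ (j+1) = (∑ i ∈ Finset.range (j+1), c ^ i * d ^ (j + 1 - 1 - i)) * (c - d) :=
          (geom_sum₂_mul c d (j+1)).symm
        rw [this]
        have : 0 ≤ c - d := by linarith
        gcongr
        calc _ ≤ ∑ i ∈ Finset.range (j+1), c ^ j := by
              apply Finset.sum_le_sum
              intro i hi
              have hi' := Finset.mem_range.1 hi
              calc c ^ i * d ^ (j + 1 - 1 - i) ≤ c ^ i * c ^ (j + 1 - 1 - i) := by gcongr
                _ = c ^ j := by rw [← pow_add]; congr 1; omega
          _ = _ := by simp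
      have h4 : ξ * c ^ j ≤ (1 + 1/ξ) * (ξ * d ^ j) := by
        -- c^j d <= c^{j+1}... c^j/d^j ≤ c^{j+1}/d^{j+1}
        have e1 : ξ * c ^ (j+1) = ξ * d ^ (j+1) + 1 := by linarith
        have e2 : 1 ≤ d ^ (j+1) := one_le_pow₀ hd1.le
        have e3 : ξ * c ^ (j+1) ≤ (1 + 1/ξ) * (ξ * d^(j+1)) := by
          rw [e1, add_mul, one_mul]
          have : 1/ξ * (ξ * d^(j+1)) = d^(j+1) := by field_simp
          rw [this]; linarith
        have e4 : c * (ξ * c ^ j) ≤ c * ((1 + 1/ξ) * (ξ * d^j)) := by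
          calc c * (ξ * c ^ j) = ξ * c ^ (j+1) := by ring
            _ ≤ (1 + 1/ξ) * (ξ * d^(j+1)) := e3
            _ = d * ((1 + 1/ξ) * (ξ * d^j)) := by ring
            _ ≤ c * ((1 + 1/ξ) * (ξ * d^j)) := by gcongr
        exact le_of_mul_le_mul_left e4 (by linarith)
      have h5 : 1 ≤ (1 + 1/ξ) * (ξ * (j+1) * d^j) * (c - d) := by
        have : 0 ≤ c - d := by linarith
        calc (1:ℝ) = ξ * (c ^ (j+1) - d ^ (j+1)) := by linarith
          _ ≤ ξ * ((j+1) * c ^ j * (c - d)) := by gcongr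
          _ = (ξ * c ^ j) * ((j+1) * (c - d)) := by ring
          _ ≤ ((1 + 1/ξ) * (ξ * d ^ j)) * ((j+1) * (c - d)) := by gcongr
          _ = _ := by ring
      have h6 : ∫ x in d..c, h (ξ * x ^ (j+1)) ≤ Ib * ((1 + 1/ξ) * (c - d)) := by
        have : 0 ≤ c - d := by linarith
        calc ∫ x in d..c, h (ξ * x ^ (j+1)) = 1 * ∫ x in d..c, h (ξ * x ^ (j+1)) := by ring
          _ ≤ ((1 + 1/ξ) * (ξ * (j+1) * d^j) * (c - d)) * ∫ x in d..c, h (ξ * x ^ (j+1)) := by gcongr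
          _ = ((1 + 1/ξ) * (c - d)) * ((ξ * (j+1) * d^j) * ∫ x in d..c, h (ξ * x ^ (j+1))) := by ring
          _ ≤ ((1 + 1/ξ) * (c - d)) * Ib := by gcongr
          _ = _ := by ring
      rw [← intervalIntegral.integral_add_adjacent_intervals (hii A d) (hii d c)]
      calc _ ≤ Ib * (1/ξ + (1 + 1/ξ) * (d - A)) + Ib * ((1 + 1/ξ) * (c - d)) := add_le_add h1 h6
        _ = _ := by ring
  obtain ⟨n, hn⟩ := exists_nat_ge (ξ * B ^ (j+1) - ξ * A ^ (j+1))
  have := key n B (by linarith) (by linarith)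
  refine this.trans (le_of_eq ?_)
  rw [hAB]; ring

open MeasureTheory Filter ProbabilityTheory

theorem indep_prod {Ω' : Type*} [MeasurableSpace Ω'] {P' : Measure Ω'} {Y : ℕ → Ω' → ℝ} {𝕜 : Type*} [RCLike 𝕜]
    (hY : iIndepFun Y P') (mY : ∀ n, Measurable (Y n)) (F : ℕ → ℝ → 𝕜) (hF : ∀ n, Measurable (F n)) (S : Finset ℕ) :
    ∫ ω, ∏ v ∈ S, F v (Y v ω) ∂P' = ∏ v ∈ S, ∫ ω, F v (Y v ω) ∂P' := by
  have h1 : iIndepFun (fun v : S => Y v) P' := hY.precomp Subtype.val_injective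
  have h2 := h1.integral_fun_prod_comp (f := fun v : S => F v) (fun i => (mY i).aemeasurable)
    (fun i => (hF i).aestronglyMeasurable)
  have e1 : ∀ ω, ∏ v ∈ S, F v (Y v ω) = ∏ v : S, F v (Y v ω) := fun ω => (Finset.prod_coe_sort S (fun v => F v (Y v ω))).symm
  simp_rw [e1]
  rw [h2, ← Finset.prod_coe_sort S]

theorem prod_diff_le {ι : Type*} (S : Finset ι) (a b : ι → ℂ) (L : ℝ) (hL : 1 ≤ L)
    (ha : ∀ i ∈ S, ‖a i‖ ≤ L) (hb : ∀ i ∈ S, ‖b i‖ ≤ L) :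
    ‖∏ i ∈ S, a i - ∏ i ∈ S, b i‖ ≤ L ^ S.card * ∑ i ∈ S, ‖a i - b i‖ := by
  classical
  induction S using Finset.induction_on with
  | empty => simp
  | insert j S hj ih =>
    rw [Finset.prod_insert hj, Finset.prod_insert hj, Finset.sum_insert hj, Finset.card_insert_of_notMem hj]
    have ih' := ih (fun i hi => ha i (Finset.mem_insert_of_mem hi)) (fun i hi => hb i (Finset.mem_insert_of_mem hi))
    have e : a j * ∏ i ∈ S, a i - b j * ∏ i ∈ S, b i = a j * (∏ i ∈ S, a i - ∏ i ∈ S, b i) + (a j - b j) * ∏ i ∈ S, b i := by ring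
    rw [e]
    have hpb : ‖∏ i ∈ S, b i‖ ≤ L ^ S.card := by
      rw [norm_prod]
      refine (Finset.prod_le_prod (fun _ _ => norm_nonneg _) fun i hi => hb i (Finset.mem_insert_of_mem hi)).trans ?_
      simp
    have haj := ha j (Finset.mem_insert_self _ _)
    have hL0 : 0 ≤ L := by linarith
    calc _ ≤ ‖a j‖ * ‖∏ i ∈ S, a i - ∏ i ∈ S, b i‖ + ‖a j - b j‖ * ‖∏ i ∈ S, b i‖ := by
          refine (norm_add_le _ _).trans ?_
          rw [norm_mul, norm_mul]
      _ ≤ L * (L ^ S.card * ∑ i ∈ S, ‖a i - b i‖) + ‖a j - b j‖ * (L ^ S.card * L) := by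
          gcongr
          exact hpb.trans (le_mul_of_one_le_right (by positivity) hL)
      _ = _ := by ring

noncomputable def mu01 : Measure ℝ := volume.restrict (Set.Ioc 0 1)
instance : IsProbabilityMeasure mu01 := ⟨by simp [mu01]⟩
noncomputable def PP : Measure (ℕ → ℝ) := Measure.infinitePi (fun _ : ℕ => mu01)
instance : IsProbabilityMeasure PP := by unfold PP; infer_instance

theorem PP_eval {E : Type*} [NormedAddCommGroup E] [NormedSpace ℝ E] (F : ℝ → E) (hF : StronglyMeasurable F) (n : ℕ) :
    ∫ ω, F (ω n) ∂PP = ∫ x in (0:ℝ)..1, F x := by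
  rw [intervalIntegral.integral_of_le zero_le_one]
  have := Measure.infinitePi_map_eval (fun _ : ℕ => mu01) n
  change ∫ ω, F (ω n) ∂PP = ∫ x, F x ∂mu01
  rw [← this, integral_map (measurable_pi_apply n).aemeasurable]
  · rfl
  · exact hF.aestronglyMeasurable

theorem PP_indep : iIndepFun (fun (n : ℕ) (ω : ℕ → ℝ) => ω n) PP :=
  iIndepFun_infinitePi (X := fun _ x => x) (fun _ => measurable_id)

/-- comparison for pure exponentials -/
theorem char_compare (ξ A B : ℝ) (hξ : 0 < ξ) (hA : 1 < A) (hAB : B - A = 1) (s : ℕ → ℕ) (hs : StrictMono s)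
    (p M : ℕ) (hM : 2 ≤ M) (n : Fin p → ℕ) (hn : ∀ i, M ≤ n i) (κ : Fin p → ℤ) :
    ‖(∫ x in A..B, ∏ i, ee (κ i) (ξ * x ^ s (n i))) - ∫ ω, ∏ i, ee (κ i) (ω (n i)) ∂PP‖ ≤
      (4 + A / ξ) * 4 ^ p * A ^ (-((M:ℝ) / 2 ^ (p + 1))) := by
  classical
  set V : Finset ℕ := Finset.univ.image n with hV
  set K : ℕ → ℤ := fun v => ∑ i with n i = v, κ i with hK
  have hgrp : ∀ y : ℕ → ℝ, ∏ i, ee (κ i) (y (n i)) = ∏ v ∈ V, ee (K v) (y v) := by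
    intro y
    rw [← Finset.prod_fiberwise_of_maps_to (s := Finset.univ) (t := V) (g := n) (fun i _ => Finset.mem_image_of_mem n (Finset.mem_univ i))]
    refine Finset.prod_congr rfl fun v _ => ?_
    simp only [hK, ee]
    push_cast
    rw [Finset.mul_sum, Finset.sum_mul]
    rw [Complex.exp_sum]
    refine Finset.prod_congr rfl fun i hi => ?_
    rw [(Finset.mem_filter.1 hi).2]
  have h2 : ∫ ω, ∏ i, ee (κ i) (ω (n i)) ∂PP = ∏ v ∈ V, (if K v = 0 then (1:ℂ) else 0) := by
    simp_rw [hgrp]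
    rw [indep_prod PP_indep (fun n => by fun_prop) (fun v => ee (K v)) (fun v => (ee_cont _).measurable) V]
    refine Finset.prod_congr rfl fun v _ => ?_
    rw [PP_eval _ (ee_cont _).stronglyMeasurable, ee_int]
  have h1 : ∀ x, ∏ i, ee (κ i) (ξ * x ^ s (n i)) = ∏ v ∈ V, ee (K v) (ξ * x ^ s v) := fun x => hgrp (fun v => ξ * x ^ s v)
  simp_rw [h1]
  rw [h2]
  set T := V.filter (fun v => K v ≠ 0) with hT
  have hTp : ∀ x, ∏ v ∈ V, ee (K v) (ξ * x ^ s v) = ∏ v ∈ T, ee (K v) (ξ * x ^ s v) := by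
    intro x
    symm
    apply Finset.prod_subset (Finset.filter_subset _ _)
    intro v hv hvT
    have : K v = 0 := by by_contra h; exact hvT (Finset.mem_filter.2 ⟨hv, h⟩)
    rw [this]; simp [ee]
  simp_rw [hTp]
  have hRHS : 0 ≤ (4 + A / ξ) * 4 ^ p * A ^ (-((M:ℝ) / 2 ^ (p + 1))) := by positivity
  rcases T.eq_empty_or_nonempty with hTe | hTn
  · have : ∏ v ∈ V, (if K v = 0 then (1:ℂ) else 0) = 1 := by
      apply Finset.prod_eq_one
      intro v hv
      rw [if_pos]
      by_contra h
      have : v ∈ T := Finset.mem_filter.2 ⟨hv, h⟩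
      rw [hTe] at this; simp at this
    rw [this, hTe]
    simpa [hAB] using hRHS
  · have : ∏ v ∈ V, (if K v = 0 then (1:ℂ) else 0) = 0 := by
      obtain ⟨v, hv⟩ := hTn
      obtain ⟨hv1, hv2⟩ := Finset.mem_filter.1 hv
      exact Finset.prod_eq_zero hv1 (if_neg hv2)
    rw [this, sub_zero]
    set c : ℕ → ℝ := fun m => (K (Function.invFun s m) : ℝ) with hc
    have hcs : ∀ v, c (s v) = K v := fun v => by
      simp only [hc]; rw [Function.leftInverse_invFun hs.injective v]
    have := osc_final ξ A B hξ hA (by linarith) p M (T.map ⟨s, hs.injective⟩) c (hTn.map) (by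
      rw [Finset.card_map]
      have h1 := Finset.card_filter_le V (fun v => K v ≠ 0)
      have h2 := Finset.card_image_le (s := (Finset.univ : Finset (Fin p))) (f := n)
      rw [Finset.card_univ, Fintype.card_fin] at h2
      exact (h1.trans h2).trans (Nat.le_succ p)) (by
      intro m hm
      obtain ⟨v, hv, rfl⟩ := Finset.mem_map.1 hm
      simp only [Function.Embedding.coeFn_mk, hcs]
      have := Int.one_le_abs (Finset.mem_filter.1 hv).2
      exact_mod_cast this) hM (by
      intro m hm
      obtain ⟨v, hv, rfl⟩ := Finset.mem_map.1 hm
      obtain ⟨i, _, rfl⟩ := Finset.mem_image.1 (Finset.mem_filter.1 hv).1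
      exact (hn i).trans (hs.le_apply))
    refine le_trans (le_of_eq ?_) this
    congr 2
    funext x
    rw [Finset.sum_map]
    simp only [Function.Embedding.coeFn_mk, hcs, ee]
    rw [← Complex.exp_sum]
    congr 1
    push_cast
    rw [Finset.mul_sum, Finset.mul_sum]
    refine Finset.sum_congr rfl fun v _ => ?_
    ring

open MeasureTheory Filter ProbabilityTheory

theorem prod_compare {α : Type*} [MeasurableSpace α] (ν : Measure α) [IsProbabilityMeasure ν] (p : ℕ) (y : Fin p → α → ℝ)
    (hy : ∀ i, Measurable (y i)) (f : ℝ → ℝ) (hf : Measurable f) (g : ℝ → ℂ) (hg : Measurable g) (L : ℝ) (hL : 1 ≤ L)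
    (hfb : ∀ x, |f x| ≤ L) (hgb : ∀ x, ‖g x‖ ≤ L) (ε : ℝ) (hε : ∀ i, ∫ a, ‖(f (y i a) : ℂ) - g (y i a)‖ ∂ν ≤ ε) :
    ‖((∫ a, ∏ i, f (y i a) ∂ν : ℝ) : ℂ) - ∫ a, ∏ i, g (y i a) ∂ν‖ ≤ L ^ p * (p * ε) := by
  have hfc : Measurable fun x => (f x : ℂ) := Complex.measurable_ofReal.comp hf
  have hL0 : 0 ≤ L := by linarith
  have i1 : Integrable (fun a => ∏ i, (f (y i a) : ℂ)) ν := by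
    refine Integrable.of_bound (C := L ^ p) (Finset.measurable_prod _ fun i _ => hfc.comp (hy i)).aestronglyMeasurable (ae_of_all _ fun a => ?_)
    rw [norm_prod]
    refine (Finset.prod_le_prod (fun _ _ => norm_nonneg _) fun i _ => (?_ : _ ≤ L)).trans (by simp)
    rw [Complex.norm_real]; exact hfb _
  have i2 : Integrable (fun a => ∏ i, g (y i a)) ν := by
    refine Integrable.of_bound (C := L ^ p) (Finset.measurable_prod _ fun i _ => hg.comp (hy i)).aestronglyMeasurable (ae_of_all _ fun a => ?_)
    rw [norm_prod]
    exact (Finset.prod_le_prod (fun _ _ => norm_nonneg _) fun i _ => hgb _).trans (by simp)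
  have i3 : ∀ i, Integrable (fun a => ‖(f (y i a) : ℂ) - g (y i a)‖) ν := by
    intro i
    refine Integrable.of_bound (C := L + L) ((hfc.comp (hy i)).sub (hg.comp (hy i))).norm.aestronglyMeasurable (ae_of_all _ fun a => ?_)
    rw [norm_norm]
    refine (norm_sub_le _ _).trans (add_le_add ?_ (hgb _))
    rw [Complex.norm_real]; exact hfb _
  rw [← integral_complex_ofReal]
  push_cast
  rw [← integral_sub i1 i2]
  calc _ ≤ ∫ a, ‖∏ i, (f (y i a) : ℂ) - ∏ i, g (y i a)‖ ∂ν := norm_integral_le_integral_norm _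
    _ ≤ ∫ a, L ^ p * ∑ i, ‖(f (y i a) : ℂ) - g (y i a)‖ ∂ν := by
        refine integral_mono (i1.sub i2).norm ((integrable_finsetSum _ fun i _ => i3 i).const_mul _) fun a => ?_
        have := prod_diff_le Finset.univ (fun i => (f (y i a) : ℂ)) (fun i => g (y i a)) L hL
          (fun i _ => by rw [Complex.norm_real]; exact hfb _) (fun i _ => hgb _)
        simpa using this
    _ = L ^ p * ∑ i, ∫ a, ‖(f (y i a) : ℂ) - g (y i a)‖ ∂ν := by
        rw [integral_const_mul, integral_finsetSum _ fun i _ => i3 i]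
    _ ≤ L ^ p * ∑ i : Fin p, ε := by gcongr with i _; exact hε i
    _ = _ := by simp

theorem prod_expand {α : Type*} [MeasurableSpace α] (ν : Measure α) [IsProbabilityMeasure ν] (p : ℕ) (y : Fin p → α → ℝ)
    (hy : ∀ i, Measurable (y i)) (D : Finset ℤ) (c : ℤ → ℂ) :
    ∫ a, ∏ i, (∑ k ∈ D, c k * ee k (y i a)) ∂ν =
      ∑ κ ∈ Fintype.piFinset (fun _ : Fin p => D), (∏ i, c (κ i)) * ∫ a, ∏ i, ee (κ i) (y i a) ∂ν := by
  simp_rw [Finset.prod_univ_sum, Finset.prod_mul_distrib]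
  rw [integral_finsetSum]
  · simp_rw [integral_const_mul]
  · intro κ _
    refine Integrable.const_mul ?_ _
    refine Integrable.of_bound (C := 1) (Finset.measurable_prod _ fun i _ => (ee_cont _).measurable.comp (hy i)).aestronglyMeasurable (ae_of_all _ fun a => ?_)
    rw [norm_prod]
    simp [ee_norm]

noncomputable def PA (A B : ℝ) : Measure ℝ := volume.restrict (Set.Ioc A B)

theorem quantH (ξ A B : ℝ) (hξ : 0 < ξ) (hA : 1 < A) (hAB : B - A = 1) (s : ℕ → ℕ) (hs : StrictMono s)
    (f : ℝ → ℝ) (hper : ∀ x : ℝ, f (x + 1) = f x)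
    (hint : (∫ x in (0:ℝ)..1, f x) = 0)
    (hvar : eVariationOn f (Set.Icc (0:ℝ) 1) ≤ 2)
    (p M t : ℕ) (hM : 2 ≤ M) (n : Fin p → ℕ) (hn : ∀ i, M ≤ n i) :
    |(∫ x, ∏ i, f (ξ * x ^ s (n i)) ∂(PA A B)) - ∫ ω, ∏ i, f (ω (n i)) ∂PP| ≤
      (4 * (1 + 2 * t)) ^ p * ((p * ((1 + 2/ξ) * (4 / 2 ^ t)) + p * (4 / 2^t)) +
       (4 + A / ξ) * 4 ^ p * A ^ (-((M:ℝ) / 2 ^ (p + 1)))) := by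
  have hm := f_meas f hper hvar
  have hb := f_bound f hper hint hvar
  have hle : A ≤ B := by linarith
  haveI : IsProbabilityMeasure (PA A B) := ⟨by simp [PA, hAB]⟩
  obtain ⟨c, hc1, hc2⟩ := trig_approx f hm hb hint hvar t
  set D := Finset.Icc (-(4:ℤ)^t) (4^t) with hD
  set g : ℝ → ℂ := fun x => ∑ k ∈ D, c k * ee k x with hg
  set L : ℝ := 4 * (1 + 2 * t) with hL
  have ht0 : (0:ℝ) ≤ t := by positivity
  have hL1 : 1 ≤ L := by rw [hL]; linarith
  have hgm : Measurable g := (continuous_finsetSum _ fun k _ => continuous_const.mul (ee_cont _)).measurable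
  have hgb : ∀ x, ‖g x‖ ≤ L := by
    intro x
    refine le_trans ((norm_sum_le _ _).trans (Finset.sum_le_sum fun k _ => ?_)) hc1
    rw [norm_mul, ee_norm, mul_one]
  have hfb : ∀ x, |f x| ≤ L := fun x => (hb x).trans (by rw [hL]; linarith)
  have hfc : Measurable fun x => (f x : ℂ) := Complex.measurable_ofReal.comp hm
  have hum : Measurable fun x => ‖(f x : ℂ) - g x‖ := (hfc.sub hgm).norm
  have e1 := prod_compare (PA A B) p (fun i x => ξ * x ^ s (n i)) (fun i => by fun_prop) f hm g hgm L hL1 hfb hgb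
    ((1 + 2/ξ) * (4 / 2 ^ t)) (by
      intro i
      have h1 := comp_int_le (fun x => ‖(f x : ℂ) - g x‖) hum (fun x => norm_nonneg _) (L + L) (fun x => by
        refine (norm_sub_le _ _).trans (add_le_add ?_ (hgb _))
        rw [Complex.norm_real]; exact hfb _) (fun x => by simp only [hg]; simp_rw [hper, ee_per]) ξ A B hξ hA hAB (s (n i)) (by
          have := hn i
          have h2 := hs.le_apply (x := n i)
          omega)
      rw [intervalIntegral.integral_of_le hle] at h1
      exact h1.trans (by gcongr))
  have e2 := prod_compare PP p (fun i ω => ω (n i)) (fun i => by fun_prop) f hm g hgm L hL1 hfb hgb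
    (4 / 2 ^ t) (by
      intro i
      rw [PP_eval (fun x => ‖(f x : ℂ) - g x‖) hum.stronglyMeasurable]
      exact hc2)
  set E := (4 + A / ξ) * 4 ^ p * A ^ (-((M:ℝ) / 2 ^ (p + 1))) with hE
  have hE0 : 0 ≤ E := by positivity
  have e3 : ‖(∫ x, ∏ i, g (ξ * x ^ s (n i)) ∂(PA A B)) - ∫ ω, ∏ i, g (ω (n i)) ∂PP‖ ≤ L ^ p * E := by
    simp only [hg]
    rw [prod_expand (PA A B) p (fun i x => ξ * x ^ s (n i)) (fun i => by fun_prop) D c,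
      prod_expand PP p (fun i ω => ω (n i)) (fun i => by fun_prop) D c, ← Finset.sum_sub_distrib]
    refine (norm_sum_le _ _).trans ?_
    have : ∀ κ ∈ Fintype.piFinset (fun _ : Fin p => D),
        ‖(∏ i, c (κ i)) * (∫ x, ∏ i, ee (κ i) (ξ * x ^ s (n i)) ∂(PA A B)) - (∏ i, c (κ i)) * ∫ ω, ∏ i, ee (κ i) (ω (n i)) ∂PP‖
        ≤ (∏ i, ‖c (κ i)‖) * E := by
      intro κ _
      rw [← mul_sub, norm_mul, norm_prod]
      gcongr
      have := char_compare ξ A B hξ hA hAB s hs p M hM n hn κ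
      rw [intervalIntegral.integral_of_le hle] at this
      exact this
    refine (Finset.sum_le_sum this).trans ?_
    rw [← Finset.sum_mul]
    gcongr
    rw [Finset.sum_prod_piFinset D (fun _ k => ‖c k‖)]
    refine (Finset.prod_le_prod (fun _ _ => Finset.sum_nonneg fun _ _ => norm_nonneg _) fun i _ => hc1).trans (by simp)
  have : ((((∫ x, ∏ i, f (ξ * x ^ s (n i)) ∂(PA A B)) - ∫ ω, ∏ i, f (ω (n i)) ∂PP : ℝ)) : ℂ) =
     (((∫ x, ∏ i, f (ξ * x ^ s (n i)) ∂(PA A B) : ℝ) : ℂ) - (∫ x, ∏ i, g (ξ * x ^ s (n i)) ∂(PA A B))) +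
     ((∫ x, ∏ i, g (ξ * x ^ s (n i)) ∂(PA A B)) - ∫ ω, ∏ i, g (ω (n i)) ∂PP)
     - (((∫ ω, ∏ i, f (ω (n i)) ∂PP : ℝ) : ℂ) - ∫ ω, ∏ i, g (ω (n i)) ∂PP) := by
    push_cast; ring
  rw [← Real.norm_eq_abs, ← Complex.norm_real, this]
  refine (norm_sub_le _ _).trans ?_
  have := norm_add_le (((∫ x, ∏ i, f (ξ * x ^ s (n i)) ∂(PA A B) : ℝ) : ℂ) - (∫ x, ∏ i, g (ξ * x ^ s (n i)) ∂(PA A B)))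
     ((∫ x, ∏ i, g (ξ * x ^ s (n i)) ∂(PA A B)) - ∫ ω, ∏ i, g (ω (n i)) ∂PP)
  have hfin : L ^ p * ((p * ((1 + 2/ξ) * (4 / 2 ^ t)) + p * (4 / 2^t)) + E) = 
    L ^ p * (p * ((1 + 2/ξ) * (4 / 2 ^ t))) + L ^ p * E + L ^ p * (p * (4 / 2 ^ t)) := by ring
  rw [hfin]
  linarith

open MeasureTheory Filter ProbabilityTheory

theorem asymH (a C : ℝ) (ha : 0 < a) : ∀ᶠ N : ℕ in atTop, 12 ≤ N ∧ Real.log N ≥ 1 ∧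
    C + (Real.log N)^2 + 2 * Real.log N ≤ a * (N:ℝ) ^ (3/8 : ℝ) := by
  have h1 : ∀ᶠ x : ℝ in atTop, ‖(Real.log x) ^ (2:ℝ)‖ ≤ (a/4) * ‖x ^ (3/8 : ℝ)‖ :=
    (isLittleO_log_rpow_rpow_atTop 2 (by norm_num : (0:ℝ) < 3/8)).bound (by positivity)
  have h2 : ∀ᶠ x : ℝ in atTop, max 1 C ≤ Real.log x := Real.tendsto_log_atTop.eventually_ge_atTop _
  have h3 := tendsto_natCast_atTop_atTop (R := ℝ)
  filter_upwards [h3.eventually h1, h3.eventually h2, eventually_ge_atTop 12] with N e1 e2 e3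
  have e4 : 1 ≤ Real.log N := (le_max_left _ _).trans e2
  have e5 : C ≤ Real.log N := (le_max_right _ _).trans e2
  refine ⟨e3, e4, ?_⟩
  rw [Real.rpow_two, Real.norm_eq_abs, abs_of_nonneg (by positivity), Real.norm_eq_abs, abs_of_nonneg (by positivity)] at e1
  nlinarith

theorem thmH (ξ A B : ℝ) (hξ : 0 < ξ) (hA : 1 < A) (hAB : B - A = 1) (s : ℕ → ℕ) (hs : StrictMono s)
    (f : ℝ → ℝ) (hper : ∀ x : ℝ, f (x + 1) = f x)
    (hint : (∫ x in (0:ℝ)..1, f x) = 0)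
    (hvar : eVariationOn f (Set.Icc (0:ℝ) 1) ≤ 2) :
    ∃ N0 : ℕ, ∀ N, N0 ≤ N → ∀ p : ℕ, (p:ℝ) ≤ Real.log N / 8 → ∀ n : Fin p → ℕ, (∀ i, N ≤ (n i)^2) → 
      |(∫ x, ∏ i, f (ξ * x ^ s (n i)) ∂(PA A B)) - ∫ ω, ∏ i, f (ω (n i)) ∂PP| ≤ 1 / (N:ℝ)^(p+1) := by
  set a : ℝ := min (Real.log 2) (Real.log A / 4) with ha
  have hlA : 0 < Real.log A := Real.log_pos hA
  have ha0 : 0 < a := lt_min (Real.log_pos (by norm_num)) (by positivity)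
  set C1 : ℝ := (1 + 2/ξ) * 4 + 4 with hC1
  set C2 : ℝ := 4 + A / ξ with hC2
  have hC1p : 0 < C1 := by positivity
  have hC2p : 0 < C2 := by positivity
  obtain ⟨N0, hN0⟩ := eventually_atTop.1 (asymH a (Real.log (C1 + C2)) ha0)
  refine ⟨N0, fun N hN p hp n hn => ?_⟩
  obtain ⟨hN12, hL1, hmain⟩ := hN0 N hN
  set L := Real.log N with hL
  have hNr : (12:ℝ) ≤ N := by exact_mod_cast hN12
  have hN0' : (0:ℝ) < N := by linarith
  have hNexp : (N:ℝ) = Real.exp L := (Real.exp_log hN0').symm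
  set M := Nat.sqrt N with hM
  have hM2 : 2 ≤ M := by
    rw [hM, Nat.le_sqrt']; omega
  have hMn : ∀ i, M ≤ n i := fun i => by
    have : Nat.sqrt N ≤ Nat.sqrt ((n i)^2) := Nat.sqrt_le_sqrt (hn i)
    rwa [Nat.sqrt_eq'] at this
  refine (quantH ξ A B hξ hA hAB s hs f hper hint hvar p M N hM2 n hMn).trans ?_
  have hp0 : (0:ℝ) ≤ p := by positivity
  -- Λ^p
  have b1 : (4 * (1 + 2 * (N:ℝ))) ^ p ≤ Real.exp (L^2/4) := by
    calc (4 * (1 + 2 * (N:ℝ))) ^ p ≤ ((N:ℝ)^2) ^ p := by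
          gcongr; nlinarith
      _ = Real.exp (2 * L * p) := by
          rw [hNexp, ← Real.exp_nat_mul, ← Real.exp_nat_mul]; congr 1; push_cast; ring
      _ ≤ _ := by
          apply Real.exp_le_exp.2; nlinarith
  have b2 : (N:ℝ) ^ (p+1) ≤ Real.exp (L^2/8 + L) := by
    rw [hNexp, ← Real.exp_nat_mul]
    apply Real.exp_le_exp.2; push_cast; nlinarith
  have hN38 : (N:ℝ) ^ (3/8:ℝ) ≤ N := by
    conv_rhs => rw [← Real.rpow_one (N:ℝ)]
    apply Real.rpow_le_rpow_of_exponent_le (by linarith) (by norm_num)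
  have hN380 : 0 ≤ (N:ℝ) ^ (3/8:ℝ) := by positivity
  set Z := Real.exp (-(a * (N:ℝ) ^ (3/8:ℝ))) with hZ
  have b3 : 1 / (2:ℝ) ^ N ≤ Z := by
    have : (2:ℝ)^N = Real.exp (N * Real.log 2) := by
      rw [Real.exp_nat_mul, Real.exp_log (by norm_num)]
    rw [this, one_div, ← Real.exp_neg, hZ]
    apply Real.exp_le_exp.2
    have : a ≤ Real.log 2 := min_le_left _ _
    have h2 : 0 < Real.log 2 := Real.log_pos (by norm_num)
    nlinarith
  have b4 : A ^ (-((M:ℝ) / 2 ^ (p + 1))) ≤ Z := by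
    rw [Real.rpow_def_of_pos (by linarith), hZ]
    apply Real.exp_le_exp.2
    have q1 : (2:ℝ)^p ≤ (N:ℝ)^(1/8:ℝ) := by
      rw [Real.rpow_def_of_pos hN0', ← hL]
      have : (2:ℝ)^p ≤ (Real.exp 1)^p := by
        gcongr; have := Real.add_one_le_exp (1:ℝ); linarith
      refine this.trans ?_
      rw [← Real.exp_nat_mul]
      apply Real.exp_le_exp.2; linarith
    have q2 : (N:ℝ)^(1/2:ℝ) / 2 ≤ M := by
      have : N < (M+1)^2 := Nat.lt_succ_sqrt' N
      have h3 : (N:ℝ) < ((M:ℝ)+1)^2 := by exact_mod_cast this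
      have h4 : (2:ℝ) ≤ M := by exact_mod_cast hM2
      rw [← Real.sqrt_eq_rpow]
      have : Real.sqrt N < (M:ℝ)+1 := by
        rw [Real.sqrt_lt' (by linarith)]; exact h3
      linarith
    have q3 : (N:ℝ)^(3/8:ℝ) / 4 ≤ (M:ℝ)/2^(p+1) := by
      rw [le_div_iff₀ (by positivity), pow_succ]
      calc (N:ℝ)^(3/8:ℝ) / 4 * (2^p*2) ≤ (N:ℝ)^(3/8:ℝ) / 4 * ((N:ℝ)^(1/8:ℝ)*2) := by gcongr
        _ = ((N:ℝ)^(3/8:ℝ) * (N:ℝ)^(1/8:ℝ)) / 2 := by ring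
        _ = (N:ℝ)^(1/2:ℝ) / 2 := by rw [← Real.rpow_add hN0']; norm_num
        _ ≤ M := q2
    have q4 : a ≤ Real.log A / 4 := min_le_right _ _
    nlinarith
  have b5 : (4:ℝ)^p ≤ Real.exp L := by
    have : (4:ℝ)^p ≤ (Real.exp 2)^p := by
      gcongr
      have := Real.add_one_le_exp (1:ℝ)
      rw [show (2:ℝ) = 1 + 1 by norm_num, Real.exp_add]; nlinarith
    refine this.trans ?_
    rw [← Real.exp_nat_mul]
    apply Real.exp_le_exp.2; linarith
  have b6 : (p:ℝ) ≤ Real.exp L := by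
    have := Real.add_one_le_exp L
    linarith
  have hZ0 : 0 < Z := Real.exp_pos _
  rw [le_div_iff₀ (by positivity)]
  calc _ ≤ Real.exp (L^2/4) * (Real.exp L * (C1 * Z) + C2 * Real.exp L * Z) * Real.exp (L^2/8 + L) := by
        gcongr
        calc (p:ℝ) * ((1 + 2 / ξ) * (4 / 2 ^ N)) + p * (4 / 2 ^ N) = p * (C1 * (1 / 2 ^ N)) := by rw [hC1]; ring
          _ ≤ _ := by gcongr
    _ = (C1 + C2) * (Real.exp (L^2/4) * Real.exp L * Real.exp (L^2/8 + L) * Z) := by ring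
    _ = Real.exp (Real.log (C1 + C2) + (L^2/4 + L + (L^2/8 + L) - a * (N:ℝ) ^ (3/8:ℝ))) := by
        rw [sub_eq_add_neg]; simp only [Real.exp_add]; rw [Real.exp_log (show 0 < C1 + C2 by positivity)]
    _ ≤ Real.exp 0 := by
        apply Real.exp_le_exp.2; nlinarith
    _ = 1 := Real.exp_zero

open MeasureTheory Filter ProbabilityTheory

structure Cmp {Ω Ω' : Type*} [MeasurableSpace Ω] [MeasurableSpace Ω'] (P : Measure Ω) (P' : Measure Ω')
    (X : ℕ → Ω → ℝ) (Y : ℕ → Ω' → ℝ) (σ : ℝ) : Prop where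
  mX : ∀ n, Measurable (X n)
  mY : ∀ n, Measurable (Y n)
  bX : ∀ n x, |X n x| ≤ 2
  bY : ∀ n x, |Y n x| ≤ 2
  ind : iIndepFun Y P'
  mean : ∀ n, ∫ ω, Y n ω ∂P' = 0
  var : ∀ n, ∫ ω, (Y n ω)^2 ∂P' = σ^2
  H : ∃ N0 : ℕ, ∀ N, N0 ≤ N → ∀ p : ℕ, (p:ℝ) ≤ Real.log N / 8 → ∀ n : Fin p → ℕ, (∀ i, N ≤ (n i)^2) → 
      |(∫ x, ∏ i, X (n i) x ∂P) - ∫ ω, ∏ i, Y (n i) ω ∂P'| ≤ 1 / (N:ℝ)^(p+1)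

section
variable {Ω Ω' : Type*} [MeasurableSpace Ω] [MeasurableSpace Ω'] {P : Measure Ω} {P' : Measure Ω'}
    {X : ℕ → Ω → ℝ} {Y : ℕ → Ω' → ℝ} {σ : ℝ}

theorem wsum_pow_integral {Ω : Type*} [MeasurableSpace Ω] {P : Measure Ω} {X : ℕ → Ω → ℝ} [IsProbabilityMeasure P] (mX : ∀ n, Measurable (X n)) (bX : ∀ n x, |X n x| ≤ 2) (S : Finset ℕ) (a : ℕ → ℝ) (p : ℕ) :
    ∫ x, (∑ i ∈ S, a i * X i x)^p ∂P =
      ∑ κ ∈ Fintype.piFinset (fun _ : Fin p => S), (∏ i, a (κ i)) * ∫ x, ∏ i, X (κ i) x ∂P := by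
  have : ∀ x, (∑ i ∈ S, a i * X i x)^p = ∑ κ ∈ Fintype.piFinset (fun _ : Fin p => S), (∏ i, a (κ i)) * ∏ i, X (κ i) x := by
    intro x
    have e : (∑ i ∈ S, a i * X i x)^p = ∏ _i : Fin p, ∑ i ∈ S, a i * X i x := by simp
    rw [e, Finset.prod_univ_sum]
    simp_rw [Finset.prod_mul_distrib]
  simp_rw [this]
  rw [integral_finsetSum]
  · simp_rw [integral_const_mul]
  · intro κ _
    refine Integrable.const_mul ?_ _
    refine Integrable.of_bound (C := 2 ^ p) (Finset.measurable_prod _ fun i _ => mX _).aestronglyMeasurable (ae_of_all _ fun a => ?_)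
    rw [norm_prod]
    exact (Finset.prod_le_prod (fun _ _ => norm_nonneg _) fun i _ => bX _ _).trans (by simp)

theorem Cmp.M1 [IsProbabilityMeasure P] [IsProbabilityMeasure P'] (h : Cmp P P' X Y σ) :
    ∃ N0 : ℕ, 2 ≤ N0 ∧ ∀ N, N0 ≤ N → ∀ p : ℕ, (p:ℝ) ≤ Real.log N / 8 → ∀ (S : Finset ℕ) (a : ℕ → ℝ),
      (∀ i ∈ S, |a i| ≤ 1) → (∀ i ∈ S, N ≤ i^2) → S.card ≤ N → 
      |(∫ x, (∑ i ∈ S, a i * X i x)^p ∂P) - ∫ ω, (∑ i ∈ S, a i * Y i ω)^p ∂P'| ≤ 1 / (N:ℝ) := by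
  obtain ⟨N0, hN0⟩ := h.H
  refine ⟨max N0 2, le_max_right _ _, fun N hN p hp S a ha hS hc => ?_⟩
  have hN2 : 2 ≤ N := (le_max_right _ _).trans hN
  have hNpos : (0:ℝ) < N := by exact_mod_cast (by omega : 0 < N)
  rw [wsum_pow_integral h.mX h.bX, wsum_pow_integral h.mY h.bY, ← Finset.sum_sub_distrib]
  refine (Finset.abs_sum_le_sum_abs _ _).trans ?_
  have : ∀ κ ∈ Fintype.piFinset (fun _ : Fin p => S), |(∏ i, a (κ i)) * (∫ x, ∏ i, X (κ i) x ∂P) - (∏ i, a (κ i)) * ∫ x, ∏ i, Y (κ i) x ∂P'|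
      ≤ 1 / (N:ℝ)^(p+1) := by
    intro κ hκ
    have hκ' := Fintype.mem_piFinset.1 hκ
    rw [← mul_sub, abs_mul, Finset.abs_prod]
    have h1 : ∏ i, |a (κ i)| ≤ 1 := Finset.prod_le_one (fun _ _ => abs_nonneg _) fun i _ => ha _ (hκ' i)
    have h2 := hN0 N ((le_max_left _ _).trans hN) p hp κ (fun i => hS _ (hκ' i))
    calc _ ≤ 1 * (1 / (N:ℝ)^(p+1)) := by gcongr
      _ = _ := one_mul _
  refine (Finset.sum_le_card_nsmul _ _ _ this).trans ?_
  rw [Fintype.card_piFinset]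
  simp only [Finset.prod_const, Finset.card_univ, Fintype.card_fin, nsmul_eq_mul]
  push_cast
  have h3 : (S.card:ℝ) ^ p ≤ (N:ℝ)^p := by gcongr
  calc (S.card:ℝ) ^ p * (1 / (N:ℝ)^(p+1)) ≤ (N:ℝ)^p * (1 / (N:ℝ)^(p+1)) := by gcongr
    _ = 1 / N := by rw [pow_succ]; field_simp

theorem wsum_meas {Ω : Type*} [MeasurableSpace Ω] {X : ℕ → Ω → ℝ} (mX : ∀ n, Measurable (X n)) (S : Finset ℕ) (a : ℕ → ℝ) :
    Measurable fun x => ∑ i ∈ S, a i * X i x :=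
  Finset.measurable_sum _ fun i _ => (mX i).const_mul _

theorem wsum_bd {Ω : Type*} {X : ℕ → Ω → ℝ} (bX : ∀ n x, |X n x| ≤ 2) (S : Finset ℕ) (a : ℕ → ℝ) (x : Ω) :
    |∑ i ∈ S, a i * X i x| ≤ ∑ i ∈ S, |a i| * 2 := by
  refine (Finset.abs_sum_le_sum_abs _ _).trans (Finset.sum_le_sum fun i _ => ?_)
  rw [abs_mul]; gcongr; exact bX i x

theorem mom_gen [IsProbabilityMeasure P] (W : Ω → ℝ) (mW : Measurable W) (C : ℝ) (hW : ∀ x, |W x| ≤ C) (q : ℕ) (hq : 1 ≤ q)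
    (V : ℝ) (hV : 0 < V)
    (h1 : ∫ x, Real.exp (Real.sqrt (2*q/V) * W x) ∂P ≤ Real.exp (Real.sqrt (2*q/V) ^2 * V / 2))
    (h2 : ∫ x, Real.exp (-Real.sqrt (2*q/V) * W x) ∂P ≤ Real.exp (Real.sqrt (2*q/V) ^2 * V / 2)) :
    ∫ x, (W x)^(2*q) ∂P ≤ 2 * (2 * q * V / Real.exp 1)^q := by
  set l := Real.sqrt (2*q/V) with hl
  have hq0 : (0:ℝ) < q := by exact_mod_cast hq
  have hl0 : 0 < l := Real.sqrt_pos.2 (by positivity)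
  have hl2 : l^2 = 2*q/V := Real.sq_sqrt (by positivity)
  have iexp : ∀ c : ℝ, Integrable (fun x => Real.exp (c * W x)) P := by
    intro c
    refine Integrable.of_bound (C := Real.exp (|c| * C)) (mW.const_mul c).exp.aestronglyMeasurable (ae_of_all _ fun x => ?_)
    rw [Real.norm_eq_abs, Real.abs_exp]
    apply Real.exp_le_exp.2
    calc c * W x ≤ |c * W x| := le_abs_self _
      _ = |c| * |W x| := abs_mul _ _
      _ ≤ _ := by gcongr; exact hW x
  have hpt : ∀ x, (W x)^(2*q) ≤ (2 * q * V / Real.exp 2)^q * (Real.exp (l * W x) + Real.exp (-l * W x)) := by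
    intro x
    have e0 : l * |W x| / (2*q) ≤ Real.exp (l * |W x| / (2*q) - 1) := by
      have := Real.add_one_le_exp (l * |W x| / (2*q) - 1); linarith
    have e1 := pow_le_pow_left₀ (by positivity) e0 (2*q)
    rw [← Real.exp_nat_mul] at e1
    have e2 : ((2*q : ℕ):ℝ) * (l * |W x| / (2*q) - 1) = l * |W x| + (-2 * q) := by push_cast; field_simp; ring
    rw [e2, Real.exp_add] at e1
    have e3 : (l * |W x| / (2*q))^(2*q) = (l^2 / (4 * q^2))^q * (W x)^(2*q) := by
      rw [mul_comm l, mul_div_assoc, mul_pow, (even_two_mul q).pow_abs, mul_comm]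
      congr 1
      rw [pow_mul]; congr 1; rw [div_pow]; ring
    rw [e3, hl2] at e1
    have e4 : 2 * (q:ℝ) / V / (4 * q^2) = (2 * q * V)⁻¹ * 1 := by field_simp; norm_num
    have e5 : Real.exp (l * |W x|) ≤ Real.exp (l * W x) + Real.exp (-l * W x) := by
      rcases abs_choice (W x) with h | h <;> rw [h]
      · linarith [Real.exp_pos (-l * W x)]
      · rw [show l * -W x = -l * W x by ring]; linarith [Real.exp_pos (l * W x)]
    rw [e4, mul_one, inv_pow, inv_mul_le_iff₀ (by positivity)] at e1
    refine e1.trans ?_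
    have e6 : Real.exp (-2 * q) = ((Real.exp 2)⁻¹)^q := by
      rw [← Real.exp_neg, ← Real.exp_nat_mul]; congr 1; ring
    rw [e6, div_eq_mul_inv]
    calc _ = ((2 * (q:ℝ) * V)^q * ((Real.exp 2)⁻¹)^q) * Real.exp (l * |W x|) := by ring
      _ = (2 * (q:ℝ) * V * (Real.exp 2)⁻¹)^q * Real.exp (l * |W x|) := by rw [← mul_pow]
      _ ≤ _ := by gcongr
  calc ∫ x, (W x)^(2*q) ∂P ≤ ∫ x, (2 * q * V / Real.exp 2)^q * (Real.exp (l * W x) + Real.exp (-l * W x)) ∂P := by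
        refine integral_mono ?_ (((iexp l).add (iexp (-l))).const_mul _) hpt
        refine Integrable.of_bound (C := C^(2*q)) (mW.pow_const _).aestronglyMeasurable (ae_of_all _ fun x => ?_)
        rw [norm_pow]; exact pow_le_pow_left₀ (norm_nonneg _) (hW x) _
    _ = (2 * q * V / Real.exp 2)^q * ((∫ x, Real.exp (l * W x) ∂P) + ∫ x, Real.exp (-l * W x) ∂P) := by
        rw [integral_const_mul, integral_add (iexp l) (iexp (-l))]
    _ ≤ (2 * q * V / Real.exp 2)^q * (Real.exp (l^2*V/2) + Real.exp (l^2*V/2)) := by gcongr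
    _ = 2 * (2 * q * V / Real.exp 1)^q := by
        have : Real.exp (l^2*V/2) = (Real.exp 1)^q := by
          rw [hl2, ← Real.exp_nat_mul]; congr 1; field_simp
        have h2 : Real.exp 2 = Real.exp 1 * Real.exp 1 := by rw [← Real.exp_add]; norm_num
        rw [this, h2, ← mul_two, ← mul_assoc, ← mul_pow]
        have : 2 * (q:ℝ) * V / (Real.exp 1 * Real.exp 1) * Real.exp 1 = 2 * q * V / Real.exp 1 := by
          field_simp
        rw [this]; ring

theorem mgf_sum_le (h : Cmp P P' X Y σ) (S : Finset ℕ) (a : ℕ → ℝ) (w : ℕ → ℝ) (l : ℝ)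
    (hw : ∀ i ∈ S, ∫ ω, Real.exp (l * a i * Y i ω) ∂P' ≤ Real.exp (w i)) :
    ∫ ω, Real.exp (l * ∑ i ∈ S, a i * Y i ω) ∂P' ≤ Real.exp (∑ i ∈ S, w i) := by
  have : ∀ ω, Real.exp (l * ∑ i ∈ S, a i * Y i ω) = ∏ i ∈ S, Real.exp (l * a i * Y i ω) := by
    intro ω
    rw [← Real.exp_sum, Finset.mul_sum]
    simp_rw [mul_assoc]
  simp_rw [this]
  rw [indep_prod (𝕜 := ℝ) h.ind h.mY (fun i y => Real.exp (l * a i * y)) (fun i => by fun_prop) S, Real.exp_sum]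
  exact Finset.prod_le_prod (fun i _ => integral_nonneg fun _ => (Real.exp_pos _).le) hw

theorem mgf_crude [IsProbabilityMeasure P'] (h : Cmp P P' X Y σ) (n : ℕ) (l : ℝ) :
    ∫ ω, Real.exp (l * Y n ω) ∂P' ≤ Real.exp (l^2 * 4 / 2) := by
  have := (hasSubgaussianMGF_of_mem_Icc_of_integral_eq_zero (μ := P') (X := Y n) (a := -2) (b := 2) (h.mY n).aemeasurable
    (ae_of_all _ fun ω => abs_le.1 (h.bY n ω)) (h.mean n)).mgf_le l
  unfold mgf at this
  refine this.trans (Real.exp_le_exp.2 (le_of_eq ?_))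
  simp
  norm_num
  ring

theorem mgf_sharp [IsProbabilityMeasure P'] (h : Cmp P P' X Y σ) (v : ℝ) (hv : σ^2 < v) :
    ∃ l0 : ℝ, 0 < l0 ∧ ∀ n l, |l| ≤ l0 → ∫ ω, Real.exp (l * Y n ω) ∂P' ≤ Real.exp (l^2 * v / 2) := by
  refine ⟨min (1/2) ((v - σ^2)/16), lt_min (by norm_num) (by linarith), fun n l hl => ?_⟩
  have hl1 : |l| ≤ 1/2 := hl.trans (min_le_left _ _)
  have hl2 : |l| ≤ (v - σ^2)/16 := hl.trans (min_le_right _ _)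
  have i1 : Integrable (Y n) P' := Integrable.of_bound (C := 2) (h.mY n).aestronglyMeasurable (ae_of_all _ (h.bY n))
  have i2 : Integrable (fun ω => (Y n ω)^2) P' := Integrable.of_bound (C := 2^2) ((h.mY n).pow_const 2).aestronglyMeasurable
    (ae_of_all _ fun ω => by rw [norm_pow]; exact pow_le_pow_left₀ (norm_nonneg _) (h.bY n ω) 2)
  have hpt : ∀ ω, Real.exp (l * Y n ω) ≤ (1 + l * Y n ω) + ((l^2/2) * (Y n ω)^2 + 8 * |l|^3) := by
    intro ω
    have hb := h.bY n ω
    have hx : |l * Y n ω| ≤ 1 := by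
      rw [abs_mul]; nlinarith [abs_nonneg l, abs_nonneg (Y n ω)]
    have := Real.exp_bound hx (n := 3) (by norm_num)
    simp [Finset.sum_range_succ, Nat.factorial] at this
    have h3 := (abs_le.1 this).2
    have h4 : (|l| * |Y n ω|)^3 ≤ 8 * |l|^3 := by
      rw [mul_pow]
      have := pow_le_pow_left₀ (abs_nonneg _) hb 3
      nlinarith [pow_nonneg (abs_nonneg l) 3]
    have h5 : 0 ≤ (|l| * |Y n ω|)^3 := by positivity
    have h6 : (|l| * |Y n ω|)^3 * (((3:ℝ)+1)/ (2 * 3 * 3)) ≤ (|l| * |Y n ω|)^3 := by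
      norm_num; linarith
    norm_num at h3 h6
    nlinarith
  calc ∫ ω, Real.exp (l * Y n ω) ∂P' ≤ ∫ ω, ((1 + l * Y n ω) + ((l^2/2) * (Y n ω)^2 + 8 * |l|^3)) ∂P' := by
        refine integral_mono_of_nonneg (ae_of_all _ fun _ => (Real.exp_pos _).le) ?_ (ae_of_all _ hpt)
        exact ((integrable_const _).add (i1.const_mul _)).add ((i2.const_mul _).add (integrable_const _))
    _ = 1 + ((l^2/2) * σ^2 + 8 * |l|^3) := by
        have j1 : Integrable (fun ω => 1 + l * Y n ω) P' := (integrable_const _).add (i1.const_mul _)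
        have j2 : Integrable (fun ω => (l^2/2) * (Y n ω)^2 + 8 * |l|^3) P' := (i2.const_mul _).add (integrable_const _)
        rw [integral_add j1 j2,
          integral_add (integrable_const _) (i1.const_mul _), integral_add (i2.const_mul _) (integrable_const _),
          integral_const_mul, integral_const_mul, h.mean, h.var]
        simp
    _ ≤ 1 + l^2 * v / 2 := by
        have : |l|^3 = l^2 * |l| := by rw [pow_succ, sq_abs]
        rw [this]
        nlinarith [sq_nonneg l]
    _ ≤ _ := by linarith [Real.add_one_le_exp (l^2 * v / 2)]

theorem mom_crude [IsProbabilityMeasure P'] (h : Cmp P P' X Y σ) (S : Finset ℕ) (a : ℕ → ℝ) (q : ℕ) (hq : 1 ≤ q)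
    (V : ℝ) (hV : 0 < V) (hVa : ∑ i ∈ S, 4 * (a i)^2 ≤ V) :
    ∫ ω, (∑ i ∈ S, a i * Y i ω)^(2*q) ∂P' ≤ 2 * (2 * q * V / Real.exp 1)^q := by
  have key : ∀ l : ℝ, ∫ ω, Real.exp (l * ∑ i ∈ S, a i * Y i ω) ∂P' ≤ Real.exp (l^2 * V / 2) := by
    intro l
    refine (mgf_sum_le h S a (fun i => (l * a i)^2 * 4 / 2) l fun i _ => mgf_crude h i (l * a i)).trans ?_
    apply Real.exp_le_exp.2
    have : ∑ i ∈ S, (l * a i)^2 * 4 / 2 = l^2 / 2 * ∑ i ∈ S, 4 * (a i)^2 := by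
      rw [Finset.mul_sum]; refine Finset.sum_congr rfl fun i _ => ?_; ring
    rw [this]
    nlinarith [sq_nonneg l]
  refine mom_gen _ (wsum_meas h.mY S a) _ (wsum_bd h.bY S a) q hq V hV (key _) ?_
  have := key (-Real.sqrt (2*q/V))
  rwa [neg_sq] at this

theorem mom_sharp [IsProbabilityMeasure P'] (h : Cmp P P' X Y σ) (v : ℝ) (hv : σ^2 < v) :
    ∃ l0 : ℝ, 0 < l0 ∧ ∀ (S : Finset ℕ) (q : ℕ) (V : ℝ), 1 ≤ q → 0 < V → v * S.card ≤ V → 2 * q / V ≤ l0 →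
    ∫ ω, (∑ i ∈ S, 1 * Y i ω)^(2*q) ∂P' ≤ 2 * (2 * q * V / Real.exp 1)^q := by
  obtain ⟨l0, hl0, hl⟩ := mgf_sharp h v hv
  refine ⟨l0^2, by positivity, fun S q V hq hV hVS hqV => ?_⟩
  have hsl : |Real.sqrt (2*q/V)| ≤ l0 := by
    rw [abs_of_nonneg (Real.sqrt_nonneg _)]
    exact (Real.sqrt_le_left hl0.le).2 hqV
  have key : ∀ l : ℝ, |l| ≤ l0 → ∫ ω, Real.exp (l * ∑ i ∈ S, 1 * Y i ω) ∂P' ≤ Real.exp (l^2 * V / 2) := by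
    intro l hll
    refine (mgf_sum_le h S (fun _ => 1) (fun i => l^2 * v / 2) l fun i _ => by simpa using hl i l hll).trans ?_
    apply Real.exp_le_exp.2
    rw [Finset.sum_const, nsmul_eq_mul]
    nlinarith [sq_nonneg l]
  refine mom_gen _ (wsum_meas h.mY S _) _ (wsum_bd h.bY S _) q hq V hV (key _ hsl) ?_
  have := key (-Real.sqrt (2*q/V)) (by rwa [abs_neg])
  rwa [neg_sq] at this

end

open MeasureTheory Filter ProbabilityTheory

section
variable {Ω Ω' : Type*} [MeasurableSpace Ω] [MeasurableSpace Ω'] {P : Measure Ω} {P' : Measure Ω'}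
    {X : ℕ → Ω → ℝ} {Y : ℕ → Ω' → ℝ} {σ : ℝ}

theorem tail_of_mom [IsProbabilityMeasure P] (mX : ∀ n, Measurable (X n)) (bX : ∀ n x, |X n x| ≤ 2) (S : Finset ℕ) (q : ℕ) (M t : ℝ) (ht : 0 < t)
    (hM : ∫ x, (∑ i ∈ S, 1 * X i x)^(2*q) ∂P ≤ 3 * M^q) :
    P.real {x | t ≤ |∑ i ∈ S, X i x|} ≤ 3 * (M/t^2)^q := by
  have hi : Integrable (fun x => (∑ i ∈ S, 1 * X i x)^(2*q)) P := by
    refine Integrable.of_bound (C := (∑ i ∈ S, |(1:ℝ)| * 2)^(2*q)) ((wsum_meas mX S fun _ => 1).pow_const _).aestronglyMeasurable (ae_of_all _ fun x => ?_)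
    rw [norm_pow]; exact pow_le_pow_left₀ (norm_nonneg _) (wsum_bd bX S (fun _ => 1) x) _
  have h1 := mul_meas_ge_le_integral_of_nonneg (μ := P) (f := fun x => (∑ i ∈ S, 1 * X i x)^(2*q)) 
    (ae_of_all _ fun x => (even_two_mul q).pow_nonneg _) hi (t^(2*q))
  have h2 : P.real {x | t ≤ |∑ i ∈ S, X i x|} ≤ P.real {x | t^(2*q) ≤ (∑ i ∈ S, 1 * X i x)^(2*q)} := by
    refine measureReal_mono fun x hx => ?_
    simp only [Set.mem_ofPred_eq, one_mul] at hx ⊢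
    rw [← (even_two_mul q).pow_abs (∑ i ∈ S, X i x)]
    exact pow_le_pow_left₀ ht.le hx _
  have h3 : t^(2*q) * P.real {x | t ≤ |∑ i ∈ S, X i x|} ≤ 3 * M^q :=
    (mul_le_mul_of_nonneg_left h2 (by positivity)).trans (h1.trans hM)
  rw [div_pow, ← pow_mul, ← mul_div_assoc, le_div_iff₀ (by positivity)]
  linarith

theorem tail_crude [IsProbabilityMeasure P] [IsProbabilityMeasure P'] (h : Cmp P P' X Y σ) :
    ∃ N0 : ℕ, ∀ N, N0 ≤ N → ∀ (S : Finset ℕ) (l q : ℕ) (t : ℝ), 1 ≤ q → 1 ≤ l → 0 < t → ((2*q:ℕ):ℝ) ≤ Real.log N / 8 →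
      (∀ i ∈ S, N ≤ i^2) → S.card ≤ N → S.card ≤ l → 
      P.real {x | t ≤ |∑ i ∈ S, X i x|} ≤ 3 * (8 * q * l / Real.exp 1 / t^2)^q := by
  obtain ⟨N0, hN2, hN0⟩ := h.M1
  refine ⟨N0, fun N hN S l q t hq hl ht hqN hS hSN hSl => tail_of_mom h.mX h.bX S q _ t ht ?_⟩
  have h1 := hN0 N hN (2*q) hqN S (fun _ => 1) (by simp) hS hSN
  have hq' : (1:ℝ) ≤ q := by exact_mod_cast hq
  have hl' : (1:ℝ) ≤ l := by exact_mod_cast hl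
  have hSl' : (S.card:ℝ) ≤ l := by exact_mod_cast hSl
  have h2 := mom_crude h S (fun _ => 1) q hq (4*l) (by positivity) (by simp; linarith)
  have h3 : (1:ℝ) ≤ (2 * q * (4*l) / Real.exp 1)^q := by
    apply one_le_pow₀
    rw [le_div_iff₀ (Real.exp_pos _)]
    have := Real.exp_one_lt_d9
    nlinarith
  have hN1 : (1:ℝ) ≤ N := by exact_mod_cast (by omega : 1 ≤ N)
  have h4 : 1/(N:ℝ) ≤ 1 := by rw [div_le_one (by linarith)]; exact hN1
  have h5 := (abs_le.1 h1).2
  have h6 : (8 * q * l / Real.exp 1 : ℝ) = 2 * q * (4*l) / Real.exp 1 := by ring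
  rw [h6]; linarith

theorem tail_sharp [IsProbabilityMeasure P] [IsProbabilityMeasure P'] (h : Cmp P P' X Y σ) (v : ℝ) (hv : σ^2 < v) :
    ∃ N0 : ℕ, ∃ l0 : ℝ, 0 < l0 ∧ ∀ N, N0 ≤ N → ∀ (S : Finset ℕ) (l q : ℕ) (t : ℝ), 1 ≤ q → 1 ≤ l → 0 < t → ((2*q:ℕ):ℝ) ≤ Real.log N / 8 →
      (∀ i ∈ S, N ≤ i^2) → S.card ≤ N → S.card ≤ l → 2 * q / (v * l) ≤ l0 → Real.exp 1 ≤ 2 * q * (v * l) → 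
      P.real {x | t ≤ |∑ i ∈ S, X i x|} ≤ 3 * (2 * q * (v*l) / Real.exp 1 / t^2)^q := by
  obtain ⟨N0, hN2, hN0⟩ := h.M1
  obtain ⟨l0, hl0, hs⟩ := mom_sharp h v hv
  refine ⟨N0, l0, hl0, fun N hN S l q t hq hl ht hqN hS hSN hSl hlq he => tail_of_mom h.mX h.bX S q _ t ht ?_⟩
  have hv0 : 0 < v := lt_of_le_of_lt (sq_nonneg _) hv
  have h1 := hN0 N hN (2*q) hqN S (fun _ => 1) (by simp) hS hSN
  have hq' : (1:ℝ) ≤ q := by exact_mod_cast hq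
  have hl' : (1:ℝ) ≤ l := by exact_mod_cast hl
  have hSl' : (S.card:ℝ) ≤ l := by exact_mod_cast hSl
  have h2 := hs S q (v*l) hq (by positivity) (by gcongr) hlq
  have h3 : (1:ℝ) ≤ (2 * q * (v*l) / Real.exp 1)^q := by
    apply one_le_pow₀
    rwa [le_div_iff₀ (Real.exp_pos _), one_mul]
  have hN1 : (1:ℝ) ≤ N := by exact_mod_cast (by omega : 1 ≤ N)
  have h4 : 1/(N:ℝ) ≤ 1 := by rw [div_le_one (by linarith)]; exact hN1
  have h5 := (abs_le.1 h1).2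
  linarith

theorem bc_lemma [IsProbabilityMeasure P] (E : ℕ → Set Ω) (b : ℕ → ℝ) (hb : Summable b) (hE : ∀ᶠ k in atTop, P.real (E k) ≤ b k) :
    ∀ᵐ x ∂P, ∀ᶠ k in atTop, x ∉ E k := by
  obtain ⟨k0, hk0⟩ := eventually_atTop.1 hE
  have hs : Summable fun k => P.real (E (k + k0)) :=
    Summable.of_nonneg_of_le (fun _ => measureReal_nonneg) (fun k => hk0 (k+k0) (by omega)) ((summable_nat_add_iff k0).2 hb)
  have h1 : ∑' k, P (E (k + k0)) ≠ ⊤ := by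
    have : ∀ k, P (E (k+k0)) = ENNReal.ofReal (P.real (E (k+k0))) := fun k => by
      rw [ofReal_measureReal]
    simp_rw [this]
    exact hs.tsum_ofReal_ne_top
  filter_upwards [ae_eventually_notMem h1] with x hx
  obtain ⟨a, ha⟩ := eventually_atTop.1 hx
  refine eventually_atTop.2 ⟨a + k0, fun k hk => ?_⟩
  have := ha (k - k0) (by omega)
  rwa [Nat.sub_add_cancel (by omega)] at this

theorem chain_det (g : ℕ → ℝ) (τ : ℕ → ℝ) (hτ : ∀ r, 0 ≤ τ r) (n : ℕ) (R : ℕ)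
    (hg : ∀ r < R, ∀ j, (j+1) * 2^r ≤ n → |g ((j+1)*2^r) - g (j * 2^r)| ≤ τ r) :
    |g n - g ((n / 2^R) * 2^R)| ≤ ∑ r ∈ Finset.range R, τ r := by
  induction R with
  | zero => simp
  | succ R ih =>
    have h1 := ih fun r hr => hg r (by omega)
    rw [Finset.sum_range_succ]
    have h2 : |g ((n / 2^R) * 2^R) - g ((n / 2^(R+1)) * 2^(R+1))| ≤ τ R := by
      have e : n / 2^(R+1) = n / 2^R / 2 := by rw [pow_succ, Nat.div_div_eq_div_mul]
      rw [e, pow_succ]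
      have hle : n / 2^R * 2^R ≤ n := Nat.div_mul_le_self _ _
      generalize n / 2^R = a at *
      obtain ⟨b, hb | hb⟩ : ∃ b, a = 2*b ∨ a = 2*b+1 := ⟨a/2, by omega⟩
      · have : a / 2 * (2^R * 2) = a * 2^R := by rw [hb]; simp; ring
        rw [this]; simpa using hτ R
      · have : a / 2 * (2^R * 2) = (2*b) * 2^R := by rw [hb, show (2*b+1)/2 = b by omega]; ring
        rw [this, hb]
        exact hg R (by omega) (2*b) (hb ▸ hle)
    calc _ ≤ |g n - g (n / 2^R * 2^R)| + |g (n / 2^R * 2^R) - g (n / 2^(R+1) * 2^(R+1))| := abs_sub_le _ _ _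
      _ ≤ _ := by linarith
end

open MeasureTheory Filter ProbabilityTheory

def TS {Ω : Type*} (X : ℕ → Ω → ℝ) (K n : ℕ) (x : Ω) : ℝ := ∑ i ∈ (Finset.Icc 1 n).filter (fun i => 2^K ≤ i^2), X i x

section
variable {Ω Ω' : Type*} [MeasurableSpace Ω] [MeasurableSpace Ω'] {P : Measure Ω} {P' : Measure Ω'}
    {X : ℕ → Ω → ℝ} {Y : ℕ → Ω' → ℝ} {σ : ℝ}

theorem TS_diff {Ω : Type*} (X : ℕ → Ω → ℝ) (K a b : ℕ) (hab : a ≤ b) (x : Ω) :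
    TS X K b x - TS X K a x = ∑ i ∈ (Finset.Ioc a b).filter (fun i => 2^K ≤ i^2), X i x := by
  unfold TS
  have : (Finset.Icc 1 b).filter (fun i => 2^K ≤ i^2) = (Finset.Icc 1 a).filter (fun i => 2^K ≤ i^2) ∪ (Finset.Ioc a b).filter (fun i => 2^K ≤ i^2) := by
    rw [← Finset.filter_union]; congr 1; ext i; simp; omega
  rw [this, Finset.sum_union]
  · ring
  · apply Finset.disjoint_filter_filter
    rw [Finset.disjoint_left]; intro i; simp; omega

theorem TS_trim {Ω : Type*} (X : ℕ → Ω → ℝ) (bX : ∀ n x, |X n x| ≤ 2) (K n : ℕ) (x : Ω) :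
    |∑ i ∈ Finset.Icc 1 n, X i x - TS X K n x| ≤ 2 * Real.sqrt (2^K) := by
  unfold TS
  have := Finset.sum_filter_add_sum_filter_not (Finset.Icc 1 n) (fun i => 2^K ≤ i^2) (fun i => X i x)
  rw [← this, add_sub_cancel_left]
  refine (Finset.abs_sum_le_sum_abs _ _).trans ?_
  refine (Finset.sum_le_card_nsmul _ _ 2 fun i _ => bX i x).trans ?_
  rw [nsmul_eq_mul, mul_comm]
  gcongr
  have h1 : ((Finset.Icc 1 n).filter (fun i => ¬ 2^K ≤ i^2)).card ≤ Nat.sqrt (2^K) := by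
    calc _ ≤ (Finset.Icc 1 (Nat.sqrt (2^K))).card := by
          apply Finset.card_le_card
          intro i hi
          simp only [Finset.mem_filter, Finset.mem_Icc, not_le] at hi ⊢
          exact ⟨hi.1.1, Nat.le_sqrt'.2 hi.2.le⟩
      _ = _ := by simp
  have h2 := Real.nat_sqrt_le_real_sqrt (a := 2^K)
  push_cast at h2
  exact (by exact_mod_cast h1 : _ ≤ ((Nat.sqrt (2^K) : ℕ):ℝ)).trans h2

theorem chain_prob [IsProbabilityMeasure P] [IsProbabilityMeasure P'] (h : Cmp P P' X Y σ) :
    ∃ K0 : ℕ, ∀ K, K0 ≤ K → ∀ q : ℕ, 4 ≤ q → ((2*q:ℕ):ℝ) ≤ Real.log ((2^K : ℕ):ℝ) / 8 → 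
      P.real (⋃ r ∈ Finset.range K, ⋃ j ∈ Finset.range (2^(K-r)), 
        {x | Real.sqrt (8 * q * 2^K) * (9/10)^(K-r) ≤ |TS X K ((j+1)*2^r) x - TS X K (j*2^r) x|}) ≤ 3 * Real.exp (-q) := by
  obtain ⟨N0, hN0⟩ := tail_crude h
  refine ⟨N0, fun K hK q hq hqK => ?_⟩
  have hNK : N0 ≤ 2^K := hK.trans (Nat.lt_two_pow_self).le
  have hq0 : (0:ℝ) < q := by exact_mod_cast (by omega : 0 < q)
  have h1 : ∀ r ∈ Finset.range K, ∀ j ∈ Finset.range (2^(K-r)), 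
      P.real {x | Real.sqrt (8 * q * 2^K) * (9/10)^(K-r) ≤ |TS X K ((j+1)*2^r) x - TS X K (j*2^r) x|} ≤ 3 * Real.exp (-q) * (1/4)^(K-r) := by
    intro r hr j hj
    have hrK := Finset.mem_range.1 hr
    have hcard : ((Finset.Ioc (j*2^r) ((j+1)*2^r)).filter (fun i => 2^K ≤ i^2)).card ≤ 2^r := by
      refine (Finset.card_filter_le _ _).trans ?_
      rw [Nat.card_Ioc]; rw [add_mul]; omega
    have hrK2 : 2^r ≤ 2^K := Nat.pow_le_pow_right (by norm_num) hrK.le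
    have := hN0 (2^K) hNK ((Finset.Ioc (j*2^r) ((j+1)*2^r)).filter (fun i => 2^K ≤ i^2)) (2^r) q (Real.sqrt (8 * q * 2^K) * (9/10)^(K-r))
      (by omega) Nat.one_le_two_pow (by positivity) hqK (fun i hi => (Finset.mem_filter.1 hi).2) (hcard.trans hrK2) hcard
    have e : ∀ x, TS X K ((j+1)*2^r) x - TS X K (j*2^r) x = ∑ i ∈ (Finset.Ioc (j*2^r) ((j+1)*2^r)).filter (fun i => 2^K ≤ i^2), X i x :=
      fun x => TS_diff X K _ _ (Nat.mul_le_mul_right _ (by omega)) x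
    simp_rw [e]
    refine this.trans ?_
    rw [mul_assoc 3 (Real.exp _)]
    gcongr 3 * ?_
    have e2 : (8 * q * ((2^r : ℕ):ℝ) / Real.exp 1 / (Real.sqrt (8 * q * 2^K) * (9/10)^(K-r))^2) = Real.exp (-1) * (50/81)^(K-r) := by
      rw [mul_pow, Real.sq_sqrt (by positivity), Real.exp_neg]
      have : (2:ℝ)^K = 2^r * 2^(K-r) := by rw [← pow_add]; congr 1; omega
      rw [this, ← pow_mul, mul_comm _ 2, pow_mul]
      have e3 : (50/81:ℝ)^(K-r) = 1 / (2^(K-r) * ((9/10)^2)^(K-r)) := by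
        rw [← mul_pow, ← one_div_pow]; norm_num
      rw [e3]; push_cast; field_simp
    rw [e2, mul_pow, ← Real.exp_nat_mul]
    have e4 : ((50/81:ℝ)^(K-r))^q ≤ (1/4)^(K-r) := by
      rw [← pow_mul, mul_comm, pow_mul]
      apply pow_le_pow_left₀ (by positivity)
      calc (50/81:ℝ)^q ≤ (50/81)^4 := pow_le_pow_of_le_one (by norm_num) (by norm_num) hq
        _ ≤ 1/4 := by norm_num
    rw [mul_neg_one]
    gcongr
  calc _ ≤ ∑ r ∈ Finset.range K, P.real (⋃ j ∈ Finset.range (2^(K-r)), 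
        {x | Real.sqrt (8 * q * 2^K) * (9/10)^(K-r) ≤ |TS X K ((j+1)*2^r) x - TS X K (j*2^r) x|}) := measureReal_biUnion_finset_le _ _
    _ ≤ ∑ r ∈ Finset.range K, ∑ j ∈ Finset.range (2^(K-r)), P.real
        {x | Real.sqrt (8 * q * 2^K) * (9/10)^(K-r) ≤ |TS X K ((j+1)*2^r) x - TS X K (j*2^r) x|} :=
        Finset.sum_le_sum fun r _ => measureReal_biUnion_finset_le _ _
    _ ≤ ∑ r ∈ Finset.range K, ∑ j ∈ Finset.range (2^(K-r)), 3 * Real.exp (-q) * (1/4)^(K-r) :=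
        Finset.sum_le_sum fun r hr => Finset.sum_le_sum fun j hj => h1 r hr j hj
    _ = 3 * Real.exp (-q) * ∑ r ∈ Finset.range K, (1/2)^(K-r) := by
        rw [Finset.mul_sum]
        refine Finset.sum_congr rfl fun r _ => ?_
        rw [Finset.sum_const, Finset.card_range, nsmul_eq_mul]; push_cast
        rw [show (1/2:ℝ) = 2 * (1/4) by norm_num, mul_pow]; ring
    _ ≤ 3 * Real.exp (-q) * 1 := by
        gcongr
        have : ∀ K : ℕ, ∑ r ∈ Finset.range K, (1/2:ℝ)^(K-r) = 1 - (1/2)^K := by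
          intro K
          induction K with
          | zero => simp
          | succ K ih => 
            rw [Finset.sum_range_succ]
            have : ∑ r ∈ Finset.range K, (1/2:ℝ)^(K+1-r) = (1/2) * ∑ r ∈ Finset.range K, (1/2:ℝ)^(K-r) := by
              rw [Finset.mul_sum]; refine Finset.sum_congr rfl fun r hr => ?_
              have := Finset.mem_range.1 hr
              rw [show K+1-r = (K-r)+1 by omega, pow_succ]; ring
            rw [this, ih]; simp; ring
        rw [this]
        have : (0:ℝ) ≤ (1/2)^K := by positivity
        linarith
    _ = _ := mul_one _

theorem grid_prob [IsProbabilityMeasure P] [IsProbabilityMeasure P'] (h : Cmp P P' X Y σ) (v : ℝ) (hv : σ^2 < v) (g : ℕ) :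
    ∃ K0 : ℕ, ∃ l0 : ℝ, 0 < l0 ∧ ∀ K, K0 ≤ K → g ≤ K → ∀ q : ℕ, 1 ≤ q → ((2*q:ℕ):ℝ) ≤ Real.log ((2^K : ℕ):ℝ) / 8 → 
      2 * q / (v * 2^(K-g)) ≤ l0 → Real.exp 1 ≤ v * 2^(K-g) → 
      P.real (⋃ j ∈ Finset.Icc 1 (2^g), 
        {x | Real.sqrt (2 * q * (v * ((j*2^(K-g) : ℕ):ℝ))) ≤ |TS X K (j*2^(K-g)) x|}) ≤ 2^g * (3 * Real.exp (-q)) := by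
  obtain ⟨N0, l0, hl0, hN0⟩ := tail_sharp h v hv
  have hv0 : 0 < v := lt_of_le_of_lt (sq_nonneg _) hv
  refine ⟨N0, l0, hl0, fun K hK hgK q hq hqK hqv hev => ?_⟩
  have hNK : N0 ≤ 2^K := hK.trans (Nat.lt_two_pow_self).le
  have hq0 : (1:ℝ) ≤ q := by exact_mod_cast hq
  have h1 : ∀ j ∈ Finset.Icc 1 (2^g), P.real {x | Real.sqrt (2 * q * (v * ((j*2^(K-g) : ℕ):ℝ))) ≤ |TS X K (j*2^(K-g)) x|} ≤ 3 * Real.exp (-q) := by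
    intro j hj
    have hj' := Finset.mem_Icc.1 hj
    have hj1 : (1:ℝ) ≤ j := by exact_mod_cast hj'.1
    have hcard : ((Finset.Icc 1 (j*2^(K-g))).filter (fun i => 2^K ≤ i^2)).card ≤ j * 2^(K-g) := by
      refine (Finset.card_filter_le _ _).trans ?_
      simp
    have hjK : j * 2^(K-g) ≤ 2^K := by
      calc j * 2^(K-g) ≤ 2^g * 2^(K-g) := Nat.mul_le_mul_right _ hj'.2
        _ = 2^K := by rw [← pow_add]; congr 1; omega
    have hle : v * 2^(K-g) ≤ v * ((j*2^(K-g) : ℕ):ℝ) := by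
      push_cast
      have : (0:ℝ) < 2^(K-g) := by positivity
      gcongr; nlinarith
    have hpos : (0:ℝ) < ((j*2^(K-g) : ℕ):ℝ) := by push_cast; positivity
    have := hN0 (2^K) hNK ((Finset.Icc 1 (j*2^(K-g))).filter (fun i => 2^K ≤ i^2)) (j*2^(K-g)) q (Real.sqrt (2 * q * (v * ((j*2^(K-g) : ℕ):ℝ))))
      hq (Nat.mul_pos hj'.1 (by positivity)) (Real.sqrt_pos.2 (by positivity)) hqK (fun i hi => (Finset.mem_filter.1 hi).2) (hcard.trans hjK) hcard
      (le_trans (by gcongr) hqv) (by nlinarith [Real.exp_pos 1])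
    unfold TS
    refine this.trans (le_of_eq ?_)
    rw [Real.sq_sqrt (by positivity)]
    have : 2 * q * (v * ((j*2^(K-g) : ℕ):ℝ)) / Real.exp 1 / (2 * q * (v * ((j*2^(K-g) : ℕ):ℝ))) = Real.exp (-1) := by
      rw [Real.exp_neg]; field_simp
    rw [this, ← Real.exp_nat_mul, mul_neg_one]
  refine (measureReal_biUnion_finset_le _ _).trans ?_
  refine (Finset.sum_le_card_nsmul _ _ _ h1).trans ?_
  simp
end

open MeasureTheory Filter ProbabilityTheory

theorem tlogK : Tendsto (fun K : ℕ => Real.log K) atTop atTop :=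
  Real.tendsto_log_atTop.comp tendsto_natCast_atTop_atTop

theorem ev_log_le (η : ℝ) (hη : 0 < η) : ∀ᶠ K : ℕ in atTop, Real.log K ≤ η * K := by
  have := (Real.isLittleO_log_id_atTop.bound hη)
  have h2 := (tendsto_natCast_atTop_atTop (R := ℝ)).eventually this
  filter_upwards [h2] with K hK
  simp only [id, Real.norm_eq_abs, Nat.abs_cast] at hK
  exact (le_abs_self _).trans hK

theorem ev_pow_small (ε : ℝ) (hε : 0 < ε) : ∀ᶠ K : ℕ in atTop, (K:ℝ) * (1/2)^K ≤ ε := by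
  have := tendsto_self_mul_const_pow_of_lt_one (r := (1/2:ℝ)) (by norm_num) (by norm_num)
  exact (this.eventually_lt_const hε).mono fun _ h => h.le

theorem tNatLog : Tendsto (fun n : ℕ => Nat.log 2 n + 1) atTop atTop := by
  refine tendsto_atTop.2 fun b => eventually_atTop.2 ⟨2^b, fun n hn => ?_⟩
  have := Nat.le_log_of_pow_le (b := 2) (by norm_num) hn
  omega

theorem geo910 (R g : ℕ) : ∑ r ∈ Finset.range R, (9/10:ℝ)^(R + g - r) ≤ 9 * (9/10)^g := by
  have : ∀ R : ℕ, ∑ r ∈ Finset.range R, (9/10:ℝ)^(R+g-r) = 9 * (9/10)^g * (1 - (9/10)^R) := by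
    intro R
    induction R with
    | zero => simp
    | succ K ih => 
      rw [Finset.sum_range_succ]
      have : ∑ r ∈ Finset.range K, (9/10:ℝ)^(K+1+g-r) = (9/10) * ∑ r ∈ Finset.range K, (9/10:ℝ)^(K+g-r) := by
        rw [Finset.mul_sum]; refine Finset.sum_congr rfl fun r hr => ?_
        have := Finset.mem_range.1 hr
        rw [show K+1+g-r = (K+g-r)+1 by omega, pow_succ]; ring
      rw [this, ih, show K+1+g-K = g+1 by omega]; ring
  rw [this]
  have h1 : (0:ℝ) ≤ (9/10)^g := by positivity
  have h2 : (0:ℝ) ≤ (9/10)^R := by positivity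
  nlinarith [mul_nonneg h1 h2]

theorem upper_det {Ω : Type*} (X : ℕ → Ω → ℝ) (bX : ∀ n x, |X n x| ≤ 2) (x : Ω) (K g q1 q2 n : ℕ) (v : ℝ) (hv : 0 < v) (hg : g ≤ K) (hn : n < 2^K)
    (h1 : x ∉ ⋃ r ∈ Finset.range K, ⋃ j ∈ Finset.range (2^(K-r)), 
        {x | Real.sqrt (8 * q2 * 2^K) * (9/10)^(K-r) ≤ |TS X K ((j+1)*2^r) x - TS X K (j*2^r) x|})
    (h2 : x ∉ ⋃ j ∈ Finset.Icc 1 (2^g), 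
        {x | Real.sqrt (2 * q1 * (v * ((j*2^(K-g) : ℕ):ℝ))) ≤ |TS X K (j*2^(K-g)) x|}) :
    |∑ i ∈ Finset.Icc 1 n, X i x| ≤ 2 * Real.sqrt (2^K) + Real.sqrt (2 * q1 * (v * n)) + 9 * (9/10)^g * Real.sqrt (8 * q2 * 2^K) := by
  simp only [Set.mem_iUnion, not_exists, Set.mem_ofPred_eq, not_le, Finset.mem_range, Finset.mem_Icc] at h1 h2
  have a1 := TS_trim X bX K n x
  have a2 := chain_det (fun n => TS X K n x) (fun r => Real.sqrt (8 * q2 * 2^K) * (9/10)^(K-r)) (fun r => by positivity) n (K-g) (by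
    intro r hr j hj
    refine (h1 r (by omega) j ?_).le
    have : (j+1) * 2^r < 2^(K-r) * 2^r := by
      rw [← pow_add, show K - r + r = K by omega]; omega
    have := lt_of_mul_lt_mul_right this (by positivity)
    omega)
  rw [← Finset.mul_sum] at a2
  have a3 := geo910 (K-g) g
  rw [Nat.sub_add_cancel hg] at a3
  have a4 : |TS X K (n / 2^(K-g) * 2^(K-g)) x| ≤ Real.sqrt (2 * q1 * (v * n)) := by
    have hle : n / 2^(K-g) * 2^(K-g) ≤ n := Nat.div_mul_le_self _ _
    rcases Nat.eq_zero_or_pos (n / 2^(K-g)) with h0 | h0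
    · rw [h0]; simp only [TS, zero_mul]; simp; positivity
    · refine (h2 _ ⟨h0, ?_⟩).le.trans (Real.sqrt_le_sqrt ?_)
      · have : n / 2^(K-g) * 2^(K-g) < 2^g * 2^(K-g) := by
          rw [← pow_add, show g + (K-g) = K by omega]; omega
        exact (lt_of_mul_lt_mul_right this (by positivity)).le
      · gcongr
  have a5 : Real.sqrt (8 * q2 * 2^K) * ∑ r ∈ Finset.range (K-g), (9/10:ℝ)^(K-r) ≤ 9 * (9/10)^g * Real.sqrt (8 * q2 * 2^K) := by
    rw [mul_comm]; gcongr
  rw [abs_le] at *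
  constructor <;> linarith [a1.1, a1.2, a2.1, a2.2, a4.1, a4.2]

section
variable {Ω Ω' : Type*} [MeasurableSpace Ω] [MeasurableSpace Ω'] {P : Measure Ω} {P' : Measure Ω'}
    {X : ℕ → Ω → ℝ} {Y : ℕ → Ω' → ℝ} {σ : ℝ}

theorem upper_prob [IsProbabilityMeasure P] [IsProbabilityMeasure P'] (h : Cmp P P' X Y σ) (v : ℝ) (hv : σ^2 < v) (g : ℕ) (δ : ℝ) (hδ : 0 < δ) :
    ∀ᵐ x ∂P, ∀ᶠ K : ℕ in atTop, ∃ q1 q2 : ℕ, (q1:ℝ) ≤ (1+2*δ) * Real.log K ∧ (q2:ℝ) ≤ 3 * Real.log K ∧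
      ∀ n < 2^K, |∑ i ∈ Finset.Icc 1 n, X i x| ≤ 2 * Real.sqrt (2^K) + Real.sqrt (2 * q1 * (v * n)) + 9 * (9/10)^g * Real.sqrt (8 * q2 * 2^K) := by
  have hv0 : 0 < v := lt_of_le_of_lt (sq_nonneg _) hv
  obtain ⟨K1, hK1⟩ := chain_prob h
  obtain ⟨K2, l0, hl0, hK2⟩ := grid_prob h v hv g
  set q1 : ℕ → ℕ := fun K => ⌈(1+δ) * Real.log K⌉₊ with hq1
  set q2 : ℕ → ℕ := fun K => ⌈2 * Real.log K⌉₊ + 4 with hq2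
  have hsq1 : ∀ᶠ K : ℕ in atTop, (q1 K:ℝ) ≤ (1+2*δ) * Real.log K ∧ (q2 K:ℝ) ≤ 3 * Real.log K := by
    filter_upwards [tlogK.eventually_ge_atTop (1/δ), tlogK.eventually_ge_atTop 5] with K h1 h5
    have h2 : 1 ≤ δ * Real.log K := by rw [div_le_iff₀ hδ] at h1; linarith
    have h3 := Nat.ceil_lt_add_one (a := (1+δ) * Real.log K) (by nlinarith)
    have h4 := Nat.ceil_lt_add_one (a := 2 * Real.log K) (by linarith)
    simp only [hq1, hq2]; push_cast
    constructor <;> nlinarith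
  have hlin : ∀ᶠ K : ℕ in atTop, (1+2*δ) * Real.log K ≤ K / 100 ∧ 3 * Real.log K ≤ K/100 := by
    filter_upwards [ev_log_le (1/(100 * (1+2*δ))) (by positivity), ev_log_le (1/300) (by norm_num)] with K h1 h2
    constructor
    · calc _ ≤ (1+2*δ) * (1/(100 * (1+2*δ)) * K) := by gcongr
        _ = _ := by field_simp
    · linarith
  have hA : ∀ᶠ K : ℕ in atTop, P.real ((⋃ r ∈ Finset.range K, ⋃ j ∈ Finset.range (2^(K-r)), 
        {x | Real.sqrt (8 * q2 K * 2^K) * (9/10)^(K-r) ≤ |TS X K ((j+1)*2^r) x - TS X K (j*2^r) x|}) ∪ ⋃ j ∈ Finset.Icc 1 (2^g), 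
        {x | Real.sqrt (2 * q1 K * (v * ((j*2^(K-g) : ℕ):ℝ))) ≤ |TS X K (j*2^(K-g)) x|})
        ≤ 3 * (K:ℝ)^(-2:ℝ) + 2^g * (3 * (K:ℝ)^(-(1+δ))) := by
    filter_upwards [hsq1, hlin, eventually_ge_atTop K1, eventually_ge_atTop K2, eventually_ge_atTop g, tlogK.eventually_ge_atTop 1, eventually_ge_atTop 1,
      ev_pow_small (l0 * v / 2 / 2^g) (by positivity), ev_pow_small (v / Real.exp 1 / 2^g) (by positivity)] with K hs hli h1 h2 h3 h4 hK0 h5 h6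
    have hKpos : (0:ℝ) < K := by exact_mod_cast hK0
    have hK1' : (1:ℝ) ≤ K := by exact_mod_cast hK0
    have hlog : Real.log ((2^K : ℕ):ℝ) / 8 = K * Real.log 2 / 8 := by push_cast; rw [Real.log_pow]
    have hl2 := Real.log_two_gt_d9
    have e1 : ((2 * q1 K : ℕ):ℝ) ≤ Real.log ((2^K : ℕ):ℝ) / 8 := by
      rw [hlog]; push_cast; nlinarith [hs.1, hli.1]
    have e2 : ((2 * q2 K : ℕ):ℝ) ≤ Real.log ((2^K : ℕ):ℝ) / 8 := by
      rw [hlog]; push_cast; nlinarith [hs.2, hli.2]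
    have e3 : (2:ℝ)^(K-g) = ((1/2)^K * 2^g)⁻¹ := by
      rw [pow_sub₀ _ (by norm_num) h3, one_div, inv_pow, mul_inv, inv_inv]
    have hq1p : 1 ≤ q1 K := Nat.one_le_ceil_iff.2 (by positivity)
    have p1 := hK1 K h1 (q2 K) (by simp [hq2]) e2
    have hq1K : (q1 K : ℝ) ≤ K := by linarith [hs.1, hli.1]
    have p2 := hK2 K h2 h3 (q1 K) hq1p e1 (by
      rw [e3, div_le_iff₀ (by positivity)]
      rw [le_div_iff₀ (by positivity)] at h5
      rw [← div_eq_mul_inv, ← mul_div_assoc, le_div_iff₀ (by positivity)]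
      have : (q1 K : ℝ) * ((1/2)^K * 2^g) ≤ K * ((1/2)^K * 2^g) := by gcongr
      nlinarith) (by
      rw [e3, ← div_eq_mul_inv, le_div_iff₀ (by positivity)]
      rw [le_div_iff₀ (by positivity), le_div_iff₀ (by positivity)] at h6
      have : 1 * ((1/2:ℝ)^K * 2^g * Real.exp 1) ≤ K * ((1/2)^K * 2^g * Real.exp 1) := by gcongr
      nlinarith)
    refine (measureReal_union_le _ _).trans (add_le_add (p1.trans ?_) (p2.trans ?_))
    · gcongr
      rw [Real.rpow_def_of_pos hKpos]
      apply Real.exp_le_exp.2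
      have := Nat.le_ceil (2 * Real.log K)
      simp only [hq2]; push_cast; linarith
    · gcongr
      rw [Real.rpow_def_of_pos hKpos]
      apply Real.exp_le_exp.2
      have := Nat.le_ceil ((1+δ) * Real.log K)
      simp only [hq1]; linarith
  have hsum : Summable fun K : ℕ => 3 * (K:ℝ)^(-2:ℝ) + 2^g * (3 * (K:ℝ)^(-(1+δ))) := by
    refine Summable.add (Summable.mul_left _ (Real.summable_nat_rpow.2 (by norm_num))) (Summable.mul_left _ (Summable.mul_left _ (Real.summable_nat_rpow.2 (by linarith))))
  filter_upwards [bc_lemma _ _ hsum hA] with x hx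
  filter_upwards [hx, hsq1, eventually_ge_atTop g] with K h1 h2 h3
  rw [Set.mem_union, not_or] at h1
  exact ⟨q1 K, q2 K, h2.1, h2.2, fun n hn => upper_det X h.bX x K g (q1 K) (q2 K) n v hv0 h3 hn h1.1 h1.2⟩

theorem loglog_ge (n K : ℕ) (hK : 2 ≤ K) (hn : 2^(K-1) ≤ n) : Real.log K - Real.log 4 ≤ Real.log (Real.log n) := by
  have h1 : ((K - 1 : ℕ):ℝ) * Real.log 2 ≤ Real.log n := by
    rw [← Real.log_pow]
    exact Real.log_le_log (by positivity) (by exact_mod_cast hn)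
  have hK' : (2:ℝ) ≤ K := by exact_mod_cast hK
  rw [← Real.log_div (by positivity) (by norm_num)]
  apply Real.log_le_log (by positivity)
  rw [Nat.cast_sub (by omega)] at h1
  push_cast at h1
  have := Real.log_two_gt_d9
  nlinarith

theorem upper [IsProbabilityMeasure P] [IsProbabilityMeasure P'] (h : Cmp P P' X Y σ) (hσ : 0 ≤ σ) (c : ℝ) (hc : Real.sqrt 2 * σ < c) :
    ∀ᵐ x ∂P, ∀ᶠ n : ℕ in atTop, |∑ i ∈ Finset.Icc 1 n, X i x| ≤ c * Real.sqrt (n * Real.log (Real.log n)) := by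
  obtain ⟨c1, hc1, hc1c⟩ := exists_between hc
  have hc1p : 0 < c1 := lt_of_le_of_lt (by positivity) hc1
  have hsq : 2 * σ^2 < c1^2 := by
    have : (Real.sqrt 2 * σ)^2 < c1^2 := by gcongr
    rwa [mul_pow, Real.sq_sqrt (by norm_num)] at this
  set v := (σ^2 + c1^2/2)/2 with hv
  have hv1 : σ^2 < v := by linarith
  have hv0 : 0 < v := lt_of_le_of_lt (sq_nonneg _) hv1
  set δ := (c1^2/(2*v) - 1)/2 with hδ
  have hδ0 : 0 < δ := by
    have : 1 < c1^2/(2*v) := by rw [lt_div_iff₀ (by positivity)]; linarith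
    linarith
  have hvd : 2 * v * (1+2*δ) = c1^2 := by rw [hδ]; field_simp; ring
  obtain ⟨g, hg⟩ := exists_pow_lt_of_lt_one (show 0 < (c - c1)/4/63 by linarith) (show (9/10:ℝ) < 1 by norm_num)
  set c2 := c1 + (c-c1)/2 with hc2
  have hc20 : 0 < c2 := by linarith
  have hc2c : c2^2 < c^2 := by gcongr; linarith
  filter_upwards [upper_prob h v hv1 g δ hδ0] with x hx
  have hT : ∀ᶠ K : ℕ in atTop, c2^2 * Real.log K ≤ c^2 * (Real.log K - Real.log 4) := by
    filter_upwards [tlogK.eventually_ge_atTop (c^2 * Real.log 4 / (c^2 - c2^2))] with K hK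
    rw [div_le_iff₀ (by linarith)] at hK
    linarith
  have hT2 : ∀ᶠ K : ℕ in atTop, 3 ≤ (c-c1)/4 * Real.sqrt (Real.log K) := by
    filter_upwards [tlogK.eventually_ge_atTop ((12/(c-c1))^2)] with K hK
    have := Real.le_sqrt_of_sq_le hK
    rw [div_le_iff₀ (by linarith)] at this
    linarith
  filter_upwards [tNatLog.eventually hx, tNatLog.eventually hT, tNatLog.eventually hT2, tNatLog.eventually_ge_atTop 2, eventually_ge_atTop 1] with n h1 h2 h3 h4 hn0
  set K := Nat.log 2 n + 1 with hKdef
  have hn1 : 2^(K-1) ≤ n := by rw [hKdef, Nat.add_sub_cancel]; exact Nat.pow_log_le_self 2 (by omega)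
  have hn2 : n < 2^K := Nat.lt_pow_succ_log_self (by norm_num) n
  have hll := loglog_ge n K h4 hn1
  obtain ⟨q1, q2, hq1, hq2, hq⟩ := h1
  have hmain := hq n hn2
  have h2K : (2:ℝ)^K ≤ 2 * n := by
    have : 2^K = 2 * 2^(K-1) := by rw [← pow_succ']; congr 1
    have h5 : 2^K ≤ 2 * n := by omega
    exact_mod_cast h5
  have hL : 0 ≤ Real.log K := Real.log_natCast_nonneg _
  have hnn : (0:ℝ) ≤ n := Nat.cast_nonneg _
  set L := Real.log K with hLdef
  have b1 : Real.sqrt (2 * q1 * (v * n)) ≤ c1 * (Real.sqrt n * Real.sqrt L) := by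
    rw [← Real.sqrt_mul hnn, ← Real.sqrt_sq hc1p.le, ← Real.sqrt_mul (by positivity)]
    apply Real.sqrt_le_sqrt
    rw [← hvd]
    calc 2 * q1 * (v * n) ≤ 2 * ((1+2*δ) * L) * (v * n) := by gcongr
      _ = _ := by ring
  have b2 : Real.sqrt (8 * q2 * 2^K) ≤ 7 * (Real.sqrt n * Real.sqrt L) := by
    rw [← Real.sqrt_mul hnn, show (7:ℝ) = Real.sqrt (7^2) by rw [Real.sqrt_sq (by norm_num)], ← Real.sqrt_mul (by positivity)]
    apply Real.sqrt_le_sqrt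
    calc 8 * q2 * (2:ℝ)^K ≤ 8 * (3 * L) * (2 * n) := by gcongr
      _ ≤ _ := by nlinarith [mul_nonneg hL hnn]
  have b3 : 2 * Real.sqrt (2^K) ≤ 3 * Real.sqrt n := by
    calc 2 * Real.sqrt (2^K) ≤ 2 * Real.sqrt ((3/2)^2 * n) := by gcongr; linarith
      _ = _ := by rw [Real.sqrt_mul (by positivity), Real.sqrt_sq (by norm_num)]; ring
  have b4 : 3 * Real.sqrt n ≤ (c-c1)/4 * (Real.sqrt n * Real.sqrt L) := by
    have := mul_le_mul_of_nonneg_left h3 (Real.sqrt_nonneg n)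
    linarith
  have b5 : 9 * (9/10)^g * Real.sqrt (8 * q2 * 2^K) ≤ (c-c1)/4 * (Real.sqrt n * Real.sqrt L) := by
    calc _ ≤ 9 * ((c - c1)/4/63) * (7 * (Real.sqrt n * Real.sqrt L)) := by gcongr
      _ = _ := by ring
  have b6 : c2 * (Real.sqrt n * Real.sqrt L) ≤ c * Real.sqrt (n * Real.log (Real.log n)) := by
    have hcp : 0 ≤ c := by linarith
    rw [← Real.sqrt_mul hnn, ← Real.sqrt_sq hc20.le, ← Real.sqrt_sq hcp, ← Real.sqrt_mul (by positivity), ← Real.sqrt_mul (by positivity)]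
    apply Real.sqrt_le_sqrt
    have : c^2 * (L - Real.log 4) ≤ c^2 * Real.log (Real.log n) := by gcongr
    nlinarith
  have : c2 * (Real.sqrt n * Real.sqrt L) = c1 * (Real.sqrt n * Real.sqrt L) + (c-c1)/4 * (Real.sqrt n * Real.sqrt L) + (c-c1)/4 * (Real.sqrt n * Real.sqrt L) := by
    rw [hc2]; ring
  linarith
end

open MeasureTheory Filter ProbabilityTheory

theorem expI_taylor_pos (n : ℕ) : ∀ x : ℝ, 0 ≤ x → 
    ‖Complex.exp (x * Complex.I) - ∑ p ∈ Finset.range n, (x * Complex.I)^p / (p.factorial : ℂ)‖ ≤ x^n / n.factorial := by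
  induction n with
  | zero => intro x _; simp [Complex.norm_exp_ofReal_mul_I]
  | succ n ih =>
    intro x hx
    have hd : ∀ y : ℝ, HasDerivAt (fun x : ℝ => Complex.exp (x * Complex.I) - ∑ p ∈ Finset.range (n+1), (x * Complex.I)^p / (p.factorial : ℂ))
        (Complex.I * (Complex.exp (y * Complex.I) - ∑ p ∈ Finset.range n, (y * Complex.I)^p / (p.factorial : ℂ))) y := by
      intro y
      have h0 : HasDerivAt (fun x : ℝ => (x:ℂ) * Complex.I) Complex.I y := by
        simpa using (Complex.ofRealCLM.hasDerivAt (x := y)).mul_const Complex.I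
      have h1 : HasDerivAt (fun x : ℝ => Complex.exp (x * Complex.I)) (Complex.exp (y * Complex.I) * Complex.I) y := h0.cexp
      have h2 : HasDerivAt (fun x : ℝ => ∑ p ∈ Finset.range (n+1), ((x:ℂ) * Complex.I)^p / (p.factorial : ℂ))
          (∑ p ∈ Finset.range (n+1), (p * ((y:ℂ) * Complex.I)^(p-1) * Complex.I) / (p.factorial : ℂ)) y := by
        refine HasDerivAt.fun_sum fun p _ => ?_
        exact (h0.pow p).div_const _
      refine (h1.sub h2).congr_deriv ?_
      rw [Finset.sum_range_succ', mul_sub, Finset.mul_sum]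
      simp only [Nat.cast_zero, zero_mul, zero_div, add_zero]
      congr 1
      · ring
      · refine Finset.sum_congr rfl fun p _ => ?_
        rw [Nat.factorial_succ, Nat.add_sub_cancel]
        have : (p.factorial : ℂ) ≠ 0 := by exact_mod_cast p.factorial_ne_zero
        have h3 : ((p:ℂ)+1) ≠ 0 := by exact_mod_cast p.succ_ne_zero
        push_cast
        field_simp
    have := image_norm_le_of_norm_deriv_right_le_deriv_boundary (a := 0) (b := x) 
      (f := fun x : ℝ => Complex.exp (x * Complex.I) - ∑ p ∈ Finset.range (n+1), (x * Complex.I)^p / (p.factorial : ℂ))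
      (B := fun x => x^(n+1) / (n+1).factorial) (B' := fun x => x^n/n.factorial)
      (fun y _ => (hd y).continuousAt.continuousWithinAt) (fun y _ => (hd y).hasDerivWithinAt) (by
        simp [Finset.sum_range_succ'])
      (fun y => by
        refine ((hasDerivAt_pow (n+1) y).div_const _).congr_deriv ?_
        rw [Nat.factorial_succ, Nat.add_sub_cancel]; push_cast
        have : (n.factorial : ℝ) ≠ 0 := by exact_mod_cast n.factorial_ne_zero
        field_simp)
      (fun y hy => by
        rw [norm_mul, Complex.norm_I, one_mul]; exact ih y hy.1)
    exact this ⟨hx, le_rfl⟩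

theorem expI_taylor (n : ℕ) (x : ℝ) :
    ‖Complex.exp (x * Complex.I) - ∑ p ∈ Finset.range n, (x * Complex.I)^p / (p.factorial : ℂ)‖ ≤ |x|^n / n.factorial := by
  rcases le_total 0 x with h | h
  · rw [abs_of_nonneg h]; exact expI_taylor_pos n x h
  · rw [abs_of_nonpos h]
    have := expI_taylor_pos n (-x) (by linarith)
    rw [← Complex.norm_conj] at this
    convert this using 2
    simp only [map_sub, map_sum, map_div₀, map_pow, map_mul, Complex.conj_ofReal, Complex.conj_I, ← Complex.exp_conj, Complex.conj_natCast]
    have h1 : ((-x:ℝ):ℂ) * -Complex.I = x * Complex.I := by push_cast; ring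
    rw [h1]

theorem cf_trunc {Ω : Type*} [MeasurableSpace Ω] {P : Measure Ω} [IsProbabilityMeasure P] (W : Ω → ℝ) (mW : Measurable W) (C : ℝ) (hW : ∀ x, |W x| ≤ C) (n : ℕ) :
    ‖(∫ x, Complex.exp (W x * Complex.I) ∂P) - ∑ p ∈ Finset.range n, Complex.I^p / (p.factorial : ℂ) * ((∫ x, (W x)^p ∂P : ℝ) : ℂ)‖
      ≤ (∫ x, |W x|^n ∂P) / n.factorial := by
  have ip : ∀ p, Integrable (fun x => (W x)^p) P := fun p => by
    refine Integrable.of_bound (C := C^p) (mW.pow_const _).aestronglyMeasurable (ae_of_all _ fun x => ?_)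
    rw [norm_pow]; exact pow_le_pow_left₀ (norm_nonneg _) (hW x) _
  have ie : Integrable (fun x => Complex.exp (W x * Complex.I)) P := by
    refine Integrable.of_bound (C := 1) (by fun_prop) (ae_of_all _ fun x => ?_)
    rw [Complex.norm_exp_ofReal_mul_I]
  have is : ∀ p ∈ Finset.range n, Integrable (fun x => ((W x:ℂ) * Complex.I)^p / (p.factorial : ℂ)) P := by
    intro p _
    have : (fun x => ((W x:ℂ) * Complex.I)^p / (p.factorial : ℂ)) = fun x => Complex.I^p / (p.factorial : ℂ) * (((W x)^p : ℝ):ℂ) := by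
      ext x; push_cast; rw [mul_pow]; ring
    rw [this]
    exact (ip p).ofReal.const_mul _
  have e : ∑ p ∈ Finset.range n, Complex.I^p / (p.factorial : ℂ) * ((∫ x, (W x)^p ∂P : ℝ) : ℂ)
      = ∫ x, ∑ p ∈ Finset.range n, ((W x:ℂ) * Complex.I)^p / (p.factorial : ℂ) ∂P := by
    rw [integral_finsetSum _ is]
    refine Finset.sum_congr rfl fun p _ => ?_
    rw [← integral_complex_ofReal, ← integral_const_mul]
    congr 1; ext x; push_cast; rw [mul_pow]; ring
  rw [e, ← integral_sub ie (integrable_finsetSum _ is), ← integral_div]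
  refine norm_integral_le_of_norm_le ?_ (ae_of_all _ fun x => expI_taylor n (W x))
  refine Integrable.div_const ?_ _
  have := (ip n).abs
  simpa [abs_pow] using this

section
variable {Ω Ω' : Type*} [MeasurableSpace Ω] [MeasurableSpace Ω'] {P : Measure Ω} {P' : Measure Ω'}
    {X : ℕ → Ω → ℝ} {Y : ℕ → Ω' → ℝ} {σ : ℝ}

theorem cf_transfer [IsProbabilityMeasure P] [IsProbabilityMeasure P'] (h : Cmp P P' X Y σ) :
    ∃ N0 : ℕ, 2 ≤ N0 ∧ ∀ N, N0 ≤ N → ∀ (q : ℕ) (S : Finset ℕ) (a : ℕ → ℝ) (V : ℝ), 1 ≤ q → ((2*q:ℕ):ℝ) ≤ Real.log N / 8 → 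
      (∀ i ∈ S, |a i| ≤ 1) → (∀ i ∈ S, N ≤ i^2) → S.card ≤ N → 0 < V → ∑ i ∈ S, 4 * (a i)^2 ≤ V → V * Real.exp 2 ≤ 2 * q → 
      ‖(∫ x, Complex.exp ((∑ i ∈ S, a i * X i x : ℝ) * Complex.I) ∂P) - ∫ x, Complex.exp ((∑ i ∈ S, a i * Y i x : ℝ) * Complex.I) ∂P'‖
        ≤ 4 / N + 4 * Real.exp (-q) := by
  obtain ⟨N0, hN2, hN0⟩ := h.M1
  refine ⟨N0, hN2, fun N hN q S a V hq hqN ha hS hSN hV hVa hVq => ?_⟩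
  have hq1 : (1:ℝ) ≤ q := by exact_mod_cast hq
  have hNpos : (0:ℝ) < N := by exact_mod_cast (by omega : 0 < N)
  have t1 := cf_trunc (P := P) _ (wsum_meas h.mX S a) _ (wsum_bd h.bX S a) (2*q)
  have t2 := cf_trunc (P := P') _ (wsum_meas h.mY S a) _ (wsum_bd h.bY S a) (2*q)
  simp_rw [(even_two_mul q).pow_abs] at t1 t2
  have m1 := mom_crude h S a q hq V hV hVa
  have m2 := hN0 N hN (2*q) hqN S a ha hS hSN
  have m3 : ‖(∑ p ∈ Finset.range (2*q), Complex.I^p / (p.factorial : ℂ) * ((∫ x, (∑ i ∈ S, a i * X i x)^p ∂P : ℝ) : ℂ)) - 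
      ∑ p ∈ Finset.range (2*q), Complex.I^p / (p.factorial : ℂ) * ((∫ x, (∑ i ∈ S, a i * Y i x)^p ∂P' : ℝ) : ℂ)‖ ≤ 3 / N := by
    rw [← Finset.sum_sub_distrib]
    refine (norm_sum_le _ _).trans ?_
    calc _ ≤ ∑ p ∈ Finset.range (2*q), (1:ℝ)^p / p.factorial * (1 / N) := by
          refine Finset.sum_le_sum fun p hp => ?_
          rw [← mul_sub, norm_mul, norm_div, norm_pow, Complex.norm_I, Complex.norm_natCast, ← Complex.ofReal_sub, Complex.norm_real]
          gcongr
          refine hN0 N hN p (le_trans ?_ hqN) S a ha hS hSN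
          exact_mod_cast (Finset.mem_range.1 hp).le
      _ = (∑ p ∈ Finset.range (2*q), (1:ℝ)^p / p.factorial) * (1 / N) := by rw [Finset.sum_mul]
      _ ≤ 3 * (1/N) := by
          gcongr
          have := Real.sum_le_exp_of_nonneg (x := 1) (by norm_num) (2*q)
          have h3 := Real.exp_one_lt_d9
          linarith
      _ = _ := by ring
  have hf1 : (1:ℝ) ≤ (2*q).factorial := by exact_mod_cast Nat.succ_le_of_lt (Nat.factorial_pos _)
  have hfac : (2 * q * V / Real.exp 1)^q / (2*q).factorial ≤ Real.exp (-q) := by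
    have h5 := Real.pow_div_factorial_le_exp (x := ((2*q:ℕ):ℝ)) (by positivity) (2*q)
    rw [div_le_iff₀ (by positivity)] at h5 ⊢
    have h6 : (((2*q:ℕ):ℝ))^(2*q) = ((2*q)^q)*(2*q)^q := by push_cast; rw [← pow_add]; congr 1; ring
    have h7 : Real.exp ((2*q:ℕ):ℝ) = Real.exp q * Real.exp q := by rw [← Real.exp_add]; congr 1; push_cast; ring
    rw [h6, h7] at h5
    have h8 : (2 * q * V / Real.exp 1)^q * Real.exp q = (2*q)^q * V^q := by
      rw [div_pow, mul_pow, ← Real.exp_nat_mul, mul_one]; field_simp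
    have h9 : V^q * (Real.exp q * Real.exp q) ≤ (2*q)^q := by
      have := pow_le_pow_left₀ (by positivity) hVq q
      rwa [mul_pow, ← Real.exp_nat_mul, show (q:ℝ)*2 = q + q by ring, Real.exp_add] at this
    rw [Real.exp_neg, ← mul_le_mul_iff_left₀ (Real.exp_pos q), h8]
    rw [mul_assoc, mul_comm ((2*q).factorial:ℝ), inv_mul_cancel_left₀ (Real.exp_pos q).ne']
    have h10 : (0:ℝ) < (2*q)^q := by positivity
    have h11 := Real.exp_pos q
    have h12 : ((2*q)^q * V^q) * (Real.exp q * Real.exp q) ≤ (2*q).factorial * (Real.exp q * Real.exp q) := by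
      nlinarith
    exact le_of_mul_le_mul_right h12 (by positivity)
  have hE : (∫ x, (∑ i ∈ S, a i * X i x)^(2*q) ∂P) / (2*q).factorial ≤ 1/N + 2 * Real.exp (-q) := by
    have : (∫ x, (∑ i ∈ S, a i * X i x)^(2*q) ∂P) ≤ 1/N + 2 * (2 * q * V / Real.exp 1)^q := by linarith [(abs_le.1 m2).2]
    calc _ ≤ (1/N + 2 * (2 * q * V / Real.exp 1)^q) / (2*q).factorial := by gcongr
      _ = (1/N)/(2*q).factorial + 2 * ((2 * q * V / Real.exp 1)^q / (2*q).factorial) := by ring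
      _ ≤ _ := by
        have := div_le_self (a := 1/(N:ℝ)) (by positivity) hf1
        linarith
  have hE' : (∫ x, (∑ i ∈ S, a i * Y i x)^(2*q) ∂P') / (2*q).factorial ≤ 2 * Real.exp (-q) := by
    calc _ ≤ (2 * (2 * q * V / Real.exp 1)^q) / (2*q).factorial := by gcongr
      _ = 2 * ((2 * q * V / Real.exp 1)^q / (2*q).factorial) := by ring
      _ ≤ _ := by gcongr
  have tri : ∀ z1 z2 w1 w2 : ℂ, ‖z1 - z2‖ ≤ ‖z1 - w1‖ + ‖w1 - w2‖ + ‖z2 - w2‖ := by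
    intro z1 z2 w1 w2
    rw [norm_sub_rev z2]
    calc ‖z1 - z2‖ = ‖(z1 - w1) + (w1 - w2) + (w2 - z2)‖ := by congr 1; ring
      _ ≤ _ := norm_add₃_le
  refine (tri _ _ _ _).trans (le_trans (add_le_add (add_le_add (t1.trans hE) m3) (t2.trans hE')) (le_of_eq ?_))
  ring

theorem cf_gauss1 [IsProbabilityMeasure P'] (h : Cmp P P' X Y σ) (n : ℕ) (a : ℝ) (ha : |a| ≤ 1) :
    ‖(∫ x, Complex.exp ((a * Y n x : ℝ) * Complex.I) ∂P') - Complex.exp (-(σ^2 * a^2 / 2 : ℝ))‖ ≤ 6 * |a|^3 := by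
  have hbd : ∀ x, |a * Y n x| ≤ |a| * 2 := fun x => by rw [abs_mul]; gcongr; exact h.bY n x
  have t := cf_trunc (P := P') (fun x => a * Y n x) ((h.mY n).const_mul a) _ hbd 3
  have hσ4 : σ^2 ≤ 4 := by
    rw [← h.var n]
    have : ∫ ω, (Y n ω)^2 ∂P' ≤ ∫ ω, (4:ℝ) ∂P' := by
      refine integral_mono_of_nonneg (ae_of_all _ fun _ => sq_nonneg _) (integrable_const _) (ae_of_all _ fun ω => ?_)
      have := abs_le.1 (h.bY n ω)
      simp only
      nlinarith
    simpa using this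
  have h3 : (∫ x, |a * Y n x|^3 ∂P') ≤ 8 * |a|^3 := by
    have : ∫ x, |a * Y n x|^3 ∂P' ≤ ∫ ω, (8 * |a|^3) ∂P' := by
      refine integral_mono_of_nonneg (ae_of_all _ fun _ => by positivity) (integrable_const _) (ae_of_all _ fun ω => ?_)
      have := pow_le_pow_left₀ (abs_nonneg _) (hbd ω) 3
      simp only
      linarith [mul_pow |a| 2 3]
    simpa using this
  have e1 : ∫ x, a * Y n x ∂P' = 0 := by rw [integral_const_mul, h.mean, mul_zero]
  have e2 : ∫ x, (a * Y n x)^2 ∂P' = a^2 * σ^2 := by simp_rw [mul_pow]; rw [integral_const_mul, h.var]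
  simp only [Finset.sum_range_succ, Finset.sum_range_zero, pow_zero, pow_one, e1, e2, Nat.factorial] at t
  have e3 : (0 + 1 / ((1:ℕ):ℂ) * ((∫ x, (1:ℝ) ∂P' : ℝ):ℂ) + Complex.I / (((0+1) * 1 : ℕ):ℂ) * ((0:ℝ):ℂ) + Complex.I^2 / (((1+1)*((0+1)*1) : ℕ):ℂ) * ((a^2 * σ^2 : ℝ):ℂ))
      = ((1 - σ^2 * a^2/2 : ℝ) : ℂ) := by
    rw [Complex.I_sq]; simp; ring
  rw [e3] at t
  set s := σ^2 * a^2 / 2 with hs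
  have hs0 : 0 ≤ s := by positivity
  have ha2 : a^2 = |a|^2 := (sq_abs a).symm
  have hs2 : s ≤ 2 * |a|^2 := by rw [hs, ha2]; nlinarith [sq_nonneg |a|]
  have hexp : |Real.exp (-s) - (1 - s)| ≤ s^2 := by
    rw [abs_le]
    have h1 := Real.add_one_le_exp (-s)
    constructor
    · nlinarith
    · rcases le_total s 1 with h | h
      · have := Real.norm_exp_sub_one_sub_id_le (x := -s) (by rw [norm_neg, Real.norm_eq_abs, abs_of_nonneg hs0]; exact h)
        rw [Real.norm_eq_abs, Real.norm_eq_abs, sq_abs] at this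
        have := (abs_le.1 this).2
        nlinarith
      · have : Real.exp (-s) ≤ 1 := Real.exp_le_one_iff.2 (by linarith)
        nlinarith
  have h4 : s^2 ≤ 4 * |a|^3 := by
    have h5 : s^2 ≤ (2*|a|^2)^2 := by gcongr
    have h6 : |a|^4 ≤ |a|^3 := pow_le_pow_of_le_one (abs_nonneg _) ha (by norm_num)
    nlinarith
  have h7 : ‖((1 - s : ℝ):ℂ) - Complex.exp (-(s:ℝ))‖ ≤ s^2 := by
    rw [← Complex.ofReal_neg, ← Complex.ofReal_exp, ← Complex.ofReal_sub, Complex.norm_real, Real.norm_eq_abs, abs_sub_comm]; exact hexp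
  have h8 : (∫ x, |a * Y n x|^3 ∂P') / ((2+1)*((1+1)*((0+1)*1)) : ℕ) ≤ 8 * |a|^3 / 6 := by
    have : (((2+1)*((1+1)*((0+1)*1)) : ℕ):ℝ) = 6 := by norm_num
    rw [this]; gcongr
  calc _ ≤ _ := norm_sub_le_norm_sub_add_norm_sub _ (((1 - s : ℝ):ℂ)) _
    _ ≤ 8 * |a|^3 / 6 + s^2 := add_le_add (t.trans h8) h7
    _ ≤ _ := by nlinarith [pow_nonneg (abs_nonneg a) 3]

theorem cf_gauss [IsProbabilityMeasure P'] (h : Cmp P P' X Y σ) (S : Finset ℕ) (a : ℕ → ℝ) (ha : ∀ i ∈ S, |a i| ≤ 1) :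
    ‖(∫ x, Complex.exp ((∑ i ∈ S, a i * Y i x : ℝ) * Complex.I) ∂P') - Complex.exp (-(σ^2 * (∑ i ∈ S, (a i)^2) / 2 : ℝ))‖ ≤ 6 * ∑ i ∈ S, |a i|^3 := by
  have e1 : ∀ x, Complex.exp ((∑ i ∈ S, a i * Y i x : ℝ) * Complex.I) = ∏ i ∈ S, Complex.exp ((a i * Y i x : ℝ) * Complex.I) := by
    intro x
    rw [← Complex.exp_sum, ← Finset.sum_mul]; push_cast; rfl
  simp_rw [e1]
  rw [indep_prod (𝕜 := ℂ) h.ind h.mY (fun i y => Complex.exp ((a i * y : ℝ) * Complex.I)) (fun i => by fun_prop) S]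
  have e2 : Complex.exp (-(σ^2 * (∑ i ∈ S, (a i)^2) / 2 : ℝ)) = ∏ i ∈ S, Complex.exp (-(σ^2 * (a i)^2 / 2 : ℝ)) := by
    rw [← Complex.exp_sum, Finset.mul_sum, Finset.sum_div]; push_cast; rw [Finset.sum_neg_distrib]
  rw [e2]
  refine (prod_diff_le S _ _ 1 le_rfl ?_ ?_).trans ?_
  · intro i _
    refine (norm_integral_le_of_norm_le_const (C := 1) (ae_of_all _ fun x => ?_)).trans (by simp)
    rw [Complex.norm_exp_ofReal_mul_I]
  · intro i _
    rw [← Complex.ofReal_neg, ← Complex.ofReal_exp, Complex.norm_real, Real.norm_eq_abs, Real.abs_exp]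
    exact Real.exp_le_one_iff.2 (by have : 0 ≤ σ^2 * (a i)^2/2 := by positivity
                                    linarith)
  · rw [one_pow, one_mul, Finset.mul_sum]
    exact Finset.sum_le_sum fun i hi => cf_gauss1 h i (a i) (ha i hi)
end

open MeasureTheory Filter ProbabilityTheory

noncomputable def sphi (θ : ℝ) (r : ℕ) (z : ℝ) : ℝ := (Real.sin (θ * z)^2)^r
noncomputable def tw : Fin 3 → ℂ := ![1/2, -1/4, -1/4]
noncomputable def td : Fin 3 → ℝ := ![0, 1, -1]
noncomputable def tcc {r : ℕ} (κ : Fin r → Fin 3) : ℂ := ∏ i, tw (κ i)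
noncomputable def tuu (θ : ℝ) {r : ℕ} (κ : Fin r → Fin 3) : ℝ := ∑ i, 2 * θ * td (κ i)

theorem sphi_meas (θ : ℝ) (r : ℕ) : Measurable (sphi θ r) := by unfold sphi; fun_prop
theorem sphi_nonneg (θ : ℝ) (r : ℕ) (z : ℝ) : 0 ≤ sphi θ r z := by unfold sphi; positivity
theorem sphi_le_one (θ : ℝ) (r : ℕ) (z : ℝ) : sphi θ r z ≤ 1 := pow_le_one₀ (sq_nonneg _) (Real.sin_sq_le_one _)

theorem tuu_bd (θ : ℝ) (hθ : 0 ≤ θ) {r : ℕ} (κ : Fin r → Fin 3) : |tuu θ κ| ≤ 2 * θ * r := by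
  unfold tuu
  refine (Finset.abs_sum_le_sum_abs _ _).trans ?_
  refine (Finset.sum_le_card_nsmul _ _ (2*θ) fun i _ => ?_).trans ?_
  · rw [abs_mul, abs_of_nonneg (by positivity : 0 ≤ 2*θ)]
    have : |td (κ i)| ≤ 1 := by
      generalize κ i = k
      fin_cases k <;> simp [td]
    nlinarith
  · simp; linarith

theorem tcc_sum (r : ℕ) : ∑ κ : Fin r → Fin 3, ‖tcc κ‖ = 1 := by
  have h1 : ∑ k : Fin 3, ‖tw k‖ = 1 := by
    simp [Fin.sum_univ_three, tw]; norm_num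
  have : (1:ℝ) = ∏ _i : Fin r, ∑ k : Fin 3, ‖tw k‖ := by rw [h1]; simp
  rw [this, Finset.prod_univ_sum]
  simp [tcc, norm_prod]

theorem sphi_exp (θ : ℝ) (r : ℕ) (z : ℝ) : ((sphi θ r z : ℝ) : ℂ) = ∑ κ : Fin r → Fin 3, tcc κ * Complex.exp ((tuu θ κ * z : ℝ) * Complex.I) := by
  have h1 : ((Real.sin (θ * z)^2 : ℝ):ℂ) = ∑ k : Fin 3, tw k * Complex.exp ((2 * θ * td k * z : ℝ) * Complex.I) := by
    simp only [Fin.sum_univ_three, tw, td, Matrix.cons_val_zero, Matrix.cons_val_one, Matrix.cons_val]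
    push_cast
    rw [Complex.sin]
    have e1 : Complex.exp (2 * θ * 1 * z * Complex.I) = Complex.exp (θ * z * Complex.I) * Complex.exp (θ * z * Complex.I) := by
      rw [← Complex.exp_add]; congr 1; ring
    have e2 : Complex.exp (2 * θ * -1 * z * Complex.I) = Complex.exp (-(θ * z) * Complex.I) * Complex.exp (-(θ * z) * Complex.I) := by
      rw [← Complex.exp_add]; congr 1; ring
    have e3 : Complex.exp (θ * z * Complex.I) * Complex.exp (-(θ * z) * Complex.I) = 1 := by
      rw [← Complex.exp_add]; simp
    rw [e1, e2]
    simp only [mul_zero, zero_mul, Complex.exp_zero]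
    have hI := Complex.I_sq
    linear_combination (1/2) * e3 + ((Complex.exp (-(θ * z) * Complex.I) - Complex.exp (θ * z * Complex.I))^2/4) * hI
  unfold sphi
  rw [Complex.ofReal_pow, h1]
  have : (∑ k : Fin 3, tw k * Complex.exp ((2 * θ * td k * z : ℝ) * Complex.I))^r = ∏ _i : Fin r, ∑ k : Fin 3, tw k * Complex.exp ((2 * θ * td k * z : ℝ) * Complex.I) := by simp
  rw [this, Finset.prod_univ_sum]
  simp only [Fintype.piFinset_univ]
  refine Finset.sum_congr rfl fun κ _ => ?_
  rw [Finset.prod_mul_distrib, ← Complex.exp_sum, tcc, tuu]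
  push_cast; congr 2; rw [Finset.sum_mul, Finset.sum_mul]

theorem eI_int {Ω : Type*} [MeasurableSpace Ω] {P : Measure Ω} [IsProbabilityMeasure P] (W : Ω → ℝ) (mW : Measurable W) :
    Integrable (fun x => Complex.exp (W x * Complex.I)) P := by
  refine Integrable.of_bound (C := 1) (by fun_prop) (ae_of_all _ fun x => ?_)
  rw [Complex.norm_exp_ofReal_mul_I]

theorem sphi_E1 {Ω : Type*} [MeasurableSpace Ω] {P : Measure Ω} [IsProbabilityMeasure P] (Z : Ω → ℝ) (mZ : Measurable Z) (θ : ℝ) (r : ℕ) :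
    ((∫ x, sphi θ r (Z x) ∂P : ℝ):ℂ) = ∑ κ : Fin r → Fin 3, tcc κ * ∫ x, Complex.exp ((tuu θ κ * Z x : ℝ) * Complex.I) ∂P := by
  rw [← integral_complex_ofReal]
  simp_rw [sphi_exp]
  rw [integral_finsetSum]
  · simp_rw [integral_const_mul]
  · intro κ _
    exact (eI_int _ (mZ.const_mul _)).const_mul _

theorem sphi_E2 {Ω : Type*} [MeasurableSpace Ω] {P : Measure Ω} [IsProbabilityMeasure P] (Z1 Z2 : Ω → ℝ) (mZ1 : Measurable Z1) (mZ2 : Measurable Z2) (θ : ℝ) (r : ℕ) :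
    ((∫ x, sphi θ r (Z1 x) * sphi θ r (Z2 x) ∂P : ℝ):ℂ) = ∑ κ : Fin r → Fin 3, ∑ κ' : Fin r → Fin 3, (tcc κ * tcc κ') * 
      ∫ x, Complex.exp ((tuu θ κ * Z1 x + tuu θ κ' * Z2 x : ℝ) * Complex.I) ∂P := by
  rw [← integral_complex_ofReal]
  have : ∀ x, ((sphi θ r (Z1 x) * sphi θ r (Z2 x) : ℝ):ℂ) = ∑ κ : Fin r → Fin 3, ∑ κ' : Fin r → Fin 3, (tcc κ * tcc κ') * 
      Complex.exp ((tuu θ κ * Z1 x + tuu θ κ' * Z2 x : ℝ) * Complex.I) := by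
    intro x
    rw [Complex.ofReal_mul, sphi_exp, sphi_exp, Finset.sum_mul_sum]
    refine Finset.sum_congr rfl fun κ _ => Finset.sum_congr rfl fun κ' _ => ?_
    rw [Complex.ofReal_add, add_mul, Complex.exp_add]; ring
  simp_rw [this]
  have hi : ∀ κ κ' : Fin r → Fin 3, Integrable (fun x => (tcc κ * tcc κ') * 
      Complex.exp ((tuu θ κ * Z1 x + tuu θ κ' * Z2 x : ℝ) * Complex.I)) P := fun κ κ' =>
    (eI_int (fun x => tuu θ κ * Z1 x + tuu θ κ' * Z2 x) ((mZ1.const_mul _).add (mZ2.const_mul _))).const_mul _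
  rw [integral_finsetSum _ fun κ _ => integrable_finsetSum _ fun κ' _ => hi κ κ']
  refine Finset.sum_congr rfl fun κ _ => ?_
  rw [integral_finsetSum _ fun κ' _ => hi κ κ']
  simp_rw [integral_const_mul]

theorem sphi_cmp {Ω : Type*} [MeasurableSpace Ω] {P : Measure Ω} [IsProbabilityMeasure P] (γ : Measure ℝ) [IsProbabilityMeasure γ]
    (Z1 Z2 : Ω → ℝ) (mZ1 : Measurable Z1) (mZ2 : Measurable Z2) (θ : ℝ) (hθ : 0 ≤ θ) (r : ℕ) (ε : ℝ) 
    (hχ : ∀ u w : ℝ, |u| ≤ 2*θ*r → |w| ≤ 2*θ*r → ‖(∫ x, Complex.exp ((u * Z1 x + w * Z2 x : ℝ) * Complex.I) ∂P)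
      - (∫ z, Complex.exp ((u * z : ℝ) * Complex.I) ∂γ) * ∫ z, Complex.exp ((w * z : ℝ) * Complex.I) ∂γ‖ ≤ ε) :
    |(∫ x, sphi θ r (Z1 x) * sphi θ r (Z2 x) ∂P) - (∫ z, sphi θ r z ∂γ)^2| ≤ ε ∧ 
    |(∫ x, sphi θ r (Z1 x) ∂P) - (∫ z, sphi θ r z ∂γ)| ≤ ε := by
  have hg := sphi_E1 (P := γ) (fun z => z) measurable_id θ r
  constructor
  · rw [← Real.norm_eq_abs, ← Complex.norm_real, Complex.ofReal_sub, Complex.ofReal_pow, sphi_E2 Z1 Z2 mZ1 mZ2, hg, sq, Finset.sum_mul_sum, ← Finset.sum_sub_distrib]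
    simp_rw [← Finset.sum_sub_distrib]
    calc _ ≤ ∑ κ : Fin r → Fin 3, ∑ κ' : Fin r → Fin 3, ‖tcc κ‖ * ‖tcc κ'‖ * ε := by
          refine (norm_sum_le _ _).trans (Finset.sum_le_sum fun κ _ => (norm_sum_le _ _).trans (Finset.sum_le_sum fun κ' _ => ?_))
          rw [mul_mul_mul_comm, ← mul_sub, norm_mul, norm_mul]
          gcongr
          exact hχ _ _ (tuu_bd θ hθ κ) (tuu_bd θ hθ κ')
      _ = _ := by
          simp_rw [← Finset.sum_mul, ← Finset.mul_sum, tcc_sum]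
          simp [tcc_sum]
  · rw [← Real.norm_eq_abs, ← Complex.norm_real, Complex.ofReal_sub, sphi_E1 Z1 mZ1, hg, ← Finset.sum_sub_distrib]
    calc _ ≤ ∑ κ : Fin r → Fin 3, ‖tcc κ‖ * ε := by
          refine (norm_sum_le _ _).trans (Finset.sum_le_sum fun κ _ => ?_)
          rw [← mul_sub, norm_mul]
          gcongr
          have := hχ _ 0 (tuu_bd θ hθ κ) (by simp; positivity)
          simpa using this
      _ = _ := by
          rw [← Finset.sum_mul, tcc_sum, one_mul]

open MeasureTheory Filter ProbabilityTheory

theorem second_moment {Ω : Type*} [MeasurableSpace Ω] {P : Measure Ω} [IsProbabilityMeasure P] (F : ℕ → Ω → ℝ)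
    (mF : ∀ k, Measurable (F k)) (F0 : ∀ k x, 0 ≤ F k x) (F1 : ∀ k x, F k x ≤ 1) (W : Finset ℕ) (g ε : ℝ)
    (g0 : 0 ≤ g) (g1 : g ≤ 1) (hε0 : 0 ≤ ε)
    (h1 : ∀ k ∈ W, |(∫ x, F k x ∂P) - g| ≤ ε)
    (h2 : ∀ j ∈ W, ∀ k ∈ W, j ≠ k → |(∫ x, F j x * F k x ∂P) - g^2| ≤ ε)
    (hε : ε * (W.card:ℝ)^2 ≤ 1) (hg : 2 ≤ W.card * g) :
    P.real {x | ∑ k ∈ W, F k x ≤ 1} ≤ (W.card * g + 4) / (W.card * g / 2)^2 := by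
  set K : ℝ := (W.card : ℝ) with hK
  have hK1 : 1 ≤ K := by
    have : (0:ℝ) < K := by
      rcases (Nat.cast_nonneg W.card : (0:ℝ) ≤ W.card).eq_or_lt with h | h
      · rw [hK, ← h] at hg; norm_num at hg
      · exact h
    rw [hK] at this ⊢
    have hh : 0 < W.card := by exact_mod_cast this
    exact_mod_cast hh
  have iF : ∀ k, Integrable (F k) P := fun k => Integrable.of_bound (C := 1) (mF k).aestronglyMeasurable
    (ae_of_all _ fun x => by rw [Real.norm_eq_abs, abs_of_nonneg (F0 k x)]; exact F1 k x)
  have iFF : ∀ j k, Integrable (fun x => F j x * F k x) P := fun j k => 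
    Integrable.of_bound (C := 1) ((mF j).mul (mF k)).aestronglyMeasurable
    (ae_of_all _ fun x => by 
      rw [Real.norm_eq_abs, abs_of_nonneg (mul_nonneg (F0 j x) (F0 k x))]; exact mul_le_one₀ (F1 j x) (F0 k x) (F1 k x))
  have hexp : ∀ x, (∑ k ∈ W, F k x - K * g)^2 = (∑ j ∈ W, ∑ k ∈ W, F j x * F k x) + ((-(2*K*g)) * ∑ k ∈ W, F k x + (K*g)^2) := by
    intro x; rw [← Finset.sum_mul_sum]; ring
  have i1 : Integrable (fun x => ∑ j ∈ W, ∑ k ∈ W, F j x * F k x) P :=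
    integrable_finsetSum _ fun j _ => integrable_finsetSum _ fun k _ => iFF j k
  have i2 : Integrable (fun x => ∑ k ∈ W, F k x) P := integrable_finsetSum _ fun k _ => iF k
  have i3 : Integrable (fun x => (-(2*K*g)) * ∑ k ∈ W, F k x + (K*g)^2) P := (i2.const_mul _).add (integrable_const _)
  have iT : Integrable (fun x => (∑ k ∈ W, F k x - K * g)^2) P := by
    simp_rw [hexp]; exact i1.add i3
  have hE : ∫ x, (∑ k ∈ W, F k x - K * g)^2 ∂P ≤ K * g + 4 := by
    simp_rw [hexp]
    rw [integral_add i1 i3, integral_add (i2.const_mul _) (integrable_const _), integral_const_mul, 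
      integral_finsetSum _ fun k _ => iF k, integral_finsetSum _ fun j _ => integrable_finsetSum _ fun k _ => iFF j k]
    have e1 : ∀ j ∈ W, ∫ x, ∑ k ∈ W, F j x * F k x ∂P ≤ K * (g^2+ε) + (g + ε) := by
      intro j hj
      rw [integral_finsetSum _ fun k _ => iFF j k]
      have : ∀ k ∈ W, ∫ x, F j x * F k x ∂P ≤ (g^2+ε) + if k = j then g + ε else 0 := by
        intro k hk
        by_cases hjk : k = j
        · subst hjk
          have a1 : ∫ x, F k x * F k x ∂P ≤ ∫ x, F k x ∂P := 
            integral_mono (iFF k k) (iF k) fun x => mul_le_of_le_one_left (F0 k x) (F1 k x)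
          have a2 := (abs_le.1 (h1 k hk)).2
          simp; nlinarith [sq_nonneg g]
        · simp only [hjk, if_false]
          have := (abs_le.1 (h2 j hj k hk (Ne.symm hjk))).2
          linarith
      refine (Finset.sum_le_sum this).trans ?_
      rw [Finset.sum_add_distrib, Finset.sum_ite_eq' W j]
      simp [hj, hK]
      exact le_of_eq (by ring)
    have e2 := Finset.sum_le_sum e1
    rw [Finset.sum_const, nsmul_eq_mul, ← hK] at e2
    have e3 : K * (g - ε) ≤ ∑ k ∈ W, ∫ x, F k x ∂P := by
      have := Finset.card_nsmul_le_sum W (fun k => ∫ x, F k x ∂P) (g-ε) fun k hk => by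
        have := (abs_le.1 (h1 k hk)).1; linarith
      simpa [hK] using this
    simp only [integral_const, probReal_univ, smul_eq_mul, one_mul]
    have e4 : 2*K*g * (K * (g - ε)) ≤ 2*K*g * ∑ k ∈ W, ∫ x, F k x ∂P := by gcongr
    have e5 : K^2 * ε * g ≤ 1 := by
      have : 0 ≤ K^2*ε := by positivity
      nlinarith
    have e6 : K * ε ≤ 1 := by
      have : K * ε ≤ K^2 * ε := by gcongr; nlinarith
      linarith
    nlinarith
  have hm := mul_meas_ge_le_integral_of_nonneg (ae_of_all P fun x => sq_nonneg (∑ k ∈ W, F k x - K * g)) iT ((K*g/2)^2)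
  rw [le_div_iff₀ (by positivity), mul_comm]
  refine le_trans ?_ (hm.trans hE)
  refine mul_le_mul_of_nonneg_left (measureReal_mono (fun x hx => ?_) (measure_ne_top _ _)) (sq_nonneg _)
  simp only [Set.mem_ofPred_eq] at hx ⊢
  nlinarith

theorem sum_two {M : Type*} [AddCommMonoid M] (S1 S2 : Finset ℕ) (hd : Disjoint S1 S2) (α β : ℝ) (G : ℝ → ℕ → M) :
    ∑ i ∈ S1 ∪ S2, G (if i ∈ S1 then α else β) i = ∑ i ∈ S1, G α i + ∑ i ∈ S2, G β i := by
  rw [Finset.sum_union hd]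
  congr 1
  · exact Finset.sum_congr rfl fun i hi => by simp [hi]
  · exact Finset.sum_congr rfl fun i hi => by simp [Finset.disjoint_right.1 hd hi]

noncomputable def gam (σ : ℝ) : Measure ℝ := gaussianReal 0 (Real.toNNReal (σ^2))

instance gam_prob (σ : ℝ) : IsProbabilityMeasure (gam σ) := by unfold gam; infer_instance

theorem gauss_cf (σ : ℝ) (u : ℝ) : ∫ z, Complex.exp ((u * z : ℝ) * Complex.I) ∂(gam σ) = 
    Complex.exp (-(σ^2 * u^2/2 : ℝ)) := by
  have := charFun_gaussianReal (μ := 0) (v := Real.toNNReal (σ^2)) u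
  rw [charFun_apply_real] at this
  push_cast
  rw [gam, this, Real.coe_toNNReal _ (sq_nonneg σ)]
  congr 1
  simp

noncomputable def Zb {Ω : Type*} (X : ℕ → Ω → ℝ) (b k : ℕ) (x : Ω) : ℝ := 
  (∑ i ∈ Finset.Ioc (b^k) (b^(k+1)), X i x) / √((b:ℝ)^(k+1) - (b:ℝ)^k)

theorem cf2_fin {Ω Ω' : Type*} [MeasurableSpace Ω] [MeasurableSpace Ω'] {P : Measure Ω} {P' : Measure Ω'} [IsProbabilityMeasure P] [IsProbabilityMeasure P']
    {X : ℕ → Ω → ℝ} {Y : ℕ → Ω' → ℝ} {σ : ℝ} (h : Cmp P P' X Y σ) (b : ℕ) (hb : 2 ≤ b) : ∃ K0 : ℕ, ∀ K ≥ K0, ∀ (q : ℕ) (U : ℝ),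
    1 ≤ q → ((2*q:ℕ):ℝ) ≤ Real.log ((b^(2*K):ℕ):ℝ)/8 → 0 < U → U ≤ √2^K → 8*U^2*Real.exp 2 ≤ 2*q →
    ∀ j ∈ Finset.Ico K (2*K), ∀ k ∈ Finset.Ico K (2*K), j ≠ k → ∀ u w : ℝ, |u| ≤ U → |w| ≤ U →
    ‖(∫ x, Complex.exp ((u * Zb X b j x + w * Zb X b k x : ℝ) * Complex.I) ∂P)
      - (∫ z, Complex.exp ((u * z : ℝ) * Complex.I) ∂(gam σ)) * ∫ z, Complex.exp ((w * z : ℝ) * Complex.I) ∂(gam σ)‖ 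
      ≤ 4/((b^(2*K):ℕ):ℝ) + 4*Real.exp (-q) + 12 * (U^3/√2^K) := by
  obtain ⟨N0, hN0, hT⟩ := cf_transfer h
  refine ⟨N0, ?_⟩
  intro K hK q U hq hq2 hU0 hU1 hUq j hj k hk hjk u w hu hw
  rw [Finset.mem_Ico] at hj hk
  have hbK : N0 ≤ b^(2*K) := by
    have : K < b^K := Nat.lt_pow_self (by omega)
    have : b^K ≤ b^(2*K) := Nat.pow_le_pow_right (by omega) (by omega)
    omega
  have hbR : (2:ℝ) ≤ b := by exact_mod_cast hb
  -- lengths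
  have hlen : ∀ m, K ≤ m → 0 < √((b:ℝ)^(m+1) - (b:ℝ)^m) ∧ √2^K ≤ √((b:ℝ)^(m+1) - (b:ℝ)^m) ∧ 
      (√((b:ℝ)^(m+1) - (b:ℝ)^m))^2 = (b:ℝ)^(m+1) - (b:ℝ)^m := by
    intro m hm
    have h1 : (2:ℝ)^K ≤ (b:ℝ)^(m+1) - (b:ℝ)^m := by
      have a1 : (2:ℝ)^K ≤ (b:ℝ)^m := (pow_le_pow_right₀ (by norm_num) hm).trans (by gcongr)
      have : (0:ℝ) < (b:ℝ)^m := by positivity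
      rw [pow_succ]; nlinarith
    have h2 : (0:ℝ) < 2^K := by positivity
    refine ⟨Real.sqrt_pos.2 (by linarith), ?_, Real.sq_sqrt (by linarith)⟩
    refine Real.le_sqrt_of_sq_le ?_
    rw [← pow_mul, mul_comm, pow_mul, Real.sq_sqrt (by norm_num)]; exact h1
  obtain ⟨j0, j1, j2⟩ := hlen j hj.1
  obtain ⟨k0, k1, k2⟩ := hlen k hk.1
  set lj := √((b:ℝ)^(j+1) - (b:ℝ)^j) with hlj
  set lk := √((b:ℝ)^(k+1) - (b:ℝ)^k) with hlk
  set S1 := Finset.Ioc (b^j) (b^(j+1)) with hS1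
  set S2 := Finset.Ioc (b^k) (b^(k+1)) with hS2
  have c1 : (S1.card : ℝ) = lj^2 := by
    rw [j2, hS1, Nat.card_Ioc, Nat.cast_sub (Nat.pow_le_pow_right (by omega) (by omega))]; push_cast; rfl
  have c2 : (S2.card : ℝ) = lk^2 := by
    rw [k2, hS2, Nat.card_Ioc, Nat.cast_sub (Nat.pow_le_pow_right (by omega) (by omega))]; push_cast; rfl
  have hd : Disjoint S1 S2 := by
    rw [Finset.disjoint_left]
    intro i hi1 hi2
    rw [hS1, Finset.mem_Ioc] at hi1
    rw [hS2, Finset.mem_Ioc] at hi2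
    rcases lt_or_gt_of_ne hjk with hlt | hlt
    · have : b^(j+1) ≤ b^k := Nat.pow_le_pow_right (by omega) (by omega)
      omega
    · have : b^(k+1) ≤ b^j := Nat.pow_le_pow_right (by omega) (by omega)
      omega
  have hsub : ∀ i ∈ S1 ∪ S2, b^K < i ∧ i ≤ b^(2*K) := by
    intro i hi
    rcases Finset.mem_union.1 hi with hi | hi
    · rw [hS1, Finset.mem_Ioc] at hi
      have := Nat.pow_le_pow_right (show 0 < b by omega) hj.1
      have := Nat.pow_le_pow_right (show 0 < b by omega) (show j+1 ≤ 2*K by omega)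
      omega
    · rw [hS2, Finset.mem_Ioc] at hi
      have := Nat.pow_le_pow_right (show 0 < b by omega) hk.1
      have := Nat.pow_le_pow_right (show 0 < b by omega) (show k+1 ≤ 2*K by omega)
      omega
  set a : ℕ → ℝ := fun i => if i ∈ S1 then u/lj else w/lk with ha
  have au : |u/lj| ≤ U/√2^K := by
    rw [abs_div, abs_of_pos j0]; gcongr
  have aw : |w/lk| ≤ U/√2^K := by
    rw [abs_div, abs_of_pos k0]; gcongr
  have aU : U/√2^K ≤ 1 := by rw [div_le_one (by positivity)]; exact hU1
  have habs : ∀ i ∈ S1 ∪ S2, |a i| ≤ 1 := by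
    intro i _
    rw [ha]; dsimp only
    split_ifs <;> linarith
  have hsq : ∑ i ∈ S1 ∪ S2, (a i)^2 = u^2 + w^2 := by
    rw [ha, sum_two S1 S2 hd (u/lj) (w/lk) (fun t _ => t^2)]
    simp only [Finset.sum_const, nsmul_eq_mul, c1, c2]
    field_simp
  have husq : u^2 ≤ U^2 := by rw [← sq_abs u]; gcongr
  have hwsq : w^2 ≤ U^2 := by rw [← sq_abs w]; gcongr
  have hcu : ∑ i ∈ S1 ∪ S2, |a i|^3 ≤ 2 * (U^3/√2^K) := by
    rw [ha, sum_two S1 S2 hd (u/lj) (w/lk) (fun t _ => |t|^3)]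
    simp only [Finset.sum_const, nsmul_eq_mul, c1, c2, abs_div, abs_of_pos j0, abs_of_pos k0]
    have e1 : lj^2 * (|u|/lj)^3 ≤ U^3/√2^K := by
      have : lj^2 * (|u|/lj)^3 = |u|^3/lj := by field_simp
      rw [this]; gcongr
    have e2 : lk^2 * (|w|/lk)^3 ≤ U^3/√2^K := by
      have : lk^2 * (|w|/lk)^3 = |w|^3/lk := by field_simp
      rw [this]; gcongr
    linarith
  have hsum : ∀ x, ∑ i ∈ S1 ∪ S2, a i * X i x = u * Zb X b j x + w * Zb X b k x := by
    intro x
    rw [ha, sum_two S1 S2 hd (u/lj) (w/lk) (fun t i => t * X i x), ← Finset.mul_sum, ← Finset.mul_sum, Zb, Zb]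
    ring
  have t1 := hT (b^(2*K)) hbK q (S1 ∪ S2) a (8*U^2) hq hq2 habs (fun i hi => by
      have := (hsub i hi).1
      rw [mul_comm 2 K, pow_mul]; gcongr) (by
      calc (S1 ∪ S2).card ≤ (Finset.Icc 1 (b^(2*K))).card := Finset.card_le_card fun i hi => by
            rw [Finset.mem_Icc]; have := hsub i hi; omega
        _ = _ := by simp) (by positivity) (by rw [← Finset.mul_sum, hsq]; linarith) hUq
  have t2 := cf_gauss h (S1 ∪ S2) a habs
  simp_rw [hsum] at t1
  rw [gauss_cf, gauss_cf, ← Complex.exp_add]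
  rw [hsq] at t2
  have e : Complex.exp (-(σ^2 * u^2/2 : ℝ) + -(σ^2*w^2/2 : ℝ)) = Complex.exp (-(σ^2 * (u^2 + w^2)/2 : ℝ)) := by
    congr 1; push_cast; ring
  rw [e]
  refine (norm_sub_le_norm_sub_add_norm_sub _ _ _).trans ((add_le_add t1 t2).trans ?_)
  linarith

open MeasureTheory Filter ProbabilityTheory

theorem cf2_asym {Ω Ω' : Type*} [MeasurableSpace Ω] [MeasurableSpace Ω'] {P : Measure Ω} {P' : Measure Ω'} [IsProbabilityMeasure P] [IsProbabilityMeasure P']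
    {X : ℕ → Ω → ℝ} {Y : ℕ → Ω' → ℝ} {σ : ℝ} (h : Cmp P P' X Y σ) (b : ℕ) (hb : 2 ≤ b) (C : ℝ) (hC : 0 < C) : ∀ᶠ K : ℕ in atTop, 
    ∀ j ∈ Finset.Ico K (2*K), ∀ k ∈ Finset.Ico K (2*K), j ≠ k → ∀ u w : ℝ, |u| ≤ C * √(Real.log K) → |w| ≤ C * √(Real.log K) →
    ‖(∫ x, Complex.exp ((u * Zb X b j x + w * Zb X b k x : ℝ) * Complex.I) ∂P)
      - (∫ z, Complex.exp ((u * z : ℝ) * Complex.I) ∂(gam σ)) * ∫ z, Complex.exp ((w * z : ℝ) * Complex.I) ∂(gam σ)‖ 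
      ≤ 1/(K:ℝ)^2 := by
  obtain ⟨K0, hK0⟩ := cf2_fin h b hb
  set D : ℝ := 4*C^2*Real.exp 2 + 3 with hD
  have hDpos : 0 < D := by positivity
  have hs2 : (0:ℝ) < √2 := by positivity
  have hs2' : (1:ℝ) < √2 := by rw [Real.lt_sqrt] <;> norm_num
  have hr : |(√2)⁻¹| < 1 := by rw [abs_of_pos (by positivity)]; exact inv_lt_one_of_one_lt₀ hs2'
  have hlim := tendsto_pow_const_mul_const_pow_of_abs_lt_one 5 hr
  have hsm1 : ∀ᶠ K : ℕ in atTop, (K:ℝ)^5 * (√2)⁻¹^K < 1/(C^3*24+C+8) := hlim.eventually_lt_const (by positivity)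
  have hl2 : 0 < Real.log 2 := Real.log_pos (by norm_num)
  filter_upwards [eventually_ge_atTop K0, hsm1, ev_log_le (Real.log 2/32/D) (by positivity), ev_log_le 1 one_pos, 
    tlogK.eventually_ge_atTop 1, eventually_ge_atTop 12, tendsto_natCast_atTop_atTop.eventually_ge_atTop (32/Real.log 2 : ℝ)] with K k0 k1 k2 k3 k4 k5 k6
  set L := Real.log (K:ℝ) with hL
  have hLpos : 0 < L := by linarith
  have hKR : (12:ℝ) ≤ K := by exact_mod_cast k5
  have hU0 : 0 < C * √L := by positivity
  have hsL : √L ≤ K := by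
    rw [Real.sqrt_le_left (by positivity)]; nlinarith
  have hpow : (√2)⁻¹^K = 1/√2^K := by rw [inv_pow, one_div]
  rw [hpow, mul_one_div, div_lt_div_iff₀ (by positivity) (by positivity), one_mul] at k1
  have hbR : (2:ℝ) ≤ b := by exact_mod_cast hb
  have hK5 : (K:ℝ) ≤ K^5 := le_self_pow₀ (by linarith) (by norm_num)
  have hU1 : C * √L ≤ √2^K := by
    have : C * √L ≤ C * (K:ℝ)^5 := by gcongr; linarith
    have : 0 ≤ (K:ℝ)^5 * (C^3*24+8) := by positivity
    linarith
  intro j hj k hk hjk u w hu hw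
  have hDL : D * L ≤ ⌈D*L⌉₊ := Nat.le_ceil _
  have hDL2 : (⌈D*L⌉₊:ℝ) < D*L + 1 := Nat.ceil_lt_add_one (by positivity)
  refine (hK0 K k0 ⌈D*L⌉₊ (C*√L) (Nat.one_le_iff_ne_zero.2 (Nat.ceil_pos.2 (by positivity)).ne') ?_ hU0 hU1 ?_ j hj k hk hjk u w hu hw).trans ?_
  · push_cast
    rw [Real.log_pow]
    push_cast
    have : Real.log 2 ≤ Real.log b := Real.log_le_log (by norm_num) hbR
    have a1 : D * L ≤ Real.log 2 / 32 * K := by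
      have := mul_le_mul_of_nonneg_left k2 hDpos.le
      have e : D * (Real.log 2/32/D*K) = Real.log 2/32*K := by field_simp
      linarith
    rw [div_le_iff₀ hl2] at k6
    have : K * Real.log 2 ≤ K * Real.log b := by gcongr
    linarith
  · rw [mul_pow, Real.sq_sqrt hLpos.le]
    have : D * L = 4*C^2*Real.exp 2 * L + 3 * L := by rw [hD]; ring
    linarith
  · have b1 : 4/((b^(2*K):ℕ):ℝ) ≤ 4 / √2^K := by
      gcongr
      push_cast
      have : (√2:ℝ) ≤ b := by
        have : √2 ≤ 2 := by rw [Real.sqrt_le_left] <;> norm_num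
        linarith
      calc √2^K ≤ √2^(2*K) := pow_le_pow_right₀ hs2'.le (by omega)
        _ ≤ _ := by gcongr
    have b2 : Real.exp (-(⌈D*L⌉₊:ℝ)) ≤ 1/(K:ℝ)^3 := by
      have : (1:ℝ)/(K:ℝ)^3 = Real.exp (-(3*L)) := by
        rw [Real.exp_neg, show 3*L = ((3:ℕ):ℝ)*L by norm_num, Real.exp_nat_mul, hL, Real.exp_log (by positivity), one_div]
      rw [this, Real.exp_le_exp]
      have : 3*L ≤ D*L := by gcongr; rw [hD]; have : 0 ≤ 4*C^2*Real.exp 2 := by positivity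
                             linarith
      linarith
    have b3 : (C*√L)^3 ≤ C^3*(K:ℝ)^3 := by rw [mul_pow]; gcongr
    have b4 : (4 + 12*(C^3*(K:ℝ)^3)) / √2^K ≤ (1/2)/(K:ℝ)^2 := by
      rw [div_le_div_iff₀ (by positivity) (by positivity)]
      have c1 : (K:ℝ)^2 ≤ K^5 := pow_le_pow_right₀ (by linarith) (by norm_num)
      have c2 : 0 ≤ (K:ℝ)^5*C := by positivity
      have c3 : (4 + 12*(C^3*(K:ℝ)^3)) * (K:ℝ)^2 = 4*(K:ℝ)^2 + (K:ℝ)^5*C^3*12 := by ring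
      have c4 : (K:ℝ)^5 * (C^3*24+C+8) = (K:ℝ)^5*C^3*24 + (K:ℝ)^5*C+ (K:ℝ)^5*8 := by ring
      rw [c3]; rw [c4] at k1
      linarith
    have b5 : 4*(1/(K:ℝ)^3) ≤ (1/3)/(K:ℝ)^2 := by
      rw [mul_one_div, div_le_div_iff₀ (by positivity) (by positivity)]
      have c1 := mul_le_mul_of_nonneg_left hKR (sq_nonneg (K:ℝ))
      have c2 : (K:ℝ)^3 = (K:ℝ)^2 * K := by ring
      rw [c2]
      linarith
    have b6 : 0 < 1/(K:ℝ)^2 := by positivity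
    have b7 : 4/((b^(2*K):ℕ):ℝ) + 12 * ((C*√L)^3/√2^K) ≤ (4 + 12*(C^3*(K:ℝ)^3)) / √2^K := by
      rw [add_div, mul_div_assoc]; gcongr
    have e1 : (1/2)/(K:ℝ)^2 = 1/2*(1/(K:ℝ)^2) := by ring
    have e2 : (1/3)/(K:ℝ)^2 = 1/3*(1/(K:ℝ)^2) := by ring
    rw [e1] at b4
    rw [e2] at b5
    linarith

theorem g_lower (σ : ℝ) (hσ : 0 < σ) (a θ w : ℝ) (ha : 0 ≤ a) (hθ : θ * a = Real.pi/2) (hw : 0 < w) (r : ℕ) (hr : r * (θ^2*w^2) ≤ 1/2) (h1 : θ^2*w^2 ≤ 1) :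
    (1/2) * (w * ((√(2*Real.pi*σ^2))⁻¹ * Real.exp (-(a+w)^2/(2*σ^2)))) ≤ ∫ z, sphi θ r z ∂(gam σ) := by
  set γ := gam σ with hγ
  have hv : Real.toNNReal (σ^2) ≠ 0 := by
    rw [Ne, Real.toNNReal_eq_zero]; push Not; positivity
  have hi : Integrable (sphi θ r) γ := Integrable.of_bound (C := 1) (sphi_meas θ r).aestronglyMeasurable
    (ae_of_all _ fun x => by rw [Real.norm_eq_abs, abs_of_nonneg (sphi_nonneg _ _ _)]; exact sphi_le_one _ _ _)
  have s1 : ∫ z in Set.Icc a (a+w), sphi θ r z ∂γ ≤ ∫ z, sphi θ r z ∂γ := 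
    setIntegral_le_integral hi (ae_of_all _ fun x => sphi_nonneg _ _ _)
  have hpt : ∀ z ∈ Set.Icc a (a+w), 1/2 ≤ sphi θ r z := by
    intro z hz
    have e : Real.sin (θ*z) = Real.cos (θ*(z-a)) := by
      rw [show θ*z = θ*(z-a) + Real.pi/2 by rw [mul_sub, hθ]; ring, Real.sin_add_pi_div_two]
    have hzz : (z-a)^2 ≤ w^2 := by
      have : 0 ≤ z - a := by linarith [hz.1]
      have : z - a ≤ w := by linarith [hz.2]
      gcongr
    have c0 : (θ*(z-a))^2 ≤ θ^2*w^2 := by rw [mul_pow]; gcongr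
    have c : 1 - θ^2*w^2 ≤ Real.sin (θ*z)^2 := by
      rw [e, Real.cos_sq']
      have : Real.sin (θ*(z-a))^2 ≤ (θ*(z-a))^2 := by
        rw [sq_le_sq]; exact Real.abs_sin_le_abs
      linarith
    unfold sphi
    have d := one_add_mul_le_pow (a := -(θ^2*w^2)) (by linarith) r
    calc (1/2:ℝ) ≤ 1 + r * -(θ^2*w^2) := by linarith
      _ ≤ _ := d
      _ ≤ _ := by gcongr <;> linarith
  have s2 : (1/2) * γ.real (Set.Icc a (a+w)) ≤ ∫ z in Set.Icc a (a+w), sphi θ r z ∂γ := by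
    have := setIntegral_mono_on (μ := γ) (s := Set.Icc a (a+w)) (f := fun _ => (1/2:ℝ)) (g := sphi θ r) (integrable_const _).integrableOn hi.integrableOn measurableSet_Icc hpt
    simp only [setIntegral_const, smul_eq_mul] at this
    linarith
  refine le_trans ?_ (s2.trans s1)
  gcongr
  rw [Measure.real, hγ, gam, gaussianReal_apply_eq_integral 0 hv, ENNReal.toReal_ofReal (integral_nonneg fun x => gaussianPDFReal_nonneg _ _ _)]
  have := setIntegral_mono_on (μ := volume) (s := Set.Icc a (a+w)) (f := fun _ => ((√(2*Real.pi*σ^2))⁻¹ * Real.exp (-(a+w)^2/(2*σ^2)))) 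
    (g := gaussianPDFReal 0 (Real.toNNReal (σ^2))) continuous_const.integrableOn_Icc 
    (integrable_gaussianPDFReal _ _).integrableOn measurableSet_Icc (by
      intro x hx
      rw [gaussianPDFReal_def]
      simp only [Real.coe_toNNReal _ (sq_nonneg σ), sub_zero]
      have : 0 ≤ x := ha.trans hx.1
      have := hx.2
      gcongr)
  refine le_trans (le_of_eq ?_) this
  rw [setIntegral_const, smul_eq_mul]
  simp [hw.le]

open MeasureTheory Filter ProbabilityTheory

theorem Zb_meas {Ω : Type*} [MeasurableSpace Ω] {X : ℕ → Ω → ℝ} (mX : ∀ n, Measurable (X n)) (b k : ℕ) : Measurable (Zb X b k) := by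
  unfold Zb
  exact (Finset.measurable_fun_sum _ fun i _ => mX i).div_const _

theorem sphi_small (α ρ s : ℝ) (hρ : 0 < ρ) (hα : ρ < α) (hs : 0 < s) (r : ℕ) (z : ℝ) (hz : |z| < ρ * s) :
    sphi (Real.pi/(2*α*s)) r z ≤ (Real.sin (Real.pi*ρ/(2*α))^2)^r := by
  have hα0 : 0 < α := hρ.trans hα
  unfold sphi
  have hpi := Real.pi_pos
  have hup : Real.pi*ρ/(2*α) ≤ Real.pi/2 := by
    rw [div_le_div_iff₀ (by positivity) (by positivity)]; nlinarith
  have key : ∀ y : ℝ, 0 ≤ y → y < ρ*s → Real.sin (Real.pi/(2*α*s)*y)^2 ≤ Real.sin (Real.pi*ρ/(2*α))^2 := by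
    intro y hy0 hy
    have h0 : 0 ≤ Real.pi/(2*α*s)*y := by positivity
    have h1 : Real.pi/(2*α*s)*y ≤ Real.pi*ρ/(2*α) := by
      calc Real.pi/(2*α*s)*y ≤ Real.pi/(2*α*s)*(ρ*s) := by gcongr
        _ = _ := by field_simp
    have h2 := Real.sin_nonneg_of_nonneg_of_le_pi h0 (by linarith)
    have h3 := Real.sin_le_sin_of_le_of_le_pi_div_two (by linarith) hup h1
    gcongr
  refine pow_le_pow_left₀ (sq_nonneg _) ?_ r
  rcases abs_cases z with ⟨h1, h2⟩ | ⟨h1, h2⟩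
  · exact key z h2 (h1 ▸ hz)
  · have := key (-z) (by linarith) (h1 ▸ hz)
    simpa using this

theorem window {Ω Ω' : Type*} [MeasurableSpace Ω] [MeasurableSpace Ω'] {P : Measure Ω} {P' : Measure Ω'} [IsProbabilityMeasure P] [IsProbabilityMeasure P']
    {X : ℕ → Ω → ℝ} {Y : ℕ → Ω' → ℝ} {σ : ℝ} (h : Cmp P P' X Y σ) (hσ : 0 < σ) (b : ℕ) (hb : 2 ≤ b) (ρ : ℝ) (hρ : 0 < ρ) (hρσ : ρ < √2 * σ) :
    Tendsto (fun K : ℕ => P.real {x | ∀ k ∈ Finset.Ico K (2*K), |Zb X b k x| < ρ * √(Real.log K)}) atTop (nhds 0) := by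
  set α : ℝ := (ρ + √2*σ)/2 with hα
  have hα1 : ρ < α := by rw [hα]; linarith
  have hα2 : α < √2*σ := by rw [hα]; linarith
  have hα0 : 0 < α := hρ.trans hα1
  have hpi := Real.pi_pos
  set κ : ℝ := Real.sin (Real.pi*ρ/(2*α))^2 with hκ
  have hκ0 : 0 < κ := by
    have : 0 < Real.sin (Real.pi*ρ/(2*α)) := Real.sin_pos_of_pos_of_lt_pi (by positivity) (by
      rw [div_lt_iff₀ (by positivity)]; nlinarith)
    positivity
  have hκ1 : κ < 1 := by
    have hc : 0 < Real.cos (Real.pi*ρ/(2*α)) := Real.cos_pos_of_mem_Ioo ⟨by 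
      have : 0 < Real.pi*ρ/(2*α) := by positivity
      linarith, by
      rw [div_lt_div_iff₀ (by positivity) (by positivity)]; nlinarith⟩
    have := Real.sin_sq_add_cos_sq (Real.pi*ρ/(2*α))
    have : 0 < Real.cos (Real.pi*ρ/(2*α))^2 := by positivity
    rw [hκ]; linarith
  have hlk : Real.log κ < 0 := Real.log_neg hκ0 hκ1
  set c : ℝ := 2 / (-Real.log κ) with hc
  have hc0 : 0 < c := div_pos two_pos (by linarith)
  set w : ℝ := √(2*α^2/((c+1)*Real.pi^2)) with hw
  have hw2 : w^2 = 2*α^2/((c+1)*Real.pi^2) := Real.sq_sqrt (by positivity)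
  have hw0 : 0 < w := Real.sqrt_pos.2 (by positivity)
  set C : ℝ := Real.pi*(c+1)/α with hC
  have hC0 : 0 < C := by positivity
  let r : ℕ → ℕ := fun K => ⌈c * Real.log K⌉₊
  let θ : ℕ → ℝ := fun K => Real.pi/(2*α*√(Real.log K))
  let t : ℕ → ℝ := fun K => K * ∫ z, sphi (θ K) (r K) z ∂(gam σ)
  -- basic estimates
  have hr : ∀ᶠ K : ℕ in atTop, (r K : ℝ) ≤ (c+1) * Real.log K := by
    filter_upwards [tlogK.eventually_ge_atTop 1] with K hK
    have := (Nat.ceil_lt_add_one (show 0 ≤ c * Real.log K by positivity)).le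
    show (⌈c * Real.log K⌉₊ : ℝ) ≤ _
    linarith
  have ht : Tendsto t atTop atTop := by
    set A0 : ℝ := (1/2) * (w * (√(2*Real.pi*σ^2))⁻¹) with hA0
    have hA : 0 < A0 := by positivity
    set d : ℝ := 1 - α^2/(2*σ^2) with hd
    have hd0 : 0 < d := by
      have : α^2 < 2*σ^2 := by
        have : α^2 < (√2*σ)^2 := by gcongr
        rwa [mul_pow, Real.sq_sqrt (by norm_num)] at this
      rw [hd, sub_pos, div_lt_one (by positivity)]; exact this
    have hy : Tendsto (fun K : ℕ => √(Real.log K)) atTop atTop := Real.tendsto_sqrt_atTop.comp tlogK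
    have hz : Tendsto (fun y : ℝ => A0 * Real.exp (y * (d*y - α*w/σ^2) - w^2/(2*σ^2))) atTop atTop := by
      refine Tendsto.const_mul_atTop hA (Real.tendsto_exp_atTop.comp ?_)
      refine tendsto_atTop_add_const_right _ (-(w^2/(2*σ^2))) ?_
      refine Tendsto.atTop_mul_atTop₀ tendsto_id ?_
      exact tendsto_atTop_add_const_right _ (-(α*w/σ^2)) (tendsto_id.const_mul_atTop hd0)
    refine tendsto_atTop_mono' _ ?_ (hz.comp hy)
    filter_upwards [hr, tlogK.eventually_ge_atTop 1, eventually_ge_atTop 1] with K hrK hK hK1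
    set y := √(Real.log K) with hyy
    have hy0 : 0 < y := Real.sqrt_pos.2 (by linarith)
    have hy2 : y^2 = Real.log K := Real.sq_sqrt (by linarith)
    have hθ2 : (θ K)^2 = Real.pi^2/(4*α^2*y^2) := by
      show (Real.pi/(2*α*y))^2 = _
      rw [div_pow]; ring
    have hθw : (θ K)^2*w^2 = 1/(2*(c+1)*y^2) := by
      rw [hθ2, hw2]; field_simp; norm_num
    have hg := g_lower σ hσ (α*y) (θ K) w (by positivity) (by show Real.pi/(2*α*y) * (α*y) = _; field_simp) hw0 (r K) (by
      rw [hθw, mul_one_div, div_le_iff₀ (by positivity)]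
      rw [← hy2] at hrK
      linarith) (by
      rw [hθw, div_le_one (by positivity)]; nlinarith)
    show A0 * Real.exp (y * (d*y - α*w/σ^2) - w^2/(2*σ^2)) ≤ K * _
    have hKe : (K:ℝ) = Real.exp (y^2) := by rw [hy2, Real.exp_log (by positivity)]
    calc A0 * Real.exp (y * (d*y - α*w/σ^2) - w^2/(2*σ^2)) = 
        A0 * (Real.exp (y^2) * Real.exp (-(α*y+w)^2/(2*σ^2))) := by
          rw [← Real.exp_add]; congr 2; rw [hd]; field_simp; ring
      _ = K * ((1/2) * (w * ((√(2*Real.pi*σ^2))⁻¹ * Real.exp (-(α*y+w)^2/(2*σ^2))))) := by rw [hKe, hA0]; ring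
      _ ≤ _ := by gcongr
  have hfin : Tendsto (fun K => (t K + 4) / (t K/2)^2) atTop (nhds 0) := by
    have h1 : Tendsto (fun y : ℝ => (y + 4)/(y/2)^2) atTop (nhds 0) := by
      have e : (fun y : ℝ => 4 * y⁻¹ + 16 * (y⁻¹ * y⁻¹)) =ᶠ[atTop] (fun y : ℝ => (y + 4)/(y/2)^2) := by
        filter_upwards [eventually_gt_atTop 0] with y hy
        field_simp; ring
      refine Tendsto.congr' e ?_
      have := tendsto_inv_atTop_zero (𝕜 := ℝ)
      simpa using (this.const_mul 4).add ((this.mul this).const_mul 16)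
    exact h1.comp ht
  refine squeeze_zero' (Eventually.of_forall fun _ => measureReal_nonneg) ?_ hfin
  filter_upwards [hr, tlogK.eventually_ge_atTop 1, eventually_ge_atTop 2, ht.eventually_ge_atTop 2, cf2_asym h b hb C hC0] with K hrK hL hK2 htK hcf
  have hKR : (2:ℝ) ≤ K := by exact_mod_cast hK2
  set y := √(Real.log K) with hyy
  have hy0 : 0 < y := Real.sqrt_pos.2 (by linarith)
  have hy2 : y^2 = Real.log K := Real.sq_sqrt (by linarith)
  have hθ0 : 0 ≤ θ K := by show 0 ≤ Real.pi/(2*α*y); positivity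
  have hU : 2 * θ K * r K ≤ C * y := by
    calc 2 * θ K * r K ≤ 2 * θ K * ((c+1)*Real.log K) := by gcongr
      _ = C * y := by
        show 2 * (Real.pi/(2*α*y)) * ((c+1)*Real.log K) = _
        rw [← hy2, hC]; field_simp
  have hpair : ∀ j ∈ Finset.Ico K (2*K), ∀ k ∈ Finset.Ico K (2*K), j ≠ k → 
    |(∫ x, sphi (θ K) (r K) (Zb X b j x) * sphi (θ K) (r K) (Zb X b k x) ∂P) - (∫ z, sphi (θ K) (r K) z ∂(gam σ))^2| ≤ 1/(K:ℝ)^2 ∧ 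
    |(∫ x, sphi (θ K) (r K) (Zb X b j x) ∂P) - (∫ z, sphi (θ K) (r K) z ∂(gam σ))| ≤ 1/(K:ℝ)^2 := fun j hj k hk hjk =>
      sphi_cmp (gam σ) _ _ (Zb_meas h.mX b j) (Zb_meas h.mX b k) (θ K) hθ0 (r K) _ fun u w hu hw =>
        hcf j hj k hk hjk u w (hu.trans hU) (hw.trans hU)
  have hcard : (Finset.Ico K (2*K)).card = K := by simp; omega
  have hsm := second_moment (P := P) (fun k x => sphi (θ K) (r K) (Zb X b k x)) 
    (fun k => (sphi_meas _ _).comp (Zb_meas h.mX b k)) (fun k x => sphi_nonneg _ _ _) (fun k x => sphi_le_one _ _ _)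
    (Finset.Ico K (2*K)) (∫ z, sphi (θ K) (r K) z ∂(gam σ)) (1/(K:ℝ)^2) (integral_nonneg fun z => sphi_nonneg _ _ _)
    (by
      have := integral_mono (μ := gam σ) (f := sphi (θ K) (r K)) (g := fun _ => (1:ℝ)) (Integrable.of_bound (C := 1) (sphi_meas _ _).aestronglyMeasurable
        (ae_of_all _ fun x => by rw [Real.norm_eq_abs, abs_of_nonneg (sphi_nonneg _ _ _)]; exact sphi_le_one _ _ _)) (integrable_const _) (fun x => sphi_le_one _ _ _)
      simpa using this)
    (by positivity)
    (fun j hj => by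
      have : ∃ k ∈ Finset.Ico K (2*K), j ≠ k := by
        rw [Finset.mem_Ico] at hj
        by_cases hjK : j = K
        · exact ⟨K+1, by rw [Finset.mem_Ico]; omega, by omega⟩
        · exact ⟨K, by rw [Finset.mem_Ico]; omega, hjK⟩
      obtain ⟨k, hk, hjk⟩ := this
      exact (hpair j hj k hk hjk).2)
    (fun j hj k hk hjk => (hpair j hj k hk hjk).1)
    (by rw [hcard]; apply le_of_eq; field_simp)
    (by rw [hcard]; exact htK)
  rw [hcard] at hsm
  refine le_trans (measureReal_mono (fun x hx => ?_) (measure_ne_top _ _)) hsm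
  simp only [Set.mem_ofPred_eq] at hx ⊢
  have hκr : κ^(r K) ≤ 1/(K:ℝ)^2 := by
    have e1 : κ^(r K) = Real.exp (r K * Real.log κ) := by rw [Real.exp_nat_mul, Real.exp_log hκ0]
    have e2 : 1/(K:ℝ)^2 = Real.exp (-(2 * Real.log K)) := by
      rw [Real.exp_neg, show 2*Real.log K = ((2:ℕ):ℝ)*Real.log K by norm_num, Real.exp_nat_mul, Real.exp_log (by positivity), one_div]
    rw [e1, e2, Real.exp_le_exp]
    have h1 : c * Real.log K ≤ r K := Nat.le_ceil _
    have h2 : c * Real.log K * Real.log κ = -(2*Real.log K) := by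
      rw [hc]; have := hlk.ne; field_simp
    rw [← h2]
    exact mul_le_mul_of_nonpos_right h1 hlk.le
  calc ∑ k ∈ Finset.Ico K (2*K), sphi (θ K) (r K) (Zb X b k x) ≤ ∑ k ∈ Finset.Ico K (2*K), 1/(K:ℝ)^2 := 
        Finset.sum_le_sum fun k hk => (sphi_small α ρ y hρ hα1 hy0 (r K) _ (hx k hk)).trans hκr
    _ = K * (1/(K:ℝ)^2) := by rw [Finset.sum_const, hcard, nsmul_eq_mul]
    _ ≤ 1 := by rw [mul_one_div, div_le_one (by positivity)]; nlinarith

open MeasureTheory Filter ProbabilityTheory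

theorem lower_Z {Ω Ω' : Type*} [MeasurableSpace Ω] [MeasurableSpace Ω'] {P : Measure Ω} {P' : Measure Ω'} [IsProbabilityMeasure P] [IsProbabilityMeasure P']
    {X : ℕ → Ω → ℝ} {Y : ℕ → Ω' → ℝ} {σ : ℝ} (h : Cmp P P' X Y σ) (hσ : 0 < σ) (b : ℕ) (hb : 2 ≤ b) (ρ : ℝ) (hρ : 0 < ρ) (hρσ : ρ < √2 * σ) :
    ∀ᵐ x ∂P, ∃ᶠ k : ℕ in atTop, ρ * √(Real.log (k/2)) ≤ |Zb X b k x| := by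
  have hz : ∀ K0 : ℕ, ∀ᵐ x ∂P, ¬ ∀ k ≥ K0, |Zb X b k x| < ρ * √(Real.log (k/2)) := by
    intro K0
    rw [ae_iff]
    simp only [not_not]
    have h0 : P.real {x | ∀ k ≥ K0, |Zb X b k x| < ρ * √(Real.log (k/2))} ≤ 0 := by
      refine ge_of_tendsto (window h hσ b hb ρ hρ hρσ) ?_
      filter_upwards [eventually_ge_atTop K0, eventually_ge_atTop 1] with K hK hK1
      refine measureReal_mono (fun x hx => ?_) (measure_ne_top _ _)
      simp only [Set.mem_ofPred_eq] at hx ⊢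
      intro k hk
      rw [Finset.mem_Ico] at hk
      refine (hx k (by omega)).trans_le ?_
      have h1 : (0:ℝ) < k := by exact_mod_cast (show 0 < k by omega)
      have h2 : (k:ℝ) ≤ 2*K := by exact_mod_cast hk.2.le
      gcongr
      linarith
    exact (measureReal_eq_zero_iff).1 (le_antisymm h0 measureReal_nonneg)
  filter_upwards [ae_all_iff.2 hz] with x hx
  rw [frequently_atTop]
  intro K0
  have := hx K0
  push Not at this
  exact this

theorem log_cmp (b : ℕ) (hb : 2 ≤ b) (η : ℝ) (hη0 : 0 < η) (hη : η < 1) : ∀ᶠ k : ℕ in atTop, 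
    η * Real.log (Real.log ((b^(k+1) : ℕ):ℝ)) ≤ Real.log ((k:ℝ)/2) := by
  have hbR : (2:ℝ) ≤ b := by exact_mod_cast hb
  have hlb : 0 < Real.log b := Real.log_pos (by linarith)
  filter_upwards [tlogK.eventually_ge_atTop ((Real.log 2 + η * Real.log (2 * Real.log b))/(1-η)), eventually_ge_atTop 1] with k hk hk1
  have hkR : (1:ℝ) ≤ k := by exact_mod_cast hk1
  rw [div_le_iff₀ (by linarith)] at hk
  push_cast
  rw [Real.log_pow, Real.log_div (by positivity) (by norm_num)]
  push_cast
  have : Real.log ((k+1) * Real.log b) ≤ Real.log (k * (2 * Real.log b)) := by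
    refine Real.log_le_log (by positivity) ?_
    nlinarith
  rw [Real.log_mul (x := (k:ℝ)) (by positivity) (by positivity)] at this
  have := mul_le_mul_of_nonneg_left this hη0.le
  linarith

theorem choose_b (ρ C c : ℝ) (hc : c < ρ) : ∃ b : ℕ, 2 ≤ b ∧ c ≤ ρ * (1 - 1/(b:ℝ)) - C * (√(b:ℝ))⁻¹ := by
  have h1 : Tendsto (fun b : ℕ => 1/(b:ℝ)) atTop (nhds 0) := tendsto_one_div_atTop_nhds_zero_nat
  have h2 : Tendsto (fun b : ℕ => (√(b:ℝ))⁻¹) atTop (nhds 0) := 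
    tendsto_inv_atTop_zero.comp (Real.tendsto_sqrt_atTop.comp tendsto_natCast_atTop_atTop)
  have h3 : Tendsto (fun b : ℕ => ρ * (1 - 1/(b:ℝ)) - C * (√(b:ℝ))⁻¹) atTop (nhds (ρ * (1 - 0) - C * 0)) := 
    ((tendsto_const_nhds.sub h1).const_mul ρ).sub (h2.const_mul C)
  have h4 := h3.eventually_const_le (show c < ρ * (1 - 0) - C * 0 by simpa using hc)
  obtain ⟨b, hb⟩ := (h4.and (eventually_ge_atTop 2)).exists
  exact ⟨b, hb.2, hb.1⟩

theorem lower {Ω Ω' : Type*} [MeasurableSpace Ω] [MeasurableSpace Ω'] {P : Measure Ω} {P' : Measure Ω'} [IsProbabilityMeasure P] [IsProbabilityMeasure P']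
    {X : ℕ → Ω → ℝ} {Y : ℕ → Ω' → ℝ} {σ : ℝ} (h : Cmp P P' X Y σ) (hσ : 0 ≤ σ) (c : ℝ) (hc : c < √2 * σ) :
    ∀ᵐ x ∂P, ∃ᶠ n : ℕ in atTop, c * √(n * Real.log (Real.log n)) ≤ |∑ i ∈ Finset.Icc 1 n, X i x| := by
  rcases le_or_gt c 0 with hc0 | hc0
  · exact ae_of_all _ fun x => Frequently.of_forall fun n => 
      (mul_nonpos_of_nonpos_of_nonneg hc0 (Real.sqrt_nonneg _)).trans (abs_nonneg _)
  have hσ0 : 0 < σ := by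
    rcases hσ.eq_or_lt with h0 | h0
    · rw [← h0, mul_zero] at hc; linarith
    · exact h0
  set ρ : ℝ := (c + √2*σ)/2 with hρ
  have hρ1 : c < ρ := by rw [hρ]; linarith
  have hρ2 : ρ < √2*σ := by rw [hρ]; linarith
  set C : ℝ := √2*σ + 1 with hC
  have hC0 : 0 < C := by positivity
  obtain ⟨b, hb, hbc⟩ := choose_b ρ C c hρ1
  have hbR : (2:ℝ) ≤ b := by exact_mod_cast hb
  set η : ℝ := 1 - 1/(b:ℝ) with hη
  have hη0 : 0 < η := by rw [hη, sub_pos, div_lt_one (by positivity)]; linarith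
  have hη1 : η < 1 := by rw [hη]; have : 0 < 1/(b:ℝ) := by positivity
                         linarith
  filter_upwards [lower_Z h hσ0 b hb ρ (hc0.trans hρ1) hρ2, upper h hσ C (by rw [hC]; linarith)] with x hx1 hx2
  have tb : Tendsto (fun k : ℕ => b^k) atTop atTop := tendsto_pow_atTop_atTop_of_one_lt (by omega)
  have tb1 : Tendsto (fun k : ℕ => b^(k+1)) atTop atTop := tb.comp (tendsto_add_atTop_nat 1)
  refine tb1.frequently (p := fun n : ℕ => c * √(n * Real.log (Real.log n)) ≤ |∑ i ∈ Finset.Icc 1 n, X i x|) ?_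
  have tll : Tendsto (fun n : ℕ => Real.log (Real.log (n:ℝ))) atTop atTop := Real.tendsto_log_atTop.comp tlogK
  refine (hx1.and_eventually ((tb.eventually hx2).and ((log_cmp b hb η hη0 hη1).and ((tb.eventually (tll.eventually_ge_atTop 0)).and (tb.eventually (tlogK.eventually_ge_atTop 1)))))).mono ?_
  rintro k ⟨k1, k2, k3, k4, k5⟩
  set n : ℕ := b^(k+1) with hn
  set m : ℕ := b^k with hm
  set M : ℝ := Real.log (Real.log n) with hM
  have hm0 : (0:ℝ) < m := by rw [hm]; positivity
  have hnm : (n:ℝ) = b * m := by rw [hn, hm]; push_cast; ring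
  have hmn : m ≤ n := Nat.pow_le_pow_right (by omega) (by omega)
  have hmnR : (m:ℝ) ≤ n := by exact_mod_cast hmn
  have hlm : Real.log (Real.log m) ≤ M := by
    rw [hM]
    refine Real.log_le_log (by linarith) (Real.log_le_log hm0 hmnR)
  have hM0 : 0 ≤ M := k4.trans hlm
  have hsplit : ∑ i ∈ Finset.Icc 1 n, X i x = ∑ i ∈ Finset.Icc 1 m, X i x + √(n*η) * Zb X b k x := by
    have e1 : √((b:ℝ)^(k+1) - (b:ℝ)^k) = √(n*η) := by
      congr 1
      rw [hη, hn]; push_cast; field_simp; ring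
    have e2 : √(n*η) * Zb X b k x = ∑ i ∈ Finset.Ioc m n, X i x := by
      rw [Zb, e1, mul_div_cancel₀ _ (Real.sqrt_pos.2 (mul_pos (by linarith) hη0)).ne']
    rw [e2]
    have hd : ∀ j, Finset.Icc 1 j = Finset.Ioc 0 j := fun j => by ext i; simp [Nat.succ_le_iff]
    rw [hd, hd]
    exact (Finset.sum_Ioc_consecutive (fun i => X i x) (Nat.zero_le _) hmn).symm
  have f1 : ρ * √(η * M) ≤ |Zb X b k x| := by
    refine le_trans ?_ k1
    have : 0 < ρ := hc0.trans hρ1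
    gcongr
  have f2 : |∑ i ∈ Finset.Icc 1 m, X i x| ≤ C * ((√b)⁻¹ * √(n*M)) := by
    refine k2.trans ?_
    have : √(m * Real.log (Real.log m)) ≤ (√b)⁻¹ * √(n*M) := by
      rw [← Real.sqrt_inv, ← Real.sqrt_mul (by positivity)]
      refine Real.sqrt_le_sqrt ?_
      rw [hnm]
      have : (b:ℝ)⁻¹ * (b * m * M) = m * M := by field_simp
      rw [this]; gcongr
    gcongr
  have f3 : ρ * η * √(n*M) ≤ √(n*η) * |Zb X b k x| := by
    have : √(n*η) * √(η*M) = η * √(n*M) := by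
      rw [← Real.sqrt_mul (by positivity), show n*η*(η*M) = η^2*(n*M) by ring, Real.sqrt_mul (by positivity), Real.sqrt_sq hη0.le]
    calc _ = √(n*η) * (ρ * √(η*M)) := by rw [mul_assoc, ← this]; ring
      _ ≤ _ := by gcongr
  have f4 : √(n*η) * |Zb X b k x| ≤ |∑ i ∈ Finset.Icc 1 n, X i x| + |∑ i ∈ Finset.Icc 1 m, X i x| := by
    have : √(n*η) * |Zb X b k x| = |∑ i ∈ Finset.Icc 1 n, X i x - ∑ i ∈ Finset.Icc 1 m, X i x| := by
      rw [hsplit, add_sub_cancel_left, abs_mul, abs_of_nonneg (Real.sqrt_nonneg _)]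
    rw [this]; exact abs_sub _ _
  have f5 := mul_le_mul_of_nonneg_right hbc (Real.sqrt_nonneg (n*M))
  have f6 : (ρ * η - C * (√(b:ℝ))⁻¹) * √(n*M) = ρ * η * √(n*M) - C * ((√b)⁻¹ * √(n*M)) := by ring
  linarith

open MeasureTheory Filter ProbabilityTheory
theorem limsup_eq_of (u : ℕ → ℝ) (l : ℝ) (hup : ∀ m : ℕ, ∀ᶠ n in atTop, u n ≤ l + 1/((m:ℝ)+1))
    (hlo : ∀ m : ℕ, ∃ᶠ n in atTop, l - 1/((m:ℝ)+1) ≤ u n) : limsup u atTop = l := by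
  have hb : IsBoundedUnder (· ≤ ·) atTop u := ⟨_, hup 0⟩
  have hcb : IsCoboundedUnder (· ≤ ·) atTop u := IsCoboundedUnder.of_frequently_ge (hlo 0)
  have ht : Tendsto (fun m : ℕ => 1/((m:ℝ)+1)) atTop (nhds 0) := tendsto_one_div_add_atTop_nhds_zero_nat
  apply le_antisymm
  · have h1 : Tendsto (fun m : ℕ => l + 1/((m:ℝ)+1)) atTop (nhds l) := by simpa using ht.const_add l
    exact ge_of_tendsto' h1 fun m => limsup_le_of_le hcb (hup m)
  · have h1 : Tendsto (fun m : ℕ => l - 1/((m:ℝ)+1)) atTop (nhds l) := by simpa using ht.const_sub l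
    exact le_of_tendsto' h1 fun m => le_limsup_of_frequently_le (hlo m) hb

theorem plog_ev : ∀ᶠ N : ℕ in atTop, plog (plog (N:ℝ)) = Real.log (Real.log (N:ℝ)) ∧ 0 < √((N:ℝ) * Real.log (Real.log N)) := by
  have tll : Tendsto (fun n : ℕ => Real.log (Real.log (n:ℝ))) atTop atTop := Real.tendsto_log_atTop.comp tlogK
  filter_upwards [tlogK.eventually_ge_atTop 1, tll.eventually_ge_atTop 1, eventually_ge_atTop 1] with N h1 h2 h3
  have h3R : (1:ℝ) ≤ N := by exact_mod_cast h3
  constructor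
  · simp only [plog]
    rw [max_eq_right h1, max_eq_right h2]
  · exact Real.sqrt_pos.2 (by positivity)

theorem the_cmp (ξ A B : ℝ) (hξ : 0 < ξ) (hA : 1 < A) (hAB : B - A = 1)
    (s : ℕ → ℕ) (hmono : StrictMono s)
    (f : ℝ → ℝ) (hper : ∀ x : ℝ, f (x + 1) = f x)
    (hint : (∫ x in (0:ℝ)..1, f x) = 0)
    (hvar : eVariationOn f (Set.Icc (0:ℝ) 1) ≤ 2) : 
    Cmp (PA A B) PP (fun n x => f (ξ * x ^ s n)) (fun n ω => f (ω n)) (fnorm A B f) where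
  mX n := (f_meas f hper hvar).comp (by fun_prop)
  mY n := (f_meas f hper hvar).comp (measurable_pi_apply n)
  bX n x := f_bound f hper hint hvar _
  bY n x := f_bound f hper hint hvar _
  ind := PP_indep.comp (fun _ => f) (fun _ => f_meas f hper hvar)
  mean n := by
    rw [PP_eval f (f_meas f hper hvar).stronglyMeasurable n, hint]
  var n := by
    rw [PP_eval (fun x => (f x)^2) ((f_meas f hper hvar).pow_const 2).stronglyMeasurable n, fnorm, Real.sq_sqrt]
    · have hp : Function.Periodic (fun x => (f x)^2) 1 := fun x => by simp only [hper]
      have := hp.intervalIntegral_add_eq 0 A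
      rw [zero_add] at this
      rw [this, show B = A + 1 by linarith]
    · exact intervalIntegral.integral_nonneg (by linarith) fun x _ => sq_nonneg _
  H := thmH ξ A B hξ hA hAB s hmono f hper hint hvar

theorem stmt17 (ξ A B : ℝ) (hξ : 0 < ξ) (hA : 1 < A) (hAB : B - A = 1)
    (s : ℕ → ℕ) (hmono : StrictMono s) (hpos : ∀ n, 1 ≤ n → 1 ≤ s n)
    (f : ℝ → ℝ) (hper : ∀ x : ℝ, f (x + 1) = f x)
    (hint : (∫ x in (0:ℝ)..1, f x) = 0)
    (hvar : eVariationOn f (Set.Icc (0:ℝ) 1) ≤ 2) :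
    ∀ᵐ x : ℝ ∂volume, x ∈ Set.Icc A B →
      Filter.atTop.limsup (fun N : ℕ =>
          |∑ n ∈ Finset.Icc 1 N, f (ξ * x ^ s n)| /
            Real.sqrt ((N : ℝ) * plog (plog N))) =
        Real.sqrt 2 * fnorm A B f := by
  have hC := the_cmp ξ A B hξ hA hAB s hmono f hper hint hvar
  haveI : IsProbabilityMeasure (PA A B) := ⟨by simp [PA, hAB]⟩
  have hσ : 0 ≤ fnorm A B f := Real.sqrt_nonneg _
  set σ := fnorm A B f with hσd
  have hm : ∀ m : ℕ, (0:ℝ) < 1/((m:ℝ)+1) := fun m => by positivity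
  have hu := ae_all_iff.2 fun m : ℕ => upper hC hσ (√2*σ + 1/((m:ℝ)+1)) (by linarith [hm m])
  have hl := ae_all_iff.2 fun m : ℕ => lower hC hσ (√2*σ - 1/((m:ℝ)+1)) (by linarith [hm m])
  have hall : ∀ᵐ x ∂(PA A B), Filter.atTop.limsup (fun N : ℕ =>
          |∑ n ∈ Finset.Icc 1 N, f (ξ * x ^ s n)| /
            Real.sqrt ((N : ℝ) * plog (plog N))) = √2 * σ := by
    filter_upwards [hu, hl] with x h1 h2
    refine limsup_eq_of _ _ (fun m => ?_) (fun m => ?_)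
    · filter_upwards [h1 m, plog_ev] with N hN hp
      rw [hp.1, div_le_iff₀ hp.2]; exact hN
    · refine ((h2 m).and_eventually plog_ev).mono ?_
      rintro N ⟨hN, hp⟩
      rw [hp.1, le_div_iff₀ hp.2]; exact hN
  rw [PA, ae_restrict_iff' measurableSet_Ioc] at hall
  have hne : ∀ᵐ x : ℝ ∂volume, x ≠ A := by simp [ae_iff]
  filter_upwards [hall, hne] with x hx hxA hxI
  exact hx ⟨lt_of_le_of_ne hxI.1 (Ne.symm hxA), hxI.2⟩
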